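/- arXiv:2408.16085 — 2 statements merged into one kernel-verified Lean document; each statement's English description precedes it below -/
import Mathlib

section
/- Every C₄-free 1-planar finite simple graph on n ≥ 4 vertices has at most (5/2)·(n − 2) edges. -/
open unitInterval

/-- A (good) drawing of a simple graph in the plane: vertices map to distinct
points, each edge is drawn as a simple continuous arc between its endpoints,
arcs avoid vertex points other than their endpoints, two arcs meet in finitely
many points, and no three arcs pass through a common interior point. -/
structure PlaneDrawing {V : Type*} (G : SimpleGraph V) where
  pos : V → ℝ × ℝ
  pos_inj : Function.Injective pos
  arc : ∀ ⦃u v : V⦄, G.Adj u v → Path (pos u) (pos v)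
  arc_symm : ∀ ⦃u v : V⦄ (h : G.Adj u v), arc h.symm = (arc h).symm
  arc_inj : ∀ ⦃u v : V⦄ (h : G.Adj u v), Function.Injective (arc h)
  no_vertex_mem : ∀ ⦃u v : V⦄ (h : G.Adj u v) (w : V) (t : I),
      arc h t = pos w → w = u ∨ w = v
  finite_inter : ∀ ⦃u v x y : V⦄ (h₁ : G.Adj u v) (h₂ : G.Adj x y),
      s(u, v) ≠ s(x, y) →
      (Set.range (arc h₁) ∩ Set.range (arc h₂)).Finite
  no_triple_point : ∀ ⦃u₁ v₁ u₂ v₂ u₃ v₃ : V⦄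
      (h₁ : G.Adj u₁ v₁) (h₂ : G.Adj u₂ v₂) (h₃ : G.Adj u₃ v₃),
      s(u₁, v₁) ≠ s(u₂, v₂) → s(u₁, v₁) ≠ s(u₃, v₃) → s(u₂, v₂) ≠ s(u₃, v₃) →
      ∀ t₁ t₂ t₃ : I, t₁ ≠ 0 → t₁ ≠ 1 → t₂ ≠ 0 → t₂ ≠ 1 → t₃ ≠ 0 → t₃ ≠ 1 →
      arc h₁ t₁ = arc h₂ t₂ → arc h₂ t₂ = arc h₃ t₃ → False

namespace PlaneDrawing

variable {V : Type*} {G : SimpleGraph V} (D : PlaneDrawing G)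

/-- `p` is an interior point of the arc of the edge `uv`. -/
def IsInteriorPoint {u v : V} (h : G.Adj u v) (p : ℝ × ℝ) : Prop :=
  ∃ t : I, t ≠ 0 ∧ t ≠ 1 ∧ D.arc h t = p

/-- The set of crossing points of the drawing: points where the interiors of
the arcs of two distinct edges meet. -/
def crossings : Set (ℝ × ℝ) :=
  {p | ∃ (u v x y : V) (h₁ : G.Adj u v) (h₂ : G.Adj x y),
    s(u, v) ≠ s(x, y) ∧ D.IsInteriorPoint h₁ p ∧ D.IsInteriorPoint h₂ p}

/-- The number of crossings of the drawing. -/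
noncomputable def crossingCount : ℕ := D.crossings.ncard

/-- The set of crossing points lying on the edge `uv`. -/
def edgeCrossings {u v : V} (h : G.Adj u v) : Set (ℝ × ℝ) :=
  {p | D.IsInteriorPoint h p ∧
    ∃ (x y : V) (h₂ : G.Adj x y), s(u, v) ≠ s(x, y) ∧ D.IsInteriorPoint h₂ p}

/-- A drawing is `k`-plane if every edge is involved in at most `k` crossings. -/
def IsKPlane (k : ℕ) : Prop :=
  ∀ ⦃u v : V⦄ (h : G.Adj u v), (D.edgeCrossings h).ncard ≤ k

end PlaneDrawing

/-- The crossing number of a graph: the minimum number of crossings over all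
drawings. -/
noncomputable def crossingNumber {V : Type*} (G : SimpleGraph V) : ℕ :=
  sInf {c : ℕ | ∃ D : PlaneDrawing G, D.crossingCount = c}

/-- A graph is `k`-planar if it admits a drawing in which every edge is
involved in at most `k` crossings. -/
def KPlanar {V : Type*} (G : SimpleGraph V) (k : ℕ) : Prop :=
  ∃ D : PlaneDrawing G, D.IsKPlane k

/-- `G` has no cycle of length `ℓ`. -/
def HasNoCycleOfLength {V : Type*} (G : SimpleGraph V) (ℓ : ℕ) : Prop :=
  ∀ (v : V) (c : G.Walk v v), c.IsCycle → c.length ≠ ℓ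

/-- The first-return permutation of a permutation of a finite type to a subset. -/
theorem exists_firstReturn {D : Type*} [Finite D] (ρ : Equiv.Perm D) (S : Set D) :
    ∃ π : Equiv.Perm S, ∀ d : S, ∃ k : ℕ, 0 < k ∧ (π d : D) = (ρ ^ k) d ∧
      ∀ j, 0 < j → j < k → (ρ ^ j) (d : D) ∉ S := by
  classical
  have hex : ∀ d : S, ∃ k : ℕ, 0 < k ∧ (ρ ^ k) (d : D) ∈ S := fun d =>
    ⟨orderOf ρ, orderOf_pos ρ, by simp [pow_orderOf_eq_one]⟩
  let k : S → ℕ := fun d => Nat.find (hex d)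
  have hk : ∀ d : S, 0 < k d ∧ (ρ ^ k d) (d : D) ∈ S := fun d => Nat.find_spec (hex d)
  have hmin : ∀ (d : S) (j : ℕ), 0 < j → j < k d → (ρ ^ j) (d : D) ∉ S := fun d j h0 hj h =>
    Nat.find_min (hex d) hj ⟨h0, h⟩
  let f : S → S := fun d => ⟨(ρ ^ k d) d, (hk d).2⟩
  have key : ∀ d d' : S, k d ≤ k d' → f d = f d' → d = d' := by
    intro d d' hle h
    have h1 : (ρ ^ k d) (d : D) = (ρ ^ k d) ((ρ ^ (k d' - k d)) (d' : D)) := by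
      rw [← Equiv.Perm.mul_apply, ← pow_add, Nat.add_sub_cancel' hle]
      exact congrArg Subtype.val h
    have h2 := (ρ ^ k d).injective h1
    rcases Nat.eq_zero_or_pos (k d' - k d) with h0 | h0
    · rw [h0] at h2
      exact Subtype.ext (by simpa using h2)
    · exact absurd (h2 ▸ d.2) (hmin d' _ h0 (Nat.sub_lt (hk d').1 (hk d).1))
  have hinj : Function.Injective f := by
    intro d d' h
    rcases le_total (k d) (k d') with hle | hle
    · exact key d d' hle h
    · exact (key d' d hle h.symm).symm
  refine ⟨Equiv.ofBijective f (Finite.injective_iff_bijective.mp hinj), fun d => ?_⟩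
  exact ⟨k d, (hk d).1, rfl, hmin d⟩

/-- Points of `S` on a common cycle of `ρ` stay on a common cycle of the first-return
permutation. -/
theorem sameCycle_firstReturn {D : Type*} [Finite D] {ρ : Equiv.Perm D} {S : Set D}
    {π : Equiv.Perm S} (hπ : ∀ d : S, ∃ k : ℕ, 0 < k ∧ (π d : D) = (ρ ^ k) d ∧
      ∀ j, 0 < j → j < k → (ρ ^ j) (d : D) ∉ S) {d d' : S} (h : ρ.SameCycle d d') :
    π.SameCycle d d' := by
  obtain ⟨n, hn⟩ := h.exists_nat_pow_eq
  induction n using Nat.strong_induction_on generalizing d with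
  | _ n ih =>
    rcases Nat.eq_zero_or_pos n with h0 | h0
    · subst h0
      have : d = d' := Subtype.ext (by simpa using hn)
      exact this ▸ Equiv.Perm.SameCycle.refl _ _
    · obtain ⟨k, hk0, hk, hmin⟩ := hπ d
      have hkn : k ≤ n := by
        by_contra hlt
        exact hmin n h0 (by omega) (hn ▸ d'.2)
      have h1 : (ρ ^ (n - k)) (π d : D) = d' := by
        rw [hk, ← Equiv.Perm.mul_apply, ← pow_add, Nat.sub_add_cancel hkn, hn]
      have := ih (n - k) (by omega) ⟨(n - k : ℕ), by simpa using h1⟩ h1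
      exact Equiv.Perm.sameCycle_apply_left.mp this

/-- Composing with a transposition of points on different cycles merges these cycles. -/
theorem invariant_of_invariant_mul_swap {D : Type*} [Finite D] [DecidableEq D]
    {π : Equiv.Perm D} {a b : D} (hab : ¬ π.SameCycle a b) {y : D → Prop}
    (hy : ∀ d, y (π (Equiv.swap a b d)) ↔ y d) : (∀ d, y (π d) ↔ y d) ∧ (y a ↔ y b) := by
  have hA : y (π b) ↔ y a := by simpa using hy a
  have hB : y (π a) ↔ y b := by simpa using hy b
  have hother : ∀ d, d ≠ a → d ≠ b → (y (π d) ↔ y d) := fun d h1 h2 => by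
    simpa [Equiv.swap_apply_of_ne_of_ne h1 h2] using hy d
  have hiter : ∀ j : ℕ, y ((π ^ (j + 1)) a) ↔ y (π a) := by
    intro j
    induction j with
    | zero => simp
    | succ j ih =>
      rw [pow_succ', Equiv.Perm.mul_apply]
      by_cases hx : (π ^ (j + 1)) a = a
      · rw [hx]
      · rw [hother _ hx, ih]
        intro hxb
        exact hab ⟨(j + 1 : ℕ), by rw [zpow_natCast]; exact hxb⟩
  have haa : y a ↔ y (π a) := by
    have := hiter (orderOf π - 1)
    rwa [Nat.sub_add_cancel (orderOf_pos π), pow_orderOf_eq_one, Equiv.Perm.one_apply] at this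
  have hab' : y a ↔ y b := haa.trans hB
  refine ⟨fun d => ?_, hab'⟩
  by_cases h1 : d = a
  · subst h1; exact haa.symm
  by_cases h2 : d = b
  · subst h2; exact hA.trans hab'
  exact hother d h1 h2

/-- Contracting the edges of a spanning forest: `κ` swaps the two darts of each edge of the
forest, and the cycles of `ν * κ` are the rotations at the contracted vertices. -/
theorem exists_forest_contraction {D : Type*} [Finite D] (ν : Equiv.Perm D) {α : D → D}
    (hα : Function.Involutive α) (E : Finset D) :
    ∃ κ : Equiv.Perm D, (∀ d, κ d = d ∨ ((d ∈ E ∨ α d ∈ E) ∧ κ d = α d)) ∧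
      ∀ y : D → Prop, (∀ d, y (ν (κ d)) ↔ y d) →
        (∀ d, y (ν d) ↔ y d) ∧ ∀ d ∈ E, (y (α d) ↔ y d) := by
  classical
  induction E using Finset.induction_on with
  | empty => exact ⟨1, by simp, fun y hy => ⟨by simpa using hy, by simp⟩⟩
  | insert a F _ ih =>
    obtain ⟨κ, hκ, hy⟩ := ih
    have hκ' : ∀ d, κ d = d ∨ ((d ∈ insert a F ∨ α d ∈ insert a F) ∧ κ d = α d) := fun d => by
      rcases hκ d with h | ⟨h, h'⟩
      · exact Or.inl h
      · refine Or.inr ⟨h.imp ?_ ?_, h'⟩ <;> exact fun h => Finset.mem_insert_of_mem h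
    by_cases hdone : κ a ≠ a ∨ α a = a ∨ (ν * κ).SameCycle a (α a)
    · refine ⟨κ, hκ', fun y hinv => ?_⟩
      obtain ⟨h1, h2⟩ := hy y hinv
      refine ⟨h1, fun d hd => ?_⟩
      rcases Finset.mem_insert.mp hd with rfl | hd
      · rcases hdone with h | h | h
        · rcases hκ d with h' | ⟨-, h'⟩
          · exact absurd h' h
          · rw [← h', ← h1, hinv]
        · rw [h]
        · obtain ⟨n, hn⟩ := h.exists_nat_pow_eq
          rw [← hn]
          clear hn
          induction n with
          | zero => simp
          | succ n ihn =>
            rw [pow_succ', Equiv.Perm.mul_apply, Equiv.Perm.mul_apply, hinv, ihn]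
      · exact h2 d hd
    · push Not at hdone
      obtain ⟨hκa, hαa, hcyc⟩ := hdone
      have hκαa : κ (α a) = α a := by
        rcases hκ (α a) with h | ⟨-, h⟩
        · exact h
        · rw [hα a] at h
          exact absurd (κ.injective (h.trans hκa.symm)) hαa
      refine ⟨κ * Equiv.swap a (α a), fun d => ?_, fun y hinv => ?_⟩
      · by_cases h1 : d = a
        · subst h1
          exact Or.inr ⟨Or.inl (Finset.mem_insert_self _ _), by simp [hκαa]⟩
        by_cases h2 : d = α a
        · subst h2
          exact Or.inr ⟨Or.inr (by simp [hα a]), by simp [hκa, hα a]⟩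
        simpa [Equiv.swap_apply_of_ne_of_ne h1 h2] using hκ' d
      · obtain ⟨h1, h2⟩ := invariant_of_invariant_mul_swap hcyc (y := y)
          (fun d => by simpa using hinv d)
        obtain ⟨h3, h4⟩ := hy y (fun d => by simpa using h1 d)
        refine ⟨h3, fun d hd => ?_⟩
        rcases Finset.mem_insert.mp hd with rfl | hd
        · exact h2.symm
        · exact h4 d hd

/-- Over `ZMod 2`, a vertex function with vanishing sum over each contracted vertex is the
boundary of a chain supported on the contracted edges. -/
theorem exists_chain_of_sum_eq_zero {D Z W : Type*} [Fintype D] [Finite Z] [DecidableEq Z]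
    [DecidableEq W] {α : D → D} {K : Finset D} {S : Finset D} (vert : D → Z) (lab : D → W)
    (hconn : ∀ y : Z → Prop, (∀ d ∈ K, (y (vert (α d)) ↔ y (vert d))) →
      ∀ d d', lab d = lab d' → (y (vert d) ↔ y (vert d')))
    (C : D → ZMod 2) (hC : ∀ w, ∑ d ∈ S with lab d = w, C d = 0) :
    ∃ c : D → ZMod 2, ∀ z, ∑ d ∈ K, c d * ((if vert d = z then 1 else 0) +
      (if vert (α d) = z then 1 else 0)) = ∑ d ∈ S with vert d = z, C d := by
  classical
  let b : (D → ZMod 2) →ₗ[ZMod 2] (Z → ZMod 2) :=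
    ∑ d ∈ K, (LinearMap.proj d).smulRight (Pi.single (vert d) 1 + Pi.single (vert (α d)) 1)
  let x : Z → ZMod 2 := ∑ d ∈ S, C d • Pi.single (vert d) 1
  suffices hx : x ∈ LinearMap.range b by
    obtain ⟨c, hc⟩ := hx
    refine ⟨c, fun z => ?_⟩
    have := congrFun hc z
    simp only [b, x, LinearMap.sum_apply, Finset.sum_apply, LinearMap.smulRight_apply,
      LinearMap.proj_apply, Pi.smul_apply, Pi.add_apply, Pi.single_apply, smul_eq_mul] at this
    simp only [mul_ite, mul_one, mul_zero] at this
    rw [Finset.sum_filter]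
    simpa [eq_comm] using this
  by_contra hx
  obtain ⟨f, hfx, hf⟩ := Submodule.exists_le_ker_of_notMem hx
  have hfK : ∀ d ∈ K, f (Pi.single (vert d) 1) = f (Pi.single (vert (α d)) 1) := by
    intro d hd
    have h1 : b (Pi.single d 1) = Pi.single (vert d) 1 + Pi.single (vert (α d)) 1 := by
      simp only [b, LinearMap.sum_apply, LinearMap.smulRight_apply, LinearMap.proj_apply]
      rw [Finset.sum_eq_single d]
      · simp
      · intro e _ he; simp [he]
      · intro h; exact absurd hd h
    have h2 : f (b (Pi.single d 1)) = 0 := hf ⟨_, rfl⟩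
    rw [h1, map_add] at h2
    exact CharTwo.add_eq_zero.mp h2
  have hbool : ∀ u v : ZMod 2, (u = 1 ↔ v = 1) → u = v := by decide
  have hconst : ∀ d d', lab d = lab d' →
      f (Pi.single (vert d) 1) = f (Pi.single (vert d') 1) := fun d d' h =>
    hbool _ _ (hconn (fun z => f (Pi.single z 1) = 1) (fun d hd => by rw [hfK d hd]) d d' h)
  apply hfx
  simp only [x, map_sum, map_smul, smul_eq_mul]
  rw [← Finset.sum_fiberwise_of_maps_to (g := lab) (t := S.image lab)
    (fun d hd => Finset.mem_image_of_mem _ hd)]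
  refine Finset.sum_eq_zero fun w hw => ?_
  obtain ⟨d₀, -, rfl⟩ := Finset.mem_image.mp hw
  rw [Finset.sum_congr rfl (g := fun d => C d * f (Pi.single (vert d₀) 1)), ← Finset.sum_mul,
    hC, zero_mul]
  intro d hd
  rw [hconst d d₀ (Finset.mem_filter.mp hd).2]

/-- Contract the edges in `E`, keep the edges in `S` and delete all others: the result is a
rotation system in which every cycle is still the coboundary of a function on faces. -/
theorem exists_minor_rotation {D Z W : Type*} [Fintype D] [Finite Z] [DecidableEq Z]
    [DecidableEq W] (ν : Equiv.Perm D) {α : D → D} (hα : Function.Involutive α)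
    (vert : D → Z) (lab : D → W) (hvert : ∀ d, vert (ν d) = vert d)
    (hlab : ∀ d, lab (ν d) = lab d) {E S : Finset D} (hE : ∀ d ∈ E, α d ∈ E)
    (hElab : ∀ d ∈ E, lab (α d) = lab d) (hS : ∀ d ∈ S, α d ∈ S) (hES : Disjoint E S)
    (hconn : ∀ y : D → Prop, (∀ d, y (ν d) ↔ y d) → (∀ d ∈ E, (y (α d) ↔ y d)) →
      ∀ d d', lab d = lab d' → (y d ↔ y d'))
    (hplanar : ∀ C : D → ZMod 2, (∀ d, C (α d) = C d) → (∀ d, d ∉ E → d ∉ S → C d = 0) →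
      (∀ z, ∑ d with vert d = z, C d = 0) →
      ∃ φ ψ : D → ZMod 2, (∀ d, φ d = ψ (ν d)) ∧ (∀ d, C d = φ d + ψ d) ∧
        ∀ d, d ∈ E ∨ d ∈ S → ψ d = φ (α d)) :
    ∃ π : Equiv.Perm S, (∀ d : S, lab (π d) = lab d) ∧
      (∀ d d' : S, lab d = lab d' → π.SameCycle d d') ∧
      ∀ C : D → ZMod 2, (∀ d ∈ S, C (α d) = C d) → (∀ w, ∑ d ∈ S with lab d = w, C d = 0) →
        ∃ φ : D → ZMod 2, ∀ d : S, φ d = φ (α (π d)) ∧ C d = φ d + φ (α d) := by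
  classical
  obtain ⟨κ, hκ, hy⟩ := exists_forest_contraction ν hα E
  replace hκ : ∀ d, κ d = d ∨ (d ∈ E ∧ κ d = α d) := fun d => by
    rcases hκ d with h | ⟨h | h, h'⟩
    · exact Or.inl h
    · exact Or.inr ⟨h, h'⟩
    · exact Or.inr ⟨by simpa [hα d] using hE _ h, h'⟩
  have hκα : ∀ d, κ d ≠ d → κ (α d) = d := fun d hd => by
    have h1 := ((hκ d).resolve_left hd).2
    rcases hκ (α d) with h | h
    · exact absurd (κ.injective (h.trans h1.symm)) fun h2 => hd (h1.trans h2)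
    · rw [h.2, hα d]
  obtain ⟨π, hπ⟩ := exists_firstReturn (ν * κ) (S : Set D)
  have hlabρ : ∀ d, lab ((ν * κ) d) = lab d := fun d => by
    rw [Equiv.Perm.mul_apply, hlab]
    rcases hκ d with h | ⟨h, h'⟩
    · rw [h]
    · rw [h', hElab d h]
  refine ⟨π, fun d => ?_, fun d d' h => ?_, fun C hCα hC => ?_⟩
  · obtain ⟨k, -, hk, -⟩ := hπ d
    rw [hk]
    clear hk
    induction k with
    | zero => rfl
    | succ k ih => rw [pow_succ', Equiv.Perm.mul_apply, hlabρ, ih]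
  · apply sameCycle_firstReturn hπ
    have hinv := hy (fun x => (ν * κ).SameCycle d x) (fun x => by
      rw [← Equiv.Perm.mul_apply]; exact Equiv.Perm.sameCycle_apply_right)
    exact (hconn _ hinv.1 hinv.2 d d' h).mp (Equiv.Perm.SameCycle.refl _ _)
  · let K : Finset D := Finset.univ.filter fun d => κ d ≠ d
    have hKE : ∀ d ∈ K, d ∈ E := fun d hd =>
      ((hκ d).resolve_left (Finset.mem_filter.mp hd).2).1
    have hKα : ∀ d ∈ K, α d ∈ K := fun d hd => by
      have hd := (Finset.mem_filter.mp hd).2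
      refine Finset.mem_filter.mpr ⟨Finset.mem_univ _, fun h => ?_⟩
      rw [hκα d hd] at h
      exact hd (((hκ d).resolve_left hd).2.trans h.symm)
    have hKα' : ∀ d, α d ∈ K ↔ d ∈ K := fun d =>
      ⟨fun h => by simpa [hα d] using hKα _ h, hKα d⟩
    have hSα' : ∀ d, α d ∈ S ↔ d ∈ S := fun d =>
      ⟨fun h => by simpa [hα d] using hS _ h, hS d⟩
    have hKS : ∀ d ∈ K, d ∉ S := fun d hd => Finset.disjoint_left.mp hES (hKE d hd)
    obtain ⟨c, hc⟩ := exists_chain_of_sum_eq_zero (α := α) (K := K) (S := S) vert lab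
      (fun y hyK => hconn (fun d => y (vert d)) (fun d => by rw [hvert])
        ((hy (fun d => y (vert d)) (fun d => by
        show y (vert (ν (κ d))) ↔ y (vert d)
        rw [hvert]
        by_cases h : κ d = d
        · rw [h]
        · rw [((hκ d).resolve_left h).2]
          exact hyK d (Finset.mem_filter.mpr ⟨Finset.mem_univ _, h⟩))).2)) C hC
    let C' : D → ZMod 2 := fun d => if d ∈ K then c d + c (α d) else if d ∈ S then C d else 0
    obtain ⟨φ, ψ, hφψ, hjump, hψ⟩ := hplanar C' (fun d => by
        simp only [C', hKα', hSα', hα d]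
        by_cases h : d ∈ K
        · simp [h, add_comm]
        · by_cases h' : d ∈ S
          · simp [h, h', hCα d h']
          · simp [h, h'])
      (fun d hE hS => by
        have hdK : d ∉ K := fun h => hE (hKE d h)
        simp [C', hS, hdK]) (fun z => by
        have h1 : ∀ d, C' d = (if d ∈ K then c d + c (α d) else 0) + if d ∈ S then C d else 0 := by
          intro d
          by_cases h : d ∈ K
          · simp [C', h, hKS d h]
          · simp [C', h]
        simp only [h1]
        rw [Finset.sum_add_distrib, CharTwo.add_eq_zero, ← Finset.sum_filter,
          ← Finset.sum_filter, Finset.filter_filter, Finset.filter_filter]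
        have h2 : (Finset.univ.filter fun d => vert d = z ∧ d ∈ S) = S.filter (vert · = z) := by
          ext d; simp [and_comm]
        rw [h2, ← hc z]
        have h3 : (Finset.univ.filter fun d => vert d = z ∧ d ∈ K) = K.filter (vert · = z) := by
          ext d; simp [and_comm]
        rw [h3, Finset.sum_filter]
        simp only [mul_add, Finset.sum_add_distrib]
        rw [← Finset.sum_nbij' (s := K) (t := K) (f := fun d => if vert d = z then c (α d) else 0)
          (g := fun d => c d * if vert (α d) = z then 1 else 0) α α hKα hKα
          (fun d _ => hα d) (fun d _ => hα d) (fun d _ => by rw [hα d]; simp),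
          ← Finset.sum_add_distrib]
        refine Finset.sum_congr rfl fun d _ => ?_
        split_ifs <;> simp)
    refine ⟨φ, fun d => ⟨?_, ?_⟩⟩
    · obtain ⟨k, hk0, hk, hmin⟩ := hπ d
      have hstep : ∀ j, j < k → ψ (((ν * κ) ^ (j + 1)) (d : D)) = φ d := by
        intro j
        induction j with
        | zero =>
          intro _
          have : κ (d : D) = d := by
            by_contra h
            exact hKS d (Finset.mem_filter.mpr ⟨Finset.mem_univ _, h⟩) d.2
          rw [zero_add, pow_one, Equiv.Perm.mul_apply, this, hφψ]
        | succ j ih =>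
          intro hj
          have hprev := ih (by omega)
          have hS' := hmin (j + 1) (by omega) hj
          rw [pow_succ', Equiv.Perm.mul_apply]
          set g := ((ν * κ) ^ (j + 1)) (d : D) with hg
          rw [Equiv.Perm.mul_apply, ← hφψ, ← hprev]
          by_cases h : κ g = g
          · have hgK : g ∉ K := fun hK => (Finset.mem_filter.mp hK).2 h
            have := hjump g
            simp only [C', hgK, if_false] at this
            rw [if_neg (by simpa using hS')] at this
            rw [h]
            exact CharTwo.add_eq_zero.mp this.symm
          · have h' := (hκ g).resolve_left h
            rw [h'.2, hψ g (Or.inl h'.1)]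
      have h1 := hstep (k - 1) (by omega)
      rw [Nat.sub_add_cancel hk0, ← hk] at h1
      rw [← h1, hψ _ (Or.inr (π d).2)]
    · have h1 := hjump d
      have h2 : C' (d : D) = C d := by
        have hdK : (d : D) ∉ K := fun h => hKS d h d.2
        simp [C', hdK]
      rw [← h2, h1, hψ _ (Or.inr d.2)]

/-- The neighbour of a point of the integer grid in one of the four directions. -/
def gridStep (z : ℤ × ℤ) : Fin 4 → ℤ × ℤ :=
  ![(z.1 + 1, z.2), (z.1, z.2 + 1), (z.1 - 1, z.2), (z.1, z.2 - 1)]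

/-- The grid cell, named by its lower left corner, to the left of a directed grid edge. -/
def gridLeft (z : ℤ × ℤ) : Fin 4 → ℤ × ℤ :=
  ![(z.1, z.2), (z.1 - 1, z.2), (z.1 - 1, z.2 - 1), (z.1, z.2 - 1)]

theorem gridStep_gridStep (z : ℤ × ℤ) (k : Fin 4) : gridStep (gridStep z k) (k + 2) = z := by
  fin_cases k <;> simp [gridStep]

theorem gridLeft_gridStep (z : ℤ × ℤ) (k : Fin 4) :
    gridLeft (gridStep z k) (k + 2) = gridLeft z (k - 1) := by
  fin_cases k <;> simp [gridStep, gridLeft]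

theorem fin4_add_two_add_two (k : Fin 4) : k + 2 + 2 = k := by
  fin_cases k <;> rfl

/-- A finitely supported cycle of the grid is the coboundary of a function on cells. -/
theorem exists_grid_potential (c : ℤ × ℤ → Fin 4 → ZMod 2) {L : Finset (ℤ × ℤ)}
    (hL : ∀ z, z ∉ L → ∀ k, c z k = 0) (hsymm : ∀ z k, c (gridStep z k) (k + 2) = c z k)
    (hsum : ∀ z, ∑ k, c z k = 0) :
    ∃ F : ℤ × ℤ → ZMod 2, ∀ z k, c z k = F (gridLeft z k) + F (gridLeft z (k - 1)) := by
  obtain ⟨i₀, hi₀⟩ : ∃ i₀ : ℤ, ∀ i j, i ≤ i₀ → ∀ k, c (i, j) k = 0 := by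
    obtain ⟨b, hb⟩ := (L.image Prod.fst).bddBelow
    refine ⟨b - 1, fun i j hi k => hL _ (fun h => ?_) k⟩
    have : b ≤ i := hb (Finset.mem_coe.mpr (Finset.mem_image_of_mem Prod.fst h))
    omega
  let F : ℤ × ℤ → ZMod 2 := fun z => ∑ i ∈ Finset.Ioc i₀ z.1, c (i, z.2) 1
  have hF0 : ∀ i j, i ≤ i₀ → F (i, j) = 0 := fun i j hi => by
    simp [F, Finset.Ioc_eq_empty_of_le hi]
  have hN : ∀ i j, F (i, j) = F (i - 1, j) + c (i, j) 1 := fun i j => by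
    rcases le_or_gt i i₀ with h | h
    · rw [hF0 _ _ h, hF0 _ _ (by omega), hi₀ _ _ h, add_zero]
    · have : Finset.Ioc i₀ i = insert i (Finset.Ioc i₀ (i - 1)) := by
        ext x; simp only [Finset.mem_Ioc, Finset.mem_insert]; omega
      simp only [F, this]
      rw [Finset.sum_insert (by simp), add_comm]
  have hE0 : ∀ i j, c (i, j) 0 = c (i, j) 1 + c (i - 1, j) 0 + c (i, j - 1) 1 := fun i j => by
    have h2 := hsymm (i, j) 2
    have h3 := hsymm (i, j) 3
    have h := hsum (i, j)
    simp only [gridStep, Matrix.cons_val] at h2 h3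
    rw [Fin.sum_univ_four, ← h2, ← h3] at h
    have e2 : (2 + 2 : Fin 4) = 0 := rfl
    have e3 : (3 + 2 : Fin 4) = 1 := rfl
    rw [e2, e3, add_assoc, add_assoc] at h
    rw [CharTwo.add_eq_zero.mp h]
    ring
  have hE : ∀ i j, c (i, j) 0 = F (i, j) + F (i, j - 1) := by
    intro i j
    rcases le_or_gt i i₀ with h | h
    · rw [hF0 _ _ h, hF0 _ _ h, hi₀ _ _ h, add_zero]
    · induction i, h.le using Int.leInduction with
      | base => exact absurd h (lt_irrefl _)
      | succ i hi ih =>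
        have hprev : c (i, j) 0 = F (i, j) + F (i, j - 1) := by
          rcases hi.lt_or_eq with h | h
          · exact ih h
          · rw [hF0 _ _ h.ge, hF0 _ _ h.ge, hi₀ _ _ h.ge, add_zero]
        rw [hE0, hN (i + 1), hN (i + 1)]
        simp only [add_sub_cancel_right]
        rw [hprev]
        ring
  have two : ∀ a b : ZMod 2, a = b + (b + a) := by decide
  refine ⟨F, fun z k => ?_⟩
  obtain ⟨i, j⟩ := z
  have e0 : (0 - 1 : Fin 4) = 3 := rfl
  have e2 : (2 - 1 : Fin 4) = 1 := rfl
  have e3 : (3 - 1 : Fin 4) = 2 := rfl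
  have h2 := hsymm (i, j) 2
  have h3 := hsymm (i, j) 3
  have f2 : (2 + 2 : Fin 4) = 0 := rfl
  have f3 : (3 + 2 : Fin 4) = 1 := rfl
  rw [f2] at h2
  rw [f3] at h3
  fin_cases k <;> simp only [gridLeft, Fin.zero_eta, Fin.mk_one, Fin.reduceFinMk, e0, e2, e3,
    sub_self, Matrix.cons_val] <;> simp only [gridStep, Matrix.cons_val] at h2 h3
  · exact hE i j
  · rw [hN i j]
    exact two _ _
  · rw [← h2, hE, add_comm]
  · rw [← h3, hN i (j - 1), add_right_comm, CharTwo.add_self_eq_zero, zero_add]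

/-- The rotation system obtained from a finite labelling of grid points by contracting each
label class to a vertex and keeping one grid edge for each `h : H`. -/
theorem exists_grid_rotation {H W : Type*} [Fintype H] [DecidableEq W] (L : Finset (ℤ × ℤ))
    (lab : ℤ × ℤ → W)
    (hconn : ∀ y : ℤ × ℤ → Prop,
      (∀ z ∈ L, ∀ k, gridStep z k ∈ L → lab (gridStep z k) = lab z → (y (gridStep z k) ↔ y z)) →
      ∀ z ∈ L, ∀ z' ∈ L, lab z = lab z' → (y z ↔ y z'))
    (s t : H → W) (hst : ∀ h h', s h ≠ t h') (e : H → ℤ × ℤ) (k : H → Fin 4)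
    (he : ∀ h, e h ∈ L) (hek : ∀ h, gridStep (e h) (k h) ∈ L) (hs : ∀ h, lab (e h) = s h)
    (ht : ∀ h, lab (gridStep (e h) (k h)) = t h)
    (hinj : ∀ h h', e h = e h' → k h = k h' → h = h') :
    ∃ ν τ : Equiv.Perm H, (∀ h, s (ν h) = s h) ∧ (∀ h, t (τ h) = t h) ∧
      (∀ h h', t h = t h' → τ.SameCycle h h') ∧
      ∀ C : H → ZMod 2, (∀ w, ∑ h with s h = w, C h = 0) → (∀ w, ∑ h with t h = w, C h = 0) →
        ∃ φ : H → ZMod 2, ∀ h, φ (τ (ν h)) = φ h ∧ C h = φ h + φ (τ h) := by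
  classical
  let D := L × Fin 4
  let ν₀ : Equiv.Perm D := Equiv.prodCongr (Equiv.refl _) (Equiv.addRight 1)
  let α : D → D := fun d =>
    if h : gridStep d.1 d.2 ∈ L then (⟨gridStep d.1 d.2, h⟩, d.2 + 2) else d
  have hαpos : ∀ (z : ℤ × ℤ) (k : Fin 4) (hz : z ∈ L) (h : gridStep z k ∈ L),
      α (⟨z, hz⟩, k) = (⟨gridStep z k, h⟩, k + 2) := fun z k hz h => dif_pos h
  have hαneg : ∀ (z : ℤ × ℤ) (k : Fin 4) (hz : z ∈ L) (h : gridStep z k ∉ L),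
      α (⟨z, hz⟩, k) = (⟨z, hz⟩, k) := fun z k hz h => dif_neg h
  have hα : Function.Involutive α := by
    rintro ⟨⟨z, hz⟩, k⟩
    by_cases h : gridStep z k ∈ L
    · rw [hαpos z k hz h, hαpos _ _ _ (by rwa [gridStep_gridStep])]
      simp only [gridStep_gridStep, fin4_add_two_add_two]
    · rw [hαneg z k hz h, hαneg z k hz h]
  let E : Finset D := Finset.univ.filter fun d =>
    gridStep d.1 d.2 ∈ L ∧ lab (gridStep d.1 d.2) = lab d.1
  let d : H → D := fun h => (⟨e h, he h⟩, k h)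
  let d' : H → D := fun h => α (d h)
  have hd' : ∀ h, d' h = (⟨gridStep (e h) (k h), hek h⟩, k h + 2) := fun h => hαpos _ _ _ (hek h)
  have hdinj : Function.Injective d := fun h h' heq =>
    hinj h h' (congrArg (fun x : D => (x.1 : ℤ × ℤ)) heq) (congrArg (fun x : D => x.2) heq)
  have hdinj' : Function.Injective d' := hα.injective.comp hdinj
  let l : D → W := fun x => lab x.1
  have hld : ∀ h, l (d h) = s h := hs
  have hld' : ∀ h, l (d' h) = t h := fun h => by simp only [l, hd', ht]
  let S : Finset D := Finset.univ.image d ∪ Finset.univ.image d'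
  have hmem : ∀ x, x ∈ S ↔ (∃ h, d h = x) ∨ ∃ h, d' h = x := by simp [S]
  have hdS : ∀ h, d h ∈ S := fun h => (hmem _).mpr (Or.inl ⟨h, rfl⟩)
  have hdS' : ∀ h, d' h ∈ S := fun h => (hmem _).mpr (Or.inr ⟨h, rfl⟩)
  have hdd : ∀ h h', d h ≠ d' h' := fun h h' heq => by
    have := congrArg l heq
    rw [hld, hld'] at this
    exact hst _ _ this
  have hαd' : ∀ h, α (d' h) = d h := fun h => hα _
  have hSstep : ∀ x ∈ S, gridStep x.1 x.2 ∈ L := fun x hx => by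
    rcases (hmem x).mp hx with ⟨h, rfl⟩ | ⟨h, rfl⟩
    · exact hek h
    · rw [hd']
      simpa only [gridStep_gridStep] using he h
  obtain ⟨π, hπ, hcyc, hplan⟩ := exists_minor_rotation (E := E) (S := S) ν₀ hα
    (fun x : D => x.1) l (fun _ => rfl) (fun _ => rfl)
    (by
      rintro ⟨⟨z, hz⟩, k⟩ hd
      obtain ⟨-, h1, h2⟩ := Finset.mem_filter.mp hd
      rw [hαpos z k hz h1]
      refine Finset.mem_filter.mpr ⟨Finset.mem_univ _, ?_⟩
      simp only [gridStep_gridStep]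
      exact ⟨hz, h2.symm⟩)
    (by
      rintro ⟨⟨z, hz⟩, k⟩ hd
      obtain ⟨-, h1, h2⟩ := Finset.mem_filter.mp hd
      rw [hαpos z k hz h1]
      exact h2)
    (fun x hx => by
      rcases (hmem x).mp hx with ⟨h, rfl⟩ | ⟨h, rfl⟩
      · exact hdS' h
      · rw [hαd']
        exact hdS h)
    (Finset.disjoint_left.mpr fun x hxE hxS => by
      obtain ⟨-, h1, h2⟩ := Finset.mem_filter.mp hxE
      rcases (hmem x).mp hxS with ⟨h, rfl⟩ | ⟨h, rfl⟩
      · exact hst h h ((hs h).symm.trans (h2.symm.trans (ht h)))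
      · rw [hd'] at h2
        simp only [gridStep_gridStep] at h2
        exact hst h h ((hs h).symm.trans (h2.trans (ht h))))
    (by
      rintro y hy1 hy2 ⟨⟨z, hz⟩, k⟩ ⟨⟨z', hz'⟩, k'⟩ hl
      have hrot : ∀ (x : L) (j : Fin 4), y (x, j) ↔ y (x, 0) := by
        intro x j
        have h0 : y (x, 0 + 1) ↔ y (x, 0) := hy1 (x, 0)
        have h1 : y (x, 1 + 1) ↔ y (x, 1) := hy1 (x, 1)
        have h2 : y (x, 2 + 1) ↔ y (x, 2) := hy1 (x, 2)
        fin_cases j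
        · rfl
        · exact h0
        · exact h1.trans h0
        · exact h2.trans (h1.trans h0)
      have := hconn (fun z => ∃ h : z ∈ L, y (⟨z, h⟩, 0)) (fun z hz k hk hlab => by
        have h1 := hy2 (⟨z, hz⟩, k) (Finset.mem_filter.mpr ⟨Finset.mem_univ _, hk, hlab⟩)
        rw [hαpos z k hz hk, hrot, hrot _ k] at h1
        simpa [hk, hz] using h1) z hz z' hz' hl
      rw [hrot, hrot _ k']
      simpa [hz, hz'] using this)
    (by
      intro C hC h0 hsum
      let c : ℤ × ℤ → Fin 4 → ZMod 2 := fun z k => if h : z ∈ L then C (⟨z, h⟩, k) else 0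
      have hc : ∀ (z : ℤ × ℤ) (k : Fin 4) (h : z ∈ L), c z k = C (⟨z, h⟩, k) :=
        fun z k h => dif_pos h
      have hc0 : ∀ z, z ∉ L → ∀ k, c z k = 0 := fun z h k => dif_neg h
      have hc1 : ∀ z k, gridStep z k ∉ L → c z k = 0 := fun z k hk => by
        by_cases hz : z ∈ L
        · rw [hc z k hz]
          exact h0 _ (fun h => hk (Finset.mem_filter.mp h).2.1) fun h => hk (hSstep _ h)
        · exact hc0 z hz k
      obtain ⟨F, hF⟩ := exists_grid_potential c hc0 (fun z k => by
        by_cases hz : z ∈ L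
        · by_cases hk : gridStep z k ∈ L
          · rw [hc z k hz, hc _ _ hk, ← hαpos z k hz hk, hC]
          · rw [hc0 _ hk, hc1 _ _ hk]
        · rw [hc0 z hz, hc1 _ _ (by rwa [gridStep_gridStep])]) (fun z => by
        by_cases hz : z ∈ L
        · rw [← hsum ⟨z, hz⟩]
          refine Finset.sum_bij (fun k _ => (⟨z, hz⟩, k)) (by simp)
            (fun _ _ _ _ h => congrArg (fun x : D => x.2) h) ?_
            fun k _ => hc z k hz
          rintro ⟨x, k⟩ hx
          simp only [Finset.mem_filter, Finset.mem_univ, true_and] at hx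
          exact ⟨k, Finset.mem_univ _, by rw [hx]⟩
        · exact Finset.sum_eq_zero fun k _ => hc0 z hz k)
      refine ⟨fun x => F (gridLeft x.1 x.2), fun x => F (gridLeft x.1 (x.2 - 1)), fun x => ?_,
        ?_, ?_⟩
      · show _ = F (gridLeft x.1 (x.2 + 1 - 1))
        rw [add_sub_cancel_right]
      · rintro ⟨⟨z, hz⟩, k⟩
        rw [← hc z k hz, hF]
      · rintro ⟨⟨z, hz⟩, k⟩ hx
        have hk : gridStep z k ∈ L := by
          rcases hx with h | h
          · exact (Finset.mem_filter.mp h).2.1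
          · exact hSstep _ h
        rw [hαpos z k hz hk]
        simp only [gridLeft_gridStep])
  have hν : ∀ h, ∃ h', (π ⟨d h, hdS h⟩ : D) = d h' := fun h => by
    rcases (hmem _).mp (π ⟨d h, hdS h⟩).2 with ⟨h', h1⟩ | ⟨h', h1⟩
    · exact ⟨h', h1.symm⟩
    · have := hπ ⟨d h, hdS h⟩
      rw [← h1, hld', hld] at this
      exact absurd this.symm (hst _ _)
  have hτ : ∀ h, ∃ h', (π ⟨d' h, hdS' h⟩ : D) = d' h' := fun h => by
    rcases (hmem _).mp (π ⟨d' h, hdS' h⟩).2 with ⟨h', h1⟩ | ⟨h', h1⟩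
    · have := hπ ⟨d' h, hdS' h⟩
      rw [← h1, hld', hld] at this
      exact absurd this (hst _ _)
    · exact ⟨h', h1.symm⟩
  choose ν hν using hν
  choose τ hτ using hτ
  have hνinj : Function.Injective ν := fun h h' heq => by
    have h1 := (hν h).trans ((congrArg d heq).trans (hν h').symm)
    exact hdinj (congrArg Subtype.val (π.injective (Subtype.ext h1)))
  have hτinj : Function.Injective τ := fun h h' heq => by
    have h1 := (hτ h).trans ((congrArg d' heq).trans (hτ h').symm)
    exact hdinj' (congrArg Subtype.val (π.injective (Subtype.ext h1)))
  refine ⟨Equiv.ofBijective ν (Finite.injective_iff_bijective.mp hνinj),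
    Equiv.ofBijective τ (Finite.injective_iff_bijective.mp hτinj), fun h => ?_, fun h => ?_,
    fun h h' hh => ?_, fun C hCs hCt => ?_⟩
  · have := hπ ⟨d h, hdS h⟩
    rwa [hν, hld, hld] at this
  · have := hπ ⟨d' h, hdS' h⟩
    rwa [hτ, hld', hld'] at this
  · obtain ⟨n, hn⟩ := (hcyc ⟨d' h, hdS' h⟩ ⟨d' h', hdS' h'⟩
      (by rw [hld', hld', hh])).exists_nat_pow_eq
    refine ⟨n, ?_⟩
    rw [zpow_natCast]
    set τ' := Equiv.ofBijective τ (Finite.injective_iff_bijective.mp hτinj) with hτ'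
    have hpow : ∀ m : ℕ, ((π ^ m) ⟨d' h, hdS' h⟩ : D) = d' ((τ' ^ m) h) := by
      intro m
      induction m with
      | zero => simp
      | succ m ih =>
        rw [pow_succ', pow_succ', Equiv.Perm.mul_apply, Equiv.Perm.mul_apply]
        rw [show (π ^ m) ⟨d' h, hdS' h⟩ = ⟨d' ((τ' ^ m) h), hdS' _⟩ from Subtype.ext ih, hτ]
        rfl
    exact hdinj' ((hpow n).symm.trans (congrArg Subtype.val hn))
  · let C' : D → ZMod 2 := fun x => Function.extend d C 0 x + Function.extend d' C 0 x
    have hC1 : ∀ h, C' (d h) = C h := fun h => by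
      simp only [C', hdinj.extend_apply]
      rw [Function.extend_apply' _ _ _ (by rintro ⟨h', h1⟩; exact hdd _ _ h1.symm)]
      simp
    have hC2 : ∀ h, C' (d' h) = C h := fun h => by
      simp only [C', hdinj'.extend_apply]
      rw [Function.extend_apply' _ _ _ (by rintro ⟨h', h1⟩; exact hdd _ _ h1)]
      simp
    obtain ⟨φ, hφ⟩ := hplan C' (fun x hx => by
        rcases (hmem x).mp hx with ⟨h, rfl⟩ | ⟨h, rfl⟩
        · rw [hC1]
          exact hC2 h
        · rw [hαd', hC1, hC2]) (fun w => by
        rw [Finset.filter_union, Finset.sum_union, Finset.filter_image, Finset.filter_image,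
          Finset.sum_image hdinj.injOn, Finset.sum_image hdinj'.injOn]
        · simp only [hC1, hC2, hld, hld', hCs, hCt, add_zero]
        · refine Finset.disjoint_filter_filter (Finset.disjoint_left.mpr ?_)
          simp only [Finset.mem_image, Finset.mem_univ, true_and]
          rintro _ ⟨h, rfl⟩ ⟨h', h1⟩
          exact hdd _ _ h1.symm)
    have h1 : ∀ h, φ (d' h) = φ (d (τ h)) := fun h => by
      have := (hφ ⟨d' h, hdS' h⟩).1
      rwa [hτ, hαd'] at this
    refine ⟨fun h => φ (d h), fun h => ⟨?_, ?_⟩⟩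
    · have := (hφ ⟨d h, hdS h⟩).1
      rw [hν] at this
      exact ((this.trans (h1 _)).symm)
    · have := (hφ ⟨d h, hdS h⟩).2
      rw [hC1] at this
      exact this.trans (congrArg _ (h1 h))

/-- The closed grid square of side `δ` with lower left corner `δ • z`. -/
def gridCell (δ : ℝ) (z : ℤ × ℤ) : Set (ℝ × ℝ) :=
  Set.Icc (δ * z.1) (δ * (z.1 + 1)) ×ˢ Set.Icc (δ * z.2) (δ * (z.2 + 1))

theorem isClosed_gridCell (δ : ℝ) (z : ℤ × ℤ) : IsClosed (gridCell δ z) :=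
  isClosed_Icc.prod isClosed_Icc

theorem exists_mem_gridCell {δ : ℝ} (hδ : 0 < δ) (p : ℝ × ℝ) : ∃ z, p ∈ gridCell δ z := by
  have key : ∀ x : ℝ, x ∈ Set.Icc (δ * ⌊x / δ⌋) (δ * (⌊x / δ⌋ + 1)) := fun x => by
    have h1 := Int.floor_le (x / δ)
    have h2 := (Int.lt_floor_add_one (x / δ)).le
    rw [le_div_iff₀ hδ] at h1
    rw [div_le_iff₀ hδ] at h2
    exact ⟨by linarith, by linarith⟩
  exact ⟨(⌊p.1 / δ⌋, ⌊p.2 / δ⌋), key p.1, key p.2⟩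

theorem dist_le_of_mem_gridCell {δ : ℝ} {z : ℤ × ℤ} {p q : ℝ × ℝ} (hp : p ∈ gridCell δ z)
    (hq : q ∈ gridCell δ z) : dist p q ≤ δ := by
  rw [Prod.dist_eq]
  refine max_le ?_ ?_
  · exact (Real.dist_le_of_mem_Icc hp.1 hq.1).trans (by linarith)
  · exact (Real.dist_le_of_mem_Icc hp.2 hq.2).trans (by linarith)

theorem gridCell_inter_gridStep_nonempty {δ : ℝ} (hδ : 0 < δ) (z : ℤ × ℤ) (k : Fin 4) :
    (gridCell δ z ∩ gridCell δ (gridStep z k)).Nonempty := by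
  obtain ⟨i, j⟩ := z
  have hle : ∀ x : ℤ, δ * x ≤ δ * (x + 1) := fun x => by linarith
  have hmem : ∀ x : ℤ, δ * x ∈ Set.Icc (δ * x) (δ * (x + 1)) := fun x => ⟨le_rfl, hle x⟩
  have hmem' : ∀ x y : ℤ, y = x + 1 → δ * y ∈ Set.Icc (δ * x) (δ * (x + 1)) := fun x y h => by
    rw [h, Int.cast_add, Int.cast_one]
    exact ⟨hle x, le_rfl⟩
  fin_cases k
  · exact ⟨(δ * (i + 1 : ℤ), δ * j), ⟨hmem' _ _ rfl, hmem _⟩, hmem _, hmem _⟩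
  · exact ⟨(δ * i, δ * (j + 1 : ℤ)), ⟨hmem _, hmem' _ _ rfl⟩, hmem _, hmem _⟩
  · exact ⟨(δ * i, δ * j), ⟨hmem _, hmem _⟩, hmem' _ _ (sub_add_cancel _ _).symm, hmem _⟩
  · exact ⟨(δ * i, δ * j), ⟨hmem _, hmem _⟩, hmem _, hmem' _ _ (sub_add_cancel _ _).symm⟩

theorem dist_le_of_mem_gridCell_gridStep {δ : ℝ} (hδ : 0 < δ) {z : ℤ × ℤ} {k : Fin 4}
    {p q : ℝ × ℝ} (hp : p ∈ gridCell δ z) (hq : q ∈ gridCell δ (gridStep z k)) :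
    dist p q ≤ 2 * δ := by
  obtain ⟨c, hc, hc'⟩ := gridCell_inter_gridStep_nonempty hδ z k
  have := dist_triangle p c q
  have := dist_le_of_mem_gridCell hp hc
  have := dist_le_of_mem_gridCell hc' hq
  linarith

/-- The grid squares meeting a set. -/
def gridCells (δ : ℝ) (A : Set (ℝ × ℝ)) : Set (ℤ × ℤ) :=
  {z | (gridCell δ z ∩ A).Nonempty}

theorem finite_gridCells {δ : ℝ} (hδ : 0 < δ) {A : Set (ℝ × ℝ)} (hA : Bornology.IsBounded A) :
    (gridCells δ A).Finite := by
  obtain ⟨R, hR⟩ := hA.subset_closedBall 0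
  have key : ∀ (x : ℝ) (i : ℤ), x ∈ Set.Icc (δ * i) (δ * (i + 1)) → |x| ≤ R →
      i ∈ Set.Icc ⌊-(R / δ) - 1⌋ ⌈R / δ⌉ := fun x i hi hx => by
    obtain ⟨h1, h2⟩ := abs_le.mp hx
    constructor
    · refine Int.floor_le_iff.mpr ?_
      have : -(i + 1 : ℝ) ≤ R / δ := by
        rw [le_div_iff₀ hδ]
        linarith [hi.2]
      linarith
    · refine Int.cast_le.mp ((?_ : (i : ℝ) ≤ R / δ).trans (Int.le_ceil _))
      rw [le_div_iff₀ hδ]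
      linarith [hi.1]
  have hfin := Set.finite_Icc ⌊-(R / δ) - 1⌋ ⌈R / δ⌉
  refine (hfin.prod hfin).subset ?_
  rintro ⟨i, j⟩ ⟨p, hp, hpA⟩
  have h := hR hpA
  rw [Metric.mem_closedBall, dist_zero_right, Prod.norm_def, max_le_iff] at h
  exact ⟨key _ _ hp.1 h.1, key _ _ hp.2 h.2⟩

/-- The grid squares meeting a connected set are connected through common sides. -/
theorem iff_of_mem_gridCells {δ : ℝ} (hδ : 0 < δ) {A : Set (ℝ × ℝ)} (hA : Bornology.IsBounded A)
    (hconn : IsPreconnected A) {y : ℤ × ℤ → Prop}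
    (hy : ∀ z ∈ gridCells δ A, ∀ k, gridStep z k ∈ gridCells δ A → y z → y (gridStep z k))
    {z z' : ℤ × ℤ} (hz : z ∈ gridCells δ A) (hz' : z' ∈ gridCells δ A) : y z → y z' := by
  intro hyz
  by_contra hyz'
  have hclosed : ∀ f : ℤ × ℤ → Prop, IsClosed (⋃ w ∈ gridCells δ A ∩ {w | f w}, gridCell δ w) :=
    fun f => ((finite_gridCells hδ hA).inter_of_left _).isClosed_biUnion
      fun w _ => isClosed_gridCell δ w
  have h := isPreconnected_closed_iff.mp hconn _ _ (hclosed y) (hclosed fun w => ¬ y w)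
    (fun p hp => by
      obtain ⟨w, hw⟩ := exists_mem_gridCell hδ p
      by_cases h : y w
      · exact Or.inl (Set.mem_biUnion ⟨⟨p, hw, hp⟩, h⟩ hw)
      · exact Or.inr (Set.mem_biUnion ⟨⟨p, hw, hp⟩, h⟩ hw))
    (by
      obtain ⟨p, hp, hpA⟩ := id hz
      exact ⟨p, hpA, Set.mem_biUnion ⟨hz, hyz⟩ hp⟩)
    (by
      obtain ⟨p, hp, hpA⟩ := id hz'
      exact ⟨p, hpA, Set.mem_biUnion ⟨hz', hyz'⟩ hp⟩)
  obtain ⟨p, hpA, hpU, hpV⟩ := h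
  obtain ⟨⟨i, j⟩, ⟨hw, hyw⟩, hpw⟩ := Set.mem_iUnion₂.mp hpU
  obtain ⟨⟨i', j'⟩, ⟨hw', hyw'⟩, hpw'⟩ := Set.mem_iUnion₂.mp hpV
  have near : ∀ (x : ℝ) (a b : ℤ), x ∈ Set.Icc (δ * a) (δ * (a + 1)) →
      x ∈ Set.Icc (δ * b) (δ * (b + 1)) → b ≤ a + 1 := fun x a b ha hb => by
    have h1 : δ * b ≤ δ * (a + 1) := hb.1.trans ha.2
    exact_mod_cast le_of_mul_le_mul_left h1 hδ
  have hpm : p ∈ gridCell δ (i, j') := ⟨hpw.1, hpw'.2⟩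
  have hm : (i, j') ∈ gridCells δ A := ⟨p, hpm, hpA⟩
  have hym : y (i, j') := by
    have h1 := near _ _ _ hpw.2 hpw'.2
    have h2 := near _ _ _ hpw'.2 hpw.2
    simp only at h1 h2
    rcases (by omega : j' = j ∨ j' = j + 1 ∨ j' = j - 1) with rfl | rfl | rfl
    · exact hyw
    · exact hy _ hw 1 hm hyw
    · exact hy _ hw 3 hm hyw
  have h1 := near _ _ _ hpw.1 hpw'.1
  have h2 := near _ _ _ hpw'.1 hpw.1
  simp only at h1 h2
  rcases (by omega : i' = i ∨ i' = i + 1 ∨ i' = i - 1) with rfl | rfl | rfl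
  · exact hyw' hym
  · exact hyw' (hy _ hm 0 hw' hym)
  · exact hyw' (hy _ hm 2 hw' hym)

open Filter Topology in
/-- Scales at which a finite family of continua looks like a graph drawing. -/
theorem exists_scales {H : Type*} [Finite H] {A : H → Set (ℝ × ℝ)} {s t : H → ℝ × ℝ}
    (hcomp : ∀ h, IsCompact (A h))
    (hterm : ∀ h, ∀ p ∈ Set.range s ∪ Set.range t, p ∈ A h → p = s h ∨ p = t h)
    (hinter : ∀ h h', h ≠ h' → ∀ a ∈ A h, a ∈ A h' → a ∈ Set.range s ∪ Set.range t) :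
    ∃ r δ : ℝ, 0 < δ ∧ δ ≤ r ∧
      (∀ p ∈ Set.range s ∪ Set.range t, ∀ q ∈ Set.range s ∪ Set.range t, p ≠ q →
        4 * r < dist p q) ∧
      (∀ h, ∀ p ∈ Set.range s ∪ Set.range t, p ≠ s h → p ≠ t h → ∀ a ∈ A h, 2 * r < dist a p) ∧
      (∀ h h', h ≠ h' → ∀ a ∈ A h, ∀ a' ∈ A h', dist a a' ≤ δ →
        ∃ p ∈ Set.range s ∪ Set.range t, dist a p < r) := by
  set T := Set.range s ∪ Set.range t with hTdef
  have hT : T.Finite := (Set.finite_range s).union (Set.finite_range t)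
  have hsmall : ∀ c ε : ℝ, 0 < ε → ∀ᶠ r in 𝓝[>] (0 : ℝ), c * r < ε := fun c ε hε => by
    have : Tendsto (fun r : ℝ => c * r) (𝓝[>] 0) (𝓝 (c * 0)) :=
      (continuous_const_mul c).continuousAt.tendsto.mono_left nhdsWithin_le_nhds
    rw [mul_zero] at this
    exact this.eventually (gt_mem_nhds hε)
  have h1 : ∀ᶠ r in 𝓝[>] (0 : ℝ), ∀ p ∈ T, ∀ q ∈ T, p ≠ q → 4 * r < dist p q := by
    refine (eventually_all_finite hT).mpr fun p _ => (eventually_all_finite hT).mpr fun q _ => ?_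
    by_cases hpq : p = q
    · simp [hpq]
    · filter_upwards [hsmall 4 _ (dist_pos.mpr hpq)] with r hr _ using hr
  have h2 : ∀ᶠ r in 𝓝[>] (0 : ℝ), ∀ h, ∀ p ∈ T, p ≠ s h → p ≠ t h → ∀ a ∈ A h,
      2 * r < dist a p := by
    refine eventually_all.mpr fun h => (eventually_all_finite hT).mpr fun p hp => ?_
    by_cases hpA : p ∈ A h
    · exact Eventually.of_forall fun r hs ht => absurd (hterm h p hp hpA) (by simp [hs, ht])
    · rcases (A h).eq_empty_or_nonempty with he | hne
      · simp [he]
      · have := ((hcomp h).isClosed.notMem_iff_infDist_pos hne).mp hpA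
        filter_upwards [hsmall 2 _ this] with r hr _ _ a ha
        rw [dist_comm]
        exact hr.trans_le (Metric.infDist_le_dist_of_mem ha)
  obtain ⟨r, hr1, hr2, hr0 : 0 < r⟩ := (h1.and (h2.and self_mem_nhdsWithin)).exists
  have h3 : ∀ᶠ δ in 𝓝[>] (0 : ℝ), ∀ h h', h ≠ h' → ∀ a ∈ A h, ∀ a' ∈ A h', dist a a' ≤ δ →
      ∃ p ∈ T, dist a p < r := by
    refine eventually_all.mpr fun h => eventually_all.mpr fun h' => ?_
    by_cases hne : h = h'
    · simp [hne]
    have hK : IsCompact (A h \ ⋃ p ∈ T, Metric.ball p r) :=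
      (hcomp h).diff (isOpen_biUnion fun _ _ => Metric.isOpen_ball)
    obtain ⟨ε, hε, hlt⟩ := Metric.exists_pos_forall_lt_edist hK (hcomp h').isClosed
      (Set.disjoint_left.mpr fun a ha ha' => ha.2 (Set.mem_biUnion
        (hinter h h' hne a ha.1 ha') (Metric.mem_ball_self hr0)))
    filter_upwards [hsmall 1 ε hε] with δ hδ _ a ha a' ha' hd
    by_contra hcon
    push Not at hcon
    have := hlt a ⟨ha, fun hmem => by
      obtain ⟨p, hp, hpa⟩ := Set.mem_iUnion₂.mp hmem
      exact absurd hpa (not_lt.mpr (hcon p hp))⟩ a' ha'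
    rw [edist_nndist, ENNReal.coe_lt_coe, ← NNReal.coe_lt_coe, coe_nndist] at this
    linarith
  obtain ⟨δ, hδ3, hδr, hδ0 : 0 < δ⟩ :=
    (h3.and ((hsmall 1 r hr0).and self_mem_nhdsWithin)).exists
  exact ⟨r, δ, hδ0, by linarith, hr1, hr2, hδ3⟩

/-- Grid points joined to `B` by a grid path inside `R` that avoids `B'` after its start. -/
inductive GridReach (R B B' : Set (ℤ × ℤ)) : ℤ × ℤ → Prop
  | base {z : ℤ × ℤ} : z ∈ R → z ∈ B → GridReach R B B' z
  | step {z : ℤ × ℤ} (k : Fin 4) : GridReach R B B' z → gridStep z k ∈ R → gridStep z k ∉ B' →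
      GridReach R B B' (gridStep z k)

theorem GridReach.mem {R B B' : Set (ℤ × ℤ)} {z : ℤ × ℤ} (hz : GridReach R B B' z) : z ∈ R := by
  cases hz <;> assumption

theorem GridReach.notMem {R B B' : Set (ℤ × ℤ)} (hB : Disjoint B B') {z : ℤ × ℤ}
    (hz : GridReach R B B' z) : z ∉ B' := by
  cases hz with
  | base _ h => exact Set.disjoint_left.mp hB h
  | step k _ _ h => exact h

/-- A finite family of continua in the plane, pairwise disjoint outside their terminals, has a
rotation system for which every cycle is a coboundary. -/
theorem exists_rotation_of_continua {H : Type*} [Fintype H] {A : H → Set (ℝ × ℝ)}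
    {s t : H → ℝ × ℝ} (hcomp : ∀ h, IsCompact (A h)) (hconn : ∀ h, IsPreconnected (A h))
    (hs : ∀ h, s h ∈ A h) (ht : ∀ h, t h ∈ A h) (hst : ∀ h h', s h ≠ t h')
    (hterm : ∀ h, ∀ p ∈ Set.range s ∪ Set.range t, p ∈ A h → p = s h ∨ p = t h)
    (hinter : ∀ h h', h ≠ h' → ∀ a ∈ A h, a ∈ A h' → a ∈ Set.range s ∪ Set.range t) :
    ∃ ν τ : Equiv.Perm H, (∀ h, s (ν h) = s h) ∧ (∀ h, t (τ h) = t h) ∧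
      (∀ h h', t h = t h' → τ.SameCycle h h') ∧
      ∀ C : H → ZMod 2, (∀ w, ∑ h with s h = w, C h = 0) → (∀ w, ∑ h with t h = w, C h = 0) →
        ∃ φ : H → ZMod 2, ∀ h, φ (τ (ν h)) = φ h ∧ C h = φ h + φ (τ h) := by
  classical
  obtain ⟨r, δ, hδ, hδr, hsep, hfar, hnear⟩ := exists_scales hcomp hterm hinter
  set T := Set.range s ∪ Set.range t with hTdef
  have hTfin : T.Finite := (Set.finite_range s).union (Set.finite_range t)
  have hsT : ∀ h, s h ∈ T := fun h => Or.inl ⟨h, rfl⟩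
  have htT : ∀ h, t h ∈ T := fun h => Or.inr ⟨h, rfl⟩
  let B : ℝ × ℝ → Set (ℤ × ℤ) := fun p => gridCells δ (Metric.closedBall p r)
  have hBB : ∀ p ∈ T, ∀ q ∈ T, ∀ z, z ∈ B p → z ∈ B q → p = q := by
    rintro p hp q hq z ⟨a, ha, hap⟩ ⟨b, hb, hbq⟩
    by_contra hpq
    have := hsep p hp q hq hpq
    have := dist_triangle4 p a b q
    have := dist_le_of_mem_gridCell ha hb
    rw [Metric.mem_closedBall] at hap hbq
    rw [dist_comm] at hap
    linarith
  have hBB' : ∀ p ∈ T, ∀ q ∈ T, ∀ z k, z ∈ B p → gridStep z k ∈ B q → p = q := by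
    rintro p hp q hq z k ⟨a, ha, hap⟩ ⟨b, hb, hbq⟩
    by_contra hpq
    have := hsep p hp q hq hpq
    have := dist_triangle4 p a b q
    have := dist_le_of_mem_gridCell_gridStep hδ ha hb
    rw [Metric.mem_closedBall] at hap hbq
    rw [dist_comm] at hap
    linarith
  have hAB : ∀ h, ∀ p ∈ T, ∀ z ∈ gridCells δ (A h), z ∈ B p → p = s h ∨ p = t h := by
    rintro h p hp z ⟨a, ha, haA⟩ ⟨b, hb, hbp⟩
    by_contra hcon
    push Not at hcon
    have := hfar h p hp hcon.1 hcon.2 a haA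
    have := dist_triangle a b p
    have := dist_le_of_mem_gridCell ha hb
    rw [Metric.mem_closedBall] at hbp
    linarith
  have hAA : ∀ h h', h ≠ h' → ∀ z ∈ gridCells δ (A h), z ∈ gridCells δ (A h') →
      ∃ p ∈ T, z ∈ B p := by
    rintro h h' hne z ⟨a, ha, haA⟩ ⟨b, hb, hbA⟩
    obtain ⟨p, hp, hpa⟩ := hnear h h' hne a haA b hbA (dist_le_of_mem_gridCell ha hb)
    exact ⟨p, hp, a, ha, Metric.mem_closedBall.mpr hpa.le⟩
  let R : H → ℤ × ℤ → Prop := fun h => GridReach (gridCells δ (A h)) (B (t h)) (B (s h))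
  have hdisj : ∀ h, Disjoint (B (t h)) (B (s h)) := fun h =>
    Set.disjoint_left.mpr fun z hz hz' => hst h h (hBB _ (hsT h) _ (htT h) z hz' hz)
  have hRB : ∀ h z, R h z → ∀ p ∈ T, z ∈ B p → p = t h := fun h z hz p hp hzp =>
    (hAB h p hp z hz.mem hzp).resolve_left fun hps => hz.notMem (hdisj h) (hps ▸ hzp)
  let Lset : Set (ℤ × ℤ) := (⋃ p ∈ T, B p) ∪ ⋃ h, gridCells δ (A h) ∩ {z | R h z}
  have hLfin : Lset.Finite :=
    (hTfin.biUnion fun p _ => finite_gridCells hδ Metric.isBounded_closedBall).union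
      (Set.finite_iUnion fun h => (finite_gridCells hδ (hcomp h).isBounded).inter_of_left _)
  let IsLab : ℤ × ℤ → ℝ × ℝ → Prop := fun z p => (p ∈ T ∧ z ∈ B p) ∨ ∃ h, R h z ∧ p = t h
  have hIsLab : ∀ z p q, IsLab z p → IsLab z q → p = q := by
    rintro z p q (⟨hp, hzp⟩ | ⟨h, hz, rfl⟩) (⟨hq, hzq⟩ | ⟨h', hz', rfl⟩)
    · exact hBB p hp q hq z hzp hzq
    · exact hRB h' z hz' p hp hzp
    · exact (hRB h z hz q hq hzq).symm
    · by_cases hne : h = h'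
      · rw [hne]
      · obtain ⟨p, hp, hzp⟩ := hAA h h' hne z hz.mem hz'.mem
        rw [← hRB h z hz p hp hzp, ← hRB h' z hz' p hp hzp]
  let lab : ℤ × ℤ → ℝ × ℝ := fun z => if h : ∃ p, IsLab z p then h.choose else 0
  have hlab : ∀ z p, IsLab z p → lab z = p := fun z p hzp => by
    have hex : ∃ p, IsLab z p := ⟨p, hzp⟩
    simp only [lab, dif_pos hex]
    exact hIsLab z _ _ hex.choose_spec hzp
  let L := hLfin.toFinset
  have hLmem : ∀ z, z ∈ L ↔ ∃ p, IsLab z p := fun z => by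
    simp only [L, Set.Finite.mem_toFinset, Lset, Set.mem_union, Set.mem_iUnion, IsLab]
    constructor
    · rintro (⟨p, hp, hz⟩ | ⟨h, -, hz⟩)
      · exact ⟨p, Or.inl ⟨hp, hz⟩⟩
      · exact ⟨t h, Or.inr ⟨h, hz, rfl⟩⟩
    · rintro ⟨p, ⟨hp, hz⟩ | ⟨h, hz, -⟩⟩
      · exact Or.inl ⟨p, hp, hz⟩
      · exact Or.inr ⟨h, hz.mem, hz⟩
  have hedge : ∀ h, ∃ z k, z ∈ B (s h) ∧ R h (gridStep z k) ∧ gridStep z k ∉ B (t h) := by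
    intro h
    by_contra hcon
    have hmem : ∀ p ∈ A h, ∃ z ∈ gridCells δ (A h), z ∈ B p := fun p hp => by
      obtain ⟨z, hz⟩ := exists_mem_gridCell hδ p
      exact ⟨z, ⟨p, hz, hp⟩, p, hz, Metric.mem_closedBall_self (hδ.le.trans hδr)⟩
    obtain ⟨z₁, hz₁, hz₁'⟩ := hmem _ (hs h)
    obtain ⟨z₂, hz₂, hz₂'⟩ := hmem _ (ht h)
    refine GridReach.notMem (hdisj h) (iff_of_mem_gridCells hδ (hcomp h).isBounded (hconn h)
      (y := R h) (fun z _ k hk hyz => ?_) hz₂ hz₁ (GridReach.base hz₂ hz₂')) hz₁'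
    refine GridReach.step k hyz hk fun hks => hcon ⟨gridStep z k, k + 2, hks, ?_⟩
    rw [gridStep_gridStep]
    exact ⟨hyz, fun hzt => hst h h (hBB' _ (htT h) _ (hsT h) z k hzt hks).symm⟩
  choose e k he hek hekt using hedge
  have hlabe : ∀ h, IsLab (e h) (s h) := fun h => Or.inl ⟨hsT h, he h⟩
  have hlabek : ∀ h, IsLab (gridStep (e h) (k h)) (t h) := fun h => Or.inr ⟨h, hek h, rfl⟩
  refine exists_grid_rotation L lab (fun y hy => ?_) s t hst e k
    (fun h => (hLmem _).mpr ⟨_, hlabe h⟩) (fun h => (hLmem _).mpr ⟨_, hlabek h⟩)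
    (fun h => hlab _ _ (hlabe h)) (fun h => hlab _ _ (hlabek h)) fun h h' h1 h2 => ?_
  · choose c hc using exists_mem_gridCell hδ
    have hcB : ∀ p, c p ∈ B p := fun p =>
      ⟨p, hc p, Metric.mem_closedBall_self (hδ.le.trans hδr)⟩
    have hstep : ∀ z k p, IsLab z p → IsLab (gridStep z k) p → (y (gridStep z k) ↔ y z) :=
      fun z k p h h' => hy z ((hLmem z).mpr ⟨p, h⟩) k ((hLmem _).mpr ⟨p, h'⟩)
        ((hlab _ _ h').trans (hlab _ _ h).symm)
    have hB : ∀ p ∈ T, ∀ z ∈ B p, (y z ↔ y (c p)) := fun p hp z hz =>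
      have hconn := fun y' hy' => iff_of_mem_gridCells hδ Metric.isBounded_closedBall
        (convex_closedBall p r).isPreconnected (y := y') hy' (z := c p) (z' := z) (hcB p) hz
      (hconn (fun w => y w ↔ y (c p)) (fun w hw k hk h =>
        (hstep w k p (Or.inl ⟨hp, hw⟩) (Or.inl ⟨hp, hk⟩)).trans h) Iff.rfl)
    have hR : ∀ h z, R h z → (y z ↔ y (c (t h))) := fun h z hz => by
      induction hz with
      | base _ hz => exact hB _ (htT h) _ hz
      | step k hz hk hks ih =>
        exact (hstep _ k (t h) (Or.inr ⟨h, hz, rfl⟩)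
          (Or.inr ⟨h, GridReach.step k hz hk hks, rfl⟩)).trans ih
    have hall : ∀ z p, IsLab z p → (y z ↔ y (c p)) := by
      rintro z p (⟨hp, hz⟩ | ⟨h, hz, rfl⟩)
      · exact hB p hp z hz
      · exact hR h z hz
    intro z hz z' hz' heq
    obtain ⟨p, hp⟩ := (hLmem z).mp hz
    obtain ⟨q, hq⟩ := (hLmem z').mp hz'
    rw [hlab _ _ hp, hlab _ _ hq] at heq
    subst heq
    exact (hall z p hp).trans (hall z' p hq).symm
  · by_contra hne
    have hmem : gridStep (e h) (k h) ∈ gridCells δ (A h') := by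
      rw [h1, h2]
      exact (hek h').mem
    obtain ⟨p, hp, hzp⟩ := hAA h h' hne _ (hek h).mem hmem
    rw [hRB h _ (hek h) p hp hzp] at hzp
    exact hekt h hzp

open Classical in
/-- A rotation system at the vertices (`ν`) and edge midpoints (`τ`) of a graph in which every
cycle is the coboundary of a function on faces. Midpoints of crossing edges are identified. -/
structure IsPlanarRotation {V : Type*} {G : SimpleGraph V} [Fintype G.Dart]
    (ν τ : Equiv.Perm G.Dart) : Prop where
  fst_apply : ∀ h, (ν h).fst = h.fst
  sameCycle_symm : ∀ h, τ.SameCycle h h.symm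
  pow_four : ∀ h, (τ ^ 4) h = h
  coboundary : ∀ C : G.Dart → ZMod 2, (∀ v, ∑ h with h.fst = v, C h = 0) →
    (∀ P : G.Dart → Prop, (∀ h, P (τ h) ↔ P h) → ∑ h with P h, C h = 0) →
    ∃ φ : G.Dart → ZMod 2, ∀ h, φ (τ (ν h)) = φ h ∧ C h = φ h + φ (τ h)

namespace PlaneDrawing

variable {V : Type*} {G : SimpleGraph V} (D : PlaneDrawing G)

theorem isInteriorPoint_symm {u v : V} (h : G.Adj u v) (p : ℝ × ℝ) :
    D.IsInteriorPoint h.symm p ↔ D.IsInteriorPoint h p := by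
  have key : ∀ {u v : V} (h : G.Adj u v), D.IsInteriorPoint h.symm p → D.IsInteriorPoint h p := by
    rintro u v h ⟨t, h0, h1, ht⟩
    refine ⟨unitInterval.symm t, ?_, ?_, ?_⟩
    · rwa [Ne, unitInterval.symm_eq_zero]
    · rwa [Ne, unitInterval.symm_eq_one]
    · rw [D.arc_symm h] at ht
      exact ht
  exact ⟨key h, key h.symm⟩

theorem edgeCrossings_symm {u v : V} (h : G.Adj u v) :
    D.edgeCrossings h.symm = D.edgeCrossings h := by
  ext p
  unfold edgeCrossings
  rw [Set.mem_ofPred_eq, Set.mem_ofPred_eq, isInteriorPoint_symm, Sym2.eq_swap]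

theorem finite_edgeCrossings [Finite V] {u v : V} (h : G.Adj u v) :
    (D.edgeCrossings h).Finite := by
  have : D.edgeCrossings h ⊆ ⋃ x, ⋃ y, ⋃ h₂ : G.Adj x y, ⋃ _ : s(u, v) ≠ s(x, y),
      Set.range (D.arc h) ∩ Set.range (D.arc h₂) := by
    rintro p ⟨⟨t, -, -, ht⟩, x, y, h₂, hne, t', -, -, ht'⟩
    simp only [Set.mem_iUnion]
    exact ⟨x, y, h₂, hne, ⟨t, ht⟩, t', ht'⟩
  refine Set.Finite.subset ?_ this
  exact Set.finite_iUnion fun x => Set.finite_iUnion fun y => Set.finite_iUnion fun h₂ =>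
    Set.finite_iUnion fun hne => D.finite_inter h h₂ hne

open Classical in
/-- The crossing point of a dart, or its midpoint if there is none. -/
noncomputable def mid (h : G.Dart) : ℝ × ℝ :=
  if hne : (D.edgeCrossings h.adj).Nonempty then hne.some
  else D.arc h.adj ⟨1 / 2, by norm_num, by norm_num⟩

open Classical in
theorem mid_symm (h : G.Dart) : D.mid h.symm = D.mid h := by
  have h1 : D.arc h.symm.adj ⟨1 / 2, by norm_num, by norm_num⟩ =
      D.arc h.adj ⟨1 / 2, by norm_num, by norm_num⟩ := by
    have harc : D.arc h.symm.adj = (D.arc h.adj).symm := D.arc_symm h.adj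
    refine (DFunLike.congr_fun harc _).trans (congrArg (D.arc h.adj) (Subtype.ext ?_))
    rw [unitInterval.coe_symm_eq]
    norm_num
  have h2 : D.edgeCrossings h.symm.adj = D.edgeCrossings h.adj := D.edgeCrossings_symm h.adj
  have key : ∀ (S S' : Set (ℝ × ℝ)) (p : ℝ × ℝ), S = S' →
      (if hne : S.Nonempty then hne.some else p) = if hne : S'.Nonempty then hne.some else p := by
    rintro S _ p rfl
    rfl
  exact (key _ _ _ h2).trans (by rw [h1]; rfl)

theorem isInteriorPoint_mid (h : G.Dart) : D.IsInteriorPoint h.adj (D.mid h) := by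
  unfold mid
  split_ifs with hne
  · exact hne.some_mem.1
  · refine ⟨_, fun h0 => ?_, fun h1 => ?_, rfl⟩
    · have := congrArg Subtype.val h0
      norm_num at this
    · have := congrArg Subtype.val h1
      norm_num at this

theorem eq_mid [Finite V] (hD : D.IsKPlane 1) {h h' : G.Dart} (hne : h.edge ≠ h'.edge)
    {p : ℝ × ℝ} (hp : D.IsInteriorPoint h.adj p) (hp' : D.IsInteriorPoint h'.adj p) :
    p = D.mid h := by
  have hmem : p ∈ D.edgeCrossings h.adj := ⟨hp, _, _, h'.adj, hne, hp'⟩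
  have hne : (D.edgeCrossings h.adj).Nonempty := ⟨p, hmem⟩
  rw [mid, dif_pos hne]
  exact (Set.ncard_le_one (D.finite_edgeCrossings h.adj)).mp (hD h.adj) _ hmem _ hne.some_mem

theorem eq_zero_or_one_of_arc_eq_pos {u v w : V} (h : G.Adj u v) {t : I}
    (ht : D.arc h t = D.pos w) : t = 0 ∨ t = 1 := by
  rcases D.no_vertex_mem h w t ht with rfl | rfl
  · exact Or.inl (D.arc_inj h (by rw [ht, Path.source]))
  · exact Or.inr (D.arc_inj h (by rw [ht, Path.target]))

theorem not_isInteriorPoint_pos {u v w : V} (h : G.Adj u v) : ¬ D.IsInteriorPoint h (D.pos w) := by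
  rintro ⟨t, h0, h1, ht⟩
  exact (D.eq_zero_or_one_of_arc_eq_pos h ht).elim h0 h1

open Classical in
theorem exists_isPlanarRotation [Finite V] [Fintype G.Dart] (hD : D.IsKPlane 1) :
    ∃ ν τ : Equiv.Perm G.Dart, IsPlanarRotation ν τ := by
  choose m hm0 hm1 hm using D.isInteriorPoint_mid
  let A : G.Dart → Set (ℝ × ℝ) := fun h => D.arc h.adj '' Set.Iic (m h)
  have hle1 : ∀ h t, t ≤ m h → t ≠ 1 := fun h t ht h1 =>
    hm1 h (le_antisymm le_one' (h1 ▸ ht))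
  have hdart : ∀ h h' : G.Dart, h.edge = h'.edge → D.mid h = D.mid h' := fun h h' heq => by
    rcases SimpleGraph.dart_edge_eq_iff h h' |>.mp heq with rfl | rfl
    · rfl
    · exact D.mid_symm h'
  obtain ⟨ν, τ, hν, hτ, hcyc, hcob⟩ := exists_rotation_of_continua (A := A)
    (s := fun h => D.pos h.fst) (t := D.mid)
    (fun h => isClosed_Iic.isCompact.image (D.arc h.adj).continuous)
    (fun h => isPreconnected_Iic.image _ (D.arc h.adj).continuous.continuousOn)
    (fun h => ⟨0, nonneg', Path.source _⟩) (fun h => ⟨m h, Set.mem_Iic.mpr le_rfl, hm h⟩)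
    (fun h h' heq => D.not_isInteriorPoint_pos h'.adj (heq ▸ D.isInteriorPoint_mid h'))
    (by
      rintro h p (⟨h', rfl⟩ | ⟨h', rfl⟩) ⟨t, ht, hp⟩
      · rcases D.eq_zero_or_one_of_arc_eq_pos h.adj hp with rfl | rfl
        · exact Or.inl (by rw [← hp, Path.source])
        · exact absurd rfl (hle1 h 1 ht)
      · refine Or.inr ?_
        by_cases heq : h'.edge = h.edge
        · exact hdart _ _ heq
        · have hint := D.isInteriorPoint_mid h'
          refine D.eq_mid hD (Ne.symm heq) ⟨t, fun h0 => ?_, hle1 h t ht, hp⟩ hint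
          rw [h0, Path.source] at hp
          exact D.not_isInteriorPoint_pos h'.adj (hp ▸ hint))
    (by
      rintro h h' hne a ⟨t, ht, rfl⟩ ⟨t', ht', heq⟩
      by_cases he : h.edge = h'.edge
      · rcases SimpleGraph.dart_edge_eq_iff h h' |>.mp he with rfl | rfl
        · exact absurd rfl hne
        · refine Or.inr ⟨h'.symm, ?_⟩
          have harc : D.arc h'.symm.adj = (D.arc h'.adj).symm := D.arc_symm h'.adj
          have h1 : t' = unitInterval.symm t := D.arc_inj h'.adj (by rw [heq, harc]; rfl)
          have h2 : m h' = unitInterval.symm (m h'.symm) := D.arc_inj h'.adj (by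
            rw [hm, ← D.mid_symm h', ← hm, harc]; rfl)
          have h3 : t = m h'.symm := by
            refine le_antisymm ht ?_
            rw [Set.mem_Iic, h1, h2] at ht'
            exact unitInterval.symm_le_symm.mp ht'
          rw [h3, hm]
      · by_cases h0 : t = 0
        · exact Or.inl ⟨h, by rw [h0, Path.source]⟩
        by_cases h0' : t' = 0
        · exact Or.inl ⟨h', by rw [← heq, h0', Path.source]⟩
        · exact Or.inr ⟨h, (D.eq_mid hD he ⟨t, h0, hle1 h t ht, rfl⟩
            ⟨t', h0', hle1 h' t' ht', heq⟩).symm⟩)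
  have hpow : ∀ h, ∀ n : ℕ, D.mid ((τ ^ n) h) = D.mid h := fun h n => by
    induction n with
    | zero => rfl
    | succ n ih => rw [pow_succ', Equiv.Perm.mul_apply, hτ, ih]
  have hiff : ∀ h h', τ.SameCycle h h' ↔ D.mid h' = D.mid h := fun h h' =>
    ⟨fun hc => by
      obtain ⟨n, rfl⟩ := hc.exists_nat_pow_eq
      exact hpow h n, fun heq => hcyc _ _ heq.symm⟩
  refine ⟨ν, τ, fun h => D.pos_inj (hν h), fun h => (hiff _ _).mpr (D.mid_symm h), fun h => ?_,
    fun C hC1 hC2 => hcob C (fun w => ?_) (fun w => ?_)⟩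
  · have hon : τ.IsCycleOn ((Finset.univ.filter fun h' => D.mid h' = D.mid h : Finset _) :
        Set G.Dart) := by
      refine ⟨⟨fun x hx => ?_, τ.injective.injOn, fun x hx => ⟨τ.symm x, ?_, by simp⟩⟩,
        fun x hx y hy => (hiff _ _).mpr ?_⟩
      · simpa [hτ] using hx
      · have := hτ (τ.symm x)
        rw [Equiv.apply_symm_apply] at this
        simpa [← this] using hx
      · simp only [Finset.coe_filter, Finset.mem_univ, true_and, Set.mem_ofPred_eq] at hx hy
        rw [hx, hy]
    have hpc := hon.pow_card_apply (a := h) (by simp)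
    have hsymm : ∀ x : G.Dart, x.symm ≠ x := fun x => x.symm_ne
    have hedge : ∀ x y : G.Dart, x.edge = y.edge ↔ x = y ∨ x = y.symm := fun x y =>
      SimpleGraph.dart_edge_eq_iff x y
    by_cases hk : ∃ k : G.Dart, D.mid k = D.mid h ∧ k.edge ≠ h.edge
    · obtain ⟨k, hkm, hkh⟩ := hk
      have hset : (Finset.univ.filter fun h' => D.mid h' = D.mid h) = {h, h.symm, k, k.symm} := by
        ext x
        simp only [Finset.mem_filter, Finset.mem_univ, true_and, Finset.mem_insert,
          Finset.mem_singleton]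
        constructor
        · intro hx
          by_contra hcon
          push Not at hcon
          have hxh : x.edge ≠ h.edge := fun h1 => by
            rcases (hedge _ _).mp h1 with h1 | h1
            exacts [hcon.1 h1, hcon.2.1 h1]
          have hxk : x.edge ≠ k.edge := fun h1 => by
            rcases (hedge _ _).mp h1 with h1 | h1
            exacts [hcon.2.2.1 h1, hcon.2.2.2 h1]
          exact D.no_triple_point x.adj h.adj k.adj hxh hxk hkh.symm _ _ _ (hm0 x) (hm1 x)
            (hm0 h) (hm1 h) (hm0 k) (hm1 k) (by rw [hm, hm, hx]) (by rw [hm, hm, hkm])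
        · rintro (rfl | rfl | rfl | rfl)
          · rfl
          · exact D.mid_symm _
          · exact hkm
          · rw [D.mid_symm, hkm]
      have hcard : (Finset.univ.filter fun h' => D.mid h' = D.mid h).card = 4 := by
        have h1 : h ≠ k := fun h1 => hkh (by rw [h1])
        have h2 : h ≠ k.symm := fun h1 => hkh (by rw [h1, SimpleGraph.Dart.edge_symm])
        have h3 : h.symm ≠ k := fun h1 => hkh (by rw [← h1, SimpleGraph.Dart.edge_symm])
        have h4 : h.symm ≠ k.symm := fun h1 => hkh (by
          rw [← SimpleGraph.Dart.edge_symm, ← h1, SimpleGraph.Dart.edge_symm])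
        rw [hset, Finset.card_insert_of_notMem (by simp [(hsymm h).symm, h1, h2]),
          Finset.card_insert_of_notMem (by simp [h3, h4]), Finset.card_pair (hsymm k).symm]
      rwa [hcard] at hpc
    · push Not at hk
      have hset : (Finset.univ.filter fun h' => D.mid h' = D.mid h) = {h, h.symm} := by
        ext x
        simp only [Finset.mem_filter, Finset.mem_univ, true_and, Finset.mem_insert,
          Finset.mem_singleton]
        refine ⟨fun hx => (hedge _ _).mp (hk x hx), ?_⟩
        rintro (rfl | rfl)
        · rfl
        · exact D.mid_symm _
      rw [hset, Finset.card_pair (hsymm h).symm] at hpc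
      rw [show 4 = 2 + 2 from rfl, pow_add, Equiv.Perm.mul_apply, hpc, hpc]
  · by_cases hw : ∃ v, D.pos v = w
    · obtain ⟨v, rfl⟩ := hw
      rw [← hC1 v]
      refine Finset.sum_congr ?_ fun _ _ => rfl
      ext h
      simp [D.pos_inj.eq_iff]
    · refine Finset.sum_eq_zero fun h hh => absurd ⟨_, (Finset.mem_filter.mp hh).2⟩ hw
  · convert hC2 (fun h => D.mid h = w) fun h => by rw [hτ]

end PlaneDrawing

namespace IsPlanarRotation

variable {V : Type*} {G : SimpleGraph V} [Fintype G.Dart] {ν τ : Equiv.Perm G.Dart}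

theorem apply_four (hR : IsPlanarRotation ν τ) (h : G.Dart) : τ (τ (τ (τ h))) = h :=
  hR.pow_four h

theorem symm_eq (hR : IsPlanarRotation ν τ) (h : G.Dart) :
    h.symm = τ h ∨ h.symm = τ (τ h) ∨ h.symm = τ (τ (τ h)) := by
  obtain ⟨n, hn⟩ := (hR.sameCycle_symm h).exists_nat_pow_eq
  have h4 : τ ^ 4 = 1 := Equiv.ext hR.pow_four
  rw [pow_eq_pow_mod n h4] at hn
  have hlt : n % 4 < 4 := Nat.mod_lt _ (by norm_num)
  interval_cases n % 4
  · exact absurd hn.symm h.symm_ne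
  · exact Or.inl hn.symm
  · exact Or.inr (Or.inl hn.symm)
  · exact Or.inr (Or.inr hn.symm)

open Classical in
/-- Two edges that touch at their common midpoint can be pulled apart. -/
theorem exists_of_touching (hR : IsPlanarRotation ν τ) {g : G.Dart} (hg : τ g = g.symm)
    (hg' : τ g.symm ≠ g) :
    ∃ τ' : Equiv.Perm G.Dart, IsPlanarRotation ν τ' ∧
      (Finset.univ.filter fun h => τ' h ≠ h.symm).card <
        (Finset.univ.filter fun h => τ h ≠ h.symm).card := by
  obtain ⟨k, hk⟩ : ∃ k, τ g.symm = k := ⟨_, rfl⟩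
  rw [hk] at hg'
  have hgs : g.symm ≠ g := g.symm_ne
  have hks : k.symm ≠ k := k.symm_ne
  have hkg : k ≠ g.symm := fun h => hgs (τ.injective ((hk.trans h).trans hg.symm))
  have hτk' : τ (τ k) = g := by rw [← hk, ← hg]; exact hR.apply_four g
  have hτk : τ k = k.symm := by
    rcases hR.symm_eq k with h | h | h
    · exact h.symm
    · rw [hτk'] at h
      exact absurd (by rw [← h, SimpleGraph.Dart.symm_symm]) hkg
    · rw [hτk', hg] at h
      exact absurd (SimpleGraph.Dart.symm_involutive.injective h) hg'
  have hτks : τ k.symm = g := by rw [← hτk, hτk']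
  have hgk : g ≠ k := Ne.symm hg'
  have hgks : g.symm ≠ k.symm := fun h => hgk (SimpleGraph.Dart.symm_involutive.injective h)
  have hgks' : k.symm ≠ g := fun h => hkg (by rw [← h, SimpleGraph.Dart.symm_symm])
  let τ' := Equiv.swap g k * τ
  have hτ' : ∀ x, τ' x = Equiv.swap g k (τ x) := fun x => rfl
  have e1 : τ' g = g.symm := by
    rw [hτ', hg, Equiv.swap_apply_of_ne_of_ne hgs hkg.symm]
  have e2 : τ' g.symm = g := by rw [hτ', hk, Equiv.swap_apply_right]
  have e3 : τ' k = k.symm := by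
    rw [hτ', hτk, Equiv.swap_apply_of_ne_of_ne hgks' hks]
  have e4 : τ' k.symm = k := by rw [hτ', hτks, Equiv.swap_apply_left]
  let O : G.Dart → Prop := fun x => x = g ∨ x = g.symm ∨ x = k ∨ x = k.symm
  have hO : ∀ x, ¬ O x → τ' x = τ x ∧ ¬ O (τ x) := by
    intro x hx
    simp only [O, not_or] at hx
    have h1 : τ x ≠ g := fun h => hx.2.2.2 (τ.injective (h.trans hτks.symm))
    have h2 : τ x ≠ k := fun h => hx.2.1 (τ.injective (h.trans hk.symm))
    refine ⟨Equiv.swap_apply_of_ne_of_ne h1 h2, ?_⟩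
    rintro (h | h | h | h)
    · exact h1 h
    · exact hx.1 (τ.injective (h.trans hg.symm))
    · exact h2 h
    · exact hx.2.2.1 (τ.injective (h.trans hτk.symm))
  have hOpow : ∀ x, ¬ O x → ∀ n : ℕ, (τ' ^ n) x = (τ ^ n) x ∧ ¬ O ((τ ^ n) x) := by
    intro x hx n
    induction n with
    | zero => exact ⟨rfl, hx⟩
    | succ n ih =>
      rw [pow_succ', pow_succ', Equiv.Perm.mul_apply, Equiv.Perm.mul_apply, ih.1]
      exact hO _ ih.2
  have hOsymm : ∀ x, O x → τ' x = x.symm ∧ τ' x.symm = x := by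
    rintro x (rfl | rfl | rfl | rfl)
    · exact ⟨e1, e2⟩
    · exact ⟨e2, e1⟩
    · exact ⟨e3, e4⟩
    · exact ⟨e4, e3⟩
  refine ⟨τ', ⟨hR.fst_apply, fun h => ?_, fun h => ?_, fun C hC1 hC2 => ?_⟩,
    Finset.card_lt_card ?_⟩
  · by_cases hh : O h
    · exact ⟨1, by rw [zpow_one, (hOsymm h hh).1]⟩
    · obtain ⟨n, hn⟩ := (hR.sameCycle_symm h).exists_nat_pow_eq
      exact ⟨n, by rw [zpow_natCast, (hOpow h hh n).1, hn]⟩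
  · by_cases hh : O h
    · show τ' (τ' (τ' (τ' h))) = h
      rw [(hOsymm h hh).1, (hOsymm h hh).2, (hOsymm h hh).1, (hOsymm h hh).2]
    · rw [(hOpow h hh 4).1, hR.pow_four]
  · obtain ⟨φ, hφ⟩ := hR.coboundary C hC1 fun P hP => hC2 P fun h => by
      rw [hτ']
      by_cases h1 : τ h = g
      · rw [h1, Equiv.swap_apply_left, ← hk, hP, ← hg, hP, ← hP h, h1]
      by_cases h2 : τ h = k
      · rw [h2, Equiv.swap_apply_right, ← hP h, h2, ← hk, hP, ← hg, hP]
      · rw [Equiv.swap_apply_of_ne_of_ne h1 h2, hP]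
    have hCg : C g = C g.symm := by
      have := hC2 (fun x => x = g ∨ x = g.symm) fun x => by
        constructor
        · rintro (h | h)
          · exact Or.inr (τ'.injective (h.trans e2.symm))
          · exact Or.inl (τ'.injective (h.trans e1.symm))
        · rintro (rfl | rfl)
          · exact Or.inr e1
          · exact Or.inl e2
      have hpair : ∑ x ∈ {g, g.symm}, C x = 0 := by
        convert this using 2
        ext
        simp
      rw [Finset.sum_pair hgs.symm] at hpair
      exact CharTwo.add_eq_zero.mp hpair
    have hφgk : φ g = φ k := by
      have h1 := (hφ g).2
      have h2 := (hφ g.symm).2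
      rw [hg] at h1
      rw [hk] at h2
      rw [hCg, h2, add_comm] at h1
      exact (add_right_cancel h1).symm
    have hφτ : ∀ x, φ (τ' x) = φ (τ x) := fun x => by
      rw [hτ', Equiv.swap_apply_def]
      split_ifs with h1 h2
      · rw [h1, hφgk]
      · rw [h2, hφgk]
      · rfl
    exact ⟨φ, fun h => by rw [hφτ, hφτ]; exact hφ h⟩
  · refine Finset.ssubset_iff_subset_ne.mpr ⟨fun x hx => ?_, fun heq => ?_⟩
    · have hx := (Finset.mem_filter.mp hx).2
      refine Finset.mem_filter.mpr ⟨Finset.mem_univ _, fun h => hx ?_⟩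
      by_cases hxO : O x
      · exact (hOsymm x hxO).1
      · rw [(hO x hxO).1, h]
    · have : g.symm ∈ Finset.univ.filter fun h => τ h ≠ h.symm :=
        Finset.mem_filter.mpr ⟨Finset.mem_univ _, by
          rw [hk, SimpleGraph.Dart.symm_symm]; exact hgk.symm⟩
      rw [← heq] at this
      exact (Finset.mem_filter.mp this).2 (by rw [e2, SimpleGraph.Dart.symm_symm])

open Classical in
/-- Two edges crossing next to a common end can be redrawn so that they touch instead. -/
theorem exists_of_adjacent_crossing (hR : IsPlanarRotation ν τ) {h : G.Dart}
    (hh : τ h ≠ h.symm) (hh' : τ (τ h) = h.symm) (hfst : (τ h).fst = h.fst) :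
    ∃ ν' τ' : Equiv.Perm G.Dart, IsPlanarRotation ν' τ' ∧
      (Finset.univ.filter fun h => τ' h ≠ h.symm).card <
        (Finset.univ.filter fun h => τ h ≠ h.symm).card := by
  obtain ⟨k, hk⟩ : ∃ k, τ h = k := ⟨_, rfl⟩
  rw [hk] at hh hh' hfst
  have hsi := (SimpleGraph.Dart.symm_involutive (G := G)).injective
  have hhs : h.symm ≠ h := h.symm_ne
  have hks : k.symm ≠ k := k.symm_ne
  have hhk : h ≠ k := fun h1 => hhs (by rw [← hh', ← h1, hk, ← h1])
  have hτhs' : τ (τ h.symm) = h := by rw [← hh', ← hk]; exact hR.apply_four h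
  have hτhs : τ h.symm = k.symm := by
    rcases hR.symm_eq k with h1 | h1 | h1
    · rw [hh'] at h1
      exact absurd (hsi h1).symm hhk
    · rw [h1, hh']
    · rw [hh', hτhs'] at h1
      exact absurd (by rw [← h1, SimpleGraph.Dart.symm_symm]) hh
  have hτks : τ k.symm = h := by rw [← hτhs, hτhs']
  let ρ := Equiv.swap h k
  have hρ : ∀ x, ρ (ρ x) = x := Equiv.swap_apply_self h k
  have hρinv : ρ⁻¹ = ρ := Equiv.swap_inv h k
  have hρfst : ∀ x, (ρ x).fst = x.fst := fun x => by
    simp only [ρ, Equiv.swap_apply_def]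
    split_ifs with h1 h2
    · rw [h1, hfst]
    · rw [h2, hfst]
    · rfl
  have hρcyc : ∀ x, τ.SameCycle x (ρ x) := fun x => by
    have hc : τ.SameCycle h k := ⟨1, by rw [zpow_one, hk]⟩
    simp only [ρ, Equiv.swap_apply_def]
    split_ifs with h1 h2
    · rw [h1]; exact hc
    · rw [h2]; exact hc.symm
    · exact Equiv.Perm.SameCycle.refl _ _
  have hconj : ∀ (π : Equiv.Perm G.Dart) (x), (ρ * π * ρ⁻¹) x = ρ (π (ρ x)) := fun π x => by
    rw [hρinv]; rfl
  refine ⟨ρ * ν * ρ⁻¹, ρ * τ * ρ⁻¹, ⟨fun x => ?_, fun x => ?_, fun x => ?_,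
    fun C hC1 hC2 => ?_⟩, Finset.card_lt_card ?_⟩
  · rw [hconj, hρfst, hR.fst_apply, hρfst]
  · rw [Equiv.Perm.sameCycle_conj, hρinv]
    exact ((hρcyc x).symm.trans (hR.sameCycle_symm x)).trans (hρcyc _)
  · rw [conj_pow, show τ ^ 4 = 1 from Equiv.ext hR.pow_four]
    simp
  · obtain ⟨φ, hφ⟩ := hR.coboundary (fun x => C (ρ x)) (fun v => by
        rw [← hC1 v]
        exact Finset.sum_equiv ρ (by simp [hρfst]) fun _ _ => rfl) (fun P hP => by
        rw [← hC2 (fun x => P (ρ x)) fun x => by rw [hconj, hρ, hP]]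
        exact Finset.sum_equiv ρ (by simp [hρ]) fun _ _ => rfl)
    refine ⟨fun x => φ (ρ x), fun x => ⟨?_, ?_⟩⟩
    · beta_reduce
      rw [hconj, hconj, hρ, hρ, (hφ _).1]
    · have := (hφ (ρ x)).2
      rw [hρ] at this
      beta_reduce
      rw [hconj, hρ, this]
  · have e1 : (ρ * τ * ρ⁻¹) h = h.symm := by
      rw [hconj]
      simp only [ρ, Equiv.swap_apply_left, hh']
      exact Equiv.swap_apply_of_ne_of_ne hhs hh.symm
    refine Finset.ssubset_iff_subset_ne.mpr ⟨fun x hx => ?_, fun heq => ?_⟩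
    · have hx := (Finset.mem_filter.mp hx).2
      refine Finset.mem_filter.mpr ⟨Finset.mem_univ _, fun hτx => hx ?_⟩
      have h1 : x ≠ h := fun h1 => hh (by rw [← hk, ← h1, hτx])
      have h2 : x ≠ k := fun h2 => hhk (hsi (by rw [← hh', ← h2, hτx]))
      have h3 : x ≠ h.symm := fun h3 => hh (by
        rw [h3, hτhs, SimpleGraph.Dart.symm_symm] at hτx
        rw [← hτx, SimpleGraph.Dart.symm_symm])
      have h4 : x ≠ k.symm := fun h4 => hhk (by
        rwa [h4, hτks, SimpleGraph.Dart.symm_symm] at hτx)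
      rw [hconj]
      simp only [ρ]
      rw [Equiv.swap_apply_of_ne_of_ne h1 h2, hτx, Equiv.swap_apply_of_ne_of_ne
        (fun h5 => h3 (by rw [← h5, SimpleGraph.Dart.symm_symm]))
        (fun h5 => h4 (by rw [← h5, SimpleGraph.Dart.symm_symm]))]
    · have : h ∈ Finset.univ.filter fun x => τ x ≠ x.symm :=
        Finset.mem_filter.mpr ⟨Finset.mem_univ _, by rw [hk]; exact hh⟩
      rw [← heq] at this
      exact (Finset.mem_filter.mp this).2 e1

/-- A rotation system without touching edges and without crossings of adjacent edges. -/
theorem exists_reduced (hR : IsPlanarRotation ν τ) :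
    ∃ ν τ : Equiv.Perm G.Dart, IsPlanarRotation ν τ ∧ ∀ h, (τ h = h.symm ∧ τ h.symm = h) ∨
      (τ h ≠ h.symm ∧ τ (τ h) = h.symm ∧ (τ h).fst ≠ h.fst) := by
  classical
  obtain ⟨n, hn⟩ : ∃ n, (Finset.univ.filter fun h => τ h ≠ h.symm).card = n := ⟨_, rfl⟩
  induction n using Nat.strong_induction_on generalizing ν τ with
  | _ n ih =>
    subst hn
    by_cases hgood : ∀ h, (τ h = h.symm ∧ τ h.symm = h) ∨
      (τ h ≠ h.symm ∧ τ (τ h) = h.symm ∧ (τ h).fst ≠ h.fst)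
    · exact ⟨ν, τ, hR, hgood⟩
    · push Not at hgood
      obtain ⟨h, h1, h2⟩ := hgood
      by_cases hs : τ h = h.symm
      · obtain ⟨τ', hR', hlt⟩ := hR.exists_of_touching hs (h1 hs)
        exact ih _ hlt hR' rfl
      by_cases hs2 : τ (τ h) = h.symm
      · obtain ⟨ν', τ', hR', hlt⟩ := hR.exists_of_adjacent_crossing hs hs2 (h2 hs hs2)
        exact ih _ hlt hR' rfl
      · have hs3 : h.symm = τ (τ (τ h)) :=
          ((hR.symm_eq h).resolve_left (Ne.symm hs)).resolve_left (Ne.symm hs2)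
        have h3 : τ h.symm = h := by rw [hs3]; exact hR.apply_four h
        obtain ⟨τ', hR', hlt⟩ := hR.exists_of_touching (g := h.symm)
          (by rw [h3, SimpleGraph.Dart.symm_symm])
          (by rwa [SimpleGraph.Dart.symm_symm])
        exact ih _ hlt hR' rfl

end IsPlanarRotation

/-- The finest equivalence relation whose classes are unions of orbits of both permutations. -/
def jointOrbitSetoid {α : Type*} (f τ : Equiv.Perm α) : Setoid α where
  r x y := ∀ P : α → Prop, (∀ z, P (f z) ↔ P z) → (∀ z, P (τ z) ↔ P z) → (P x ↔ P y)
  iseqv := ⟨fun _ _ _ _ => Iff.rfl, fun h P h1 h2 => (h P h1 h2).symm,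
    fun h h' P h1 h2 => (h P h1 h2).trans (h' P h1 h2)⟩

theorem jointOrbitSetoid_apply_right {α : Type*} (f τ : Equiv.Perm α) (x : α) :
    jointOrbitSetoid f τ (τ x) x := fun _ _ h2 => h2 x

theorem jointOrbitSetoid_of_sameCycle {α : Type*} {f τ : Equiv.Perm α} {x y : α}
    (h : f.SameCycle x y) : jointOrbitSetoid f τ x y := by
  intro P h1 _
  obtain ⟨n, rfl⟩ := h
  have hinv : ∀ z, P (f⁻¹ z) ↔ P z := fun z => by
    rw [← h1 (f⁻¹ z)]
    simp
  induction n with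
  | zero => simp
  | succ n ih => rw [add_comm, zpow_add, zpow_one, Equiv.Perm.mul_apply, h1]; exact ih
  | pred n ih => rw [sub_eq_neg_add, zpow_add, zpow_neg_one, Equiv.Perm.mul_apply, hinv]; exact ih

open Classical in
theorem sum_filter_eq_zero_of_sameCycle {α R : Type*} [Fintype α] [AddCommMonoid R]
    (τ : Equiv.Perm α) (C : α → R)
    (hC : ∀ q : Quotient (Equiv.Perm.SameCycle.setoid τ),
      ∑ h with Quotient.mk _ h = q, C h = 0) (P : α → Prop)
    (hP : ∀ h, P (τ h) ↔ P h) : ∑ h with P h, C h = 0 := by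
  have hP' : ∀ x y, τ.SameCycle x y → (P x ↔ P y) := fun x y hxy =>
    jointOrbitSetoid_of_sameCycle (τ := 1) hxy P hP fun _ => Iff.rfl
  rw [← Finset.sum_fiberwise (Finset.univ.filter P)
    (fun h => Quotient.mk (Equiv.Perm.SameCycle.setoid τ) h)]
  refine Finset.sum_eq_zero fun q _ => ?_
  induction q using Quotient.inductionOn with
  | h x =>
    by_cases hx : P x
    · rw [← hC (Quotient.mk _ x)]
      congr 1
      ext y
      simp only [Finset.mem_filter, Finset.mem_univ, true_and]
      exact ⟨fun h => h.2, fun h => ⟨(hP' _ _ (Quotient.exact h)).mpr hx, h⟩⟩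
    · refine Finset.sum_eq_zero fun y hy => absurd ?_ hx
      simp only [Finset.mem_filter, Finset.mem_univ, true_and] at hy
      exact (hP' _ _ (Quotient.exact hy.2)).mp hy.1

namespace IsPlanarRotation

variable {V : Type*} {G : SimpleGraph V} [Fintype G.Dart] {ν τ : Equiv.Perm G.Dart}

open Classical in
/-- Euler's inequality for a planar rotation system. -/
theorem euler [Fintype V] [Nonempty V] (hR : IsPlanarRotation ν τ) :
    Fintype.card G.Dart + Nat.card (Quotient (jointOrbitSetoid (ν * τ) τ)) + 1 ≤
      Nat.card (Quotient (Equiv.Perm.SameCycle.setoid (ν * τ))) + Fintype.card V +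
        Nat.card (Quotient (Equiv.Perm.SameCycle.setoid τ)) := by
  let K := ZMod 2
  let Face := Quotient (Equiv.Perm.SameCycle.setoid (ν * τ))
  let Comp := Quotient (jointOrbitSetoid (ν * τ) τ)
  let M := Quotient (Equiv.Perm.SameCycle.setoid τ)
  obtain ⟨v₀⟩ := ‹Nonempty V›
  let face : G.Dart → Face := Quotient.mk _
  let Φ : (Face → K) →ₗ[K] (G.Dart → K) :=
    { toFun := fun y h => y (face (τ.symm h)) + y (face h)
      map_add' := fun y z => by ext h; simp only [Pi.add_apply]; ring
      map_smul' := fun c y => by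
        ext h
        simp only [Pi.smul_apply, smul_eq_mul, RingHom.id_apply]
        ring }
  let Ψ : (G.Dart → K) →ₗ[K] ({v // v ≠ v₀} → K) × (M → K) :=
    { toFun := fun C => (fun v => ∑ h with h.fst = v.1, C h,
        fun q => ∑ h with Quotient.mk _ h = q, C h)
      map_add' := fun y z => by
        ext h <;> simp [Finset.sum_add_distrib]
      map_smul' := fun c y => by
        ext h <;> exact (Finset.mul_sum _ _ c).symm }
  let π : Face → Comp := Quotient.map' id fun x y hxy => jointOrbitSetoid_of_sameCycle hxy
  have hπ : Function.Surjective π := fun q => by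
    induction q using Quotient.inductionOn with
    | h x => exact ⟨face x, rfl⟩
  let Θ : (Comp → K) →ₗ[K] (Face → K) := LinearMap.funLeft K K π
  have hΘ : LinearMap.range Θ ≤ LinearMap.ker Φ := by
    rintro _ ⟨y, rfl⟩
    rw [LinearMap.mem_ker]
    ext h
    have : π (face (τ.symm h)) = π (face h) := by
      apply Quotient.sound (s := jointOrbitSetoid (ν * τ) τ)
      have := jointOrbitSetoid_apply_right (ν * τ) τ (τ.symm h)
      rw [Equiv.apply_symm_apply] at this
      exact (jointOrbitSetoid (ν * τ) τ).symm this
    show y (π (face (τ.symm h))) + y (π (face h)) = 0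
    rw [this]
    exact CharTwo.add_self_eq_zero _
  have hΨ : LinearMap.ker Ψ ≤ LinearMap.range Φ := by
    intro C hC
    rw [LinearMap.mem_ker] at hC
    have hCM := sum_filter_eq_zero_of_sameCycle τ C fun q => congrFun (congrArg Prod.snd hC) q
    have hCV : ∀ v, v ≠ v₀ → ∑ h with h.fst = v, C h = 0 := fun v hv =>
      congrFun (congrArg Prod.fst hC) ⟨v, hv⟩
    obtain ⟨φ, hφ⟩ := hR.coboundary C (fun v => by
      by_cases hv : v = v₀
      · have h1 := hCM (fun _ => True) fun _ => Iff.rfl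
        rw [Finset.filter_true, ← Finset.sum_fiberwise _ fun h : G.Dart => h.fst,
          Finset.sum_eq_single v₀ (fun w _ hw => hCV w hw) (by simp)] at h1
        rw [hv]
        exact h1
      · exact hCV v hv) hCM
    have hφ' : ∀ x y, (ν * τ).SameCycle x y → φ (τ x) = φ (τ y) := by
      intro x y hxy
      have := jointOrbitSetoid_of_sameCycle (τ := 1) hxy (fun z => φ (τ z) = φ (τ y))
        (fun z => by rw [Equiv.Perm.mul_apply, (hφ (τ z)).1]) fun _ => Iff.rfl
      exact this.mpr rfl
    refine ⟨Quotient.lift (fun x => φ (τ x)) hφ', ?_⟩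
    ext h
    show φ (τ (τ.symm h)) + φ (τ h) = C h
    rw [Equiv.apply_symm_apply, (hφ h).2]
  have e1 := LinearMap.finrank_range_add_finrank_ker Φ
  have e2 := LinearMap.finrank_range_add_finrank_ker Ψ
  have e3 := Submodule.finrank_mono hΘ
  have e4 := Submodule.finrank_mono hΨ
  have e5 := LinearMap.finrank_range_of_inj (LinearMap.funLeft_injective_of_surjective K K π hπ)
  have e6 := Submodule.finrank_le (LinearMap.range Ψ)
  have e7 : Fintype.card {v // v ≠ v₀} + 1 = Fintype.card V := by
    rw [Fintype.card_subtype_compl, Fintype.card_subtype_eq]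
    exact Nat.sub_add_cancel (Fintype.card_pos_iff.mpr ⟨v₀⟩)
  simp only [Module.finrank_prod, Module.finrank_fintype_fun_eq_card] at e1 e2 e5 e6
  change Fintype.card G.Dart + Nat.card Comp + 1 ≤ Nat.card Face + Fintype.card V + Nat.card M
  rw [Nat.card_eq_fintype_card, Nat.card_eq_fintype_card, Nat.card_eq_fintype_card]
  have e5' : Module.finrank K (LinearMap.range Θ) = Fintype.card Comp := e5
  omega

end IsPlanarRotation

section

variable {V : Type*} {G : SimpleGraph V}

theorem HasNoCycleOfLength.eq_of_common_neighbors (hC : HasNoCycleOfLength G 4) {a b c d : V}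
    (hab : a ≠ b) (hac : G.Adj a c) (hbc : G.Adj b c) (had : G.Adj a d) (hbd : G.Adj b d) :
    c = d := by
  by_contra hcd
  refine hC a (.cons hac (.cons hbc.symm (.cons hbd (.cons had.symm .nil)))) ?_ rfl
  simp [SimpleGraph.Walk.isCycle_def, SimpleGraph.Walk.isTrail_def, hab, hab.symm, hcd,
    hac.ne, hac.ne', hbc.ne', had.ne, had.ne', hbd.ne]

/-- The edge of the dart `h` is crossed. -/
def IsCrossed (τ : Equiv.Perm G.Dart) (h : G.Dart) : Prop := τ h ≠ h.symm

/-- The permutation `τ` describes crossings of independent edges only, and `f` traces the faces. -/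
structure IsReducedRotation (f τ : Equiv.Perm G.Dart) : Prop where
  fst_apply : ∀ h, (f h).fst = (τ h).fst
  uncrossed_or : ∀ h, (τ h = h.symm ∧ τ h.symm = h) ∨
    (τ h ≠ h.symm ∧ τ (τ h) = h.symm ∧ (τ h).fst ≠ h.fst)

/-- The face at the crossed dart `q` is bounded by two half-edges and an uncrossed edge. -/
def IsKite (f τ : Equiv.Perm G.Dart) (q : G.Dart) : Prop :=
  IsCrossed τ q ∧ ¬ IsCrossed τ (f q) ∧ f (f q) = q

/-- One of the two faces next to `q` at its crossing is a kite. -/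
def IsNearKite (f τ : Equiv.Perm G.Dart) (q : G.Dart) : Prop :=
  IsKite f τ (τ q) ∨ IsKite f τ (τ.symm q)

/-- The face at `g` is a triangle bounded by uncrossed edges. -/
def IsTriangularFace (f τ : Equiv.Perm G.Dart) (g : G.Dart) : Prop :=
  ¬ IsCrossed τ g ∧ ¬ IsCrossed τ (f g) ∧ ¬ IsCrossed τ (f (f g)) ∧ f (f (f g)) = g

/-- The face at the uncrossed dart `g` needs charge from the other side of `g`. -/
def IsPoorSide (f τ : Equiv.Perm G.Dart) (g : G.Dart) : Prop :=
  IsTriangularFace f τ g ∨ (IsKite f τ (f g) ∧ IsNearKite f τ (f g))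

theorem SimpleGraph.Dart.ext_fst {g h : G.Dart} (h1 : g.fst = h.fst)
    (h2 : g.symm.fst = h.symm.fst) : g = h :=
  SimpleGraph.Dart.ext _ _ (Prod.ext h1 h2)

theorem SimpleGraph.Dart.adj_symm_fst (g : G.Dart) : G.Adj g.fst g.symm.fst := g.adj

namespace IsReducedRotation

variable {f τ : Equiv.Perm G.Dart}

theorem apply_symm_of_not_isCrossed (hR : IsReducedRotation f τ) {g : G.Dart}
    (hg : ¬ IsCrossed τ g) : τ g.symm = g :=
  ((hR.uncrossed_or g).resolve_right fun h => hg h.1).2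

theorem apply_of_not_isCrossed {g : G.Dart} (hg : ¬ IsCrossed τ g) : τ g = g.symm :=
  not_not.mp hg

theorem isCrossed_symm (hR : IsReducedRotation f τ) {g : G.Dart} :
    IsCrossed τ g.symm ↔ IsCrossed τ g := by
  have key : ∀ g : G.Dart, ¬ IsCrossed τ g → ¬ IsCrossed τ g.symm := fun g hg h =>
    h (by rw [hR.apply_symm_of_not_isCrossed hg, SimpleGraph.Dart.symm_symm])
  refine ⟨fun h => by_contra fun h1 => key g h1 h, fun h => by_contra fun h1 => ?_⟩
  have := key _ h1
  rw [SimpleGraph.Dart.symm_symm] at this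
  exact this h

theorem symm_apply_of_not_isCrossed (hR : IsReducedRotation f τ) {g : G.Dart}
    (hg : ¬ IsCrossed τ g) : τ.symm g = g.symm := by
  rw [Equiv.symm_apply_eq, hR.apply_symm_of_not_isCrossed hg]

theorem apply_apply (hR : IsReducedRotation f τ) {q : G.Dart} (hq : IsCrossed τ q) :
    τ (τ q) = q.symm :=
  ((hR.uncrossed_or q).resolve_left fun h => hq h.1).2.1

theorem apply_fst_ne (hR : IsReducedRotation f τ) (q : G.Dart) : (τ q).fst ≠ q.fst := by
  rcases hR.uncrossed_or q with h | h
  · rw [h.1]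
    exact q.adj_symm_fst.ne'
  · exact h.2.2

theorem isCrossed_apply (hR : IsReducedRotation f τ) {q : G.Dart} :
    IsCrossed τ (τ q) ↔ IsCrossed τ q := by
  constructor
  · intro h hq
    exact (hR.isCrossed_symm.mp (by rwa [hq] at h)) hq
  · intro h hq
    have h1 := hR.apply_apply h
    rw [hq] at h1
    have h2 := SimpleGraph.Dart.symm_involutive.injective h1
    have h3 := hR.apply_fst_ne q
    rw [h2] at h3
    exact h3 rfl

theorem apply_symm (hR : IsReducedRotation f τ) {q : G.Dart} (hq : IsCrossed τ q) :
    τ q.symm = (τ q).symm := by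
  rw [← hR.apply_apply hq, hR.apply_apply (hR.isCrossed_apply.mpr hq)]

theorem symm_apply (hR : IsReducedRotation f τ) {q : G.Dart} (hq : IsCrossed τ q) :
    τ.symm q = (τ q).symm := by
  rw [Equiv.symm_apply_eq, hR.apply_symm (hR.isCrossed_apply.mpr hq), hR.apply_apply hq,
    SimpleGraph.Dart.symm_symm]

theorem exists_of_isKite (hR : IsReducedRotation f τ) {q : G.Dart} (hq : IsKite f τ q) :
    ∃ g, ¬ IsCrossed τ g ∧ g.fst = q.fst ∧ g.symm.fst = (τ q).fst := by
  refine ⟨(f q).symm, fun h => hq.2.1 (hR.isCrossed_symm.mp h), ?_, ?_⟩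
  · rw [← apply_of_not_isCrossed hq.2.1, ← hR.fst_apply, hq.2.2]
  · rw [SimpleGraph.Dart.symm_symm, hR.fst_apply]

/-- If `q` is crossed near a kite, the apex of the kite is joined to both ends of the corner of `q`,
to one of them by an uncrossed edge and to the other one by one of the two crossing edges. -/
theorem exists_of_isNearKite (hR : IsReducedRotation f τ) {q : G.Dart} (hq : IsCrossed τ q)
    (h : IsNearKite f τ q) :
    (∃ g, ¬ IsCrossed τ g ∧ g.fst = (τ q).fst ∧ g.symm.fst = q.symm.fst) ∨
      ∃ g, ¬ IsCrossed τ g ∧ g.fst = q.fst ∧ g.symm.fst = (τ q).symm.fst := by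
  rcases h with h | h
  · obtain ⟨g, h1, h2, h3⟩ := hR.exists_of_isKite h
    rw [hR.apply_apply hq] at h3
    exact Or.inl ⟨g, h1, h2, h3⟩
  · obtain ⟨g, h1, h2, h3⟩ := hR.exists_of_isKite h
    rw [Equiv.apply_symm_apply] at h3
    rw [hR.symm_apply hq] at h2
    exact Or.inr ⟨g.symm, fun h => h1 (hR.isCrossed_symm.mp h), h3, by
      rw [SimpleGraph.Dart.symm_symm, h2]⟩

theorem isCrossed_congr {g h : G.Dart} (h1 : g.fst = h.fst) (h2 : g.symm.fst = h.symm.fst) :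
    IsCrossed τ g ↔ IsCrossed τ h := by
  rw [SimpleGraph.Dart.ext_fst h1 h2]

theorem not_isKite_symm (hR : IsReducedRotation f τ) (hC : HasNoCycleOfLength G 4) {q : G.Dart}
    (hq : IsKite f τ q) : ¬ IsKite f τ q.symm := by
  intro hq'
  obtain ⟨g, h1, h2, h3⟩ := hR.exists_of_isKite hq
  obtain ⟨g', h1', h2', h3'⟩ := hR.exists_of_isKite hq'
  have hk := hR.isCrossed_apply.mpr hq.1
  rw [hR.apply_symm hq.1] at h3'
  have e1 := hR.apply_fst_ne (τ q)
  rw [hR.apply_apply hq.1] at e1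
  have e2 := hR.apply_fst_ne (τ q).symm
  rw [hR.apply_symm hk, hR.apply_apply hq.1, SimpleGraph.Dart.symm_symm] at e2
  have a1 := g.adj_symm_fst
  have a2 := g'.adj_symm_fst
  rw [h2, h3] at a1
  rw [h2', h3'] at a2
  exact e1 (hC.eq_of_common_neighbors e2 q.adj_symm_fst a2.symm a1 (τ q).adj_symm_fst.symm)

theorem not_isNearKite_of_common_neighbor (hR : IsReducedRotation f τ)
    (hC : HasNoCycleOfLength G 4) {q g g' : G.Dart} (hq : IsCrossed τ q)
    (hg : ¬ IsCrossed τ g) (hg' : ¬ IsCrossed τ g') (h1 : g.fst = q.fst) (h2 : g'.fst = (τ q).fst)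
    (h3 : g.symm.fst = g'.symm.fst) : ¬ IsNearKite f τ q := by
  intro h
  have hne := hR.apply_fst_ne q
  have a1 := g.adj_symm_fst
  have a2 := g'.adj_symm_fst
  rw [h1] at a1
  rw [h2, ← h3] at a2
  have a3 := q.adj_symm_fst
  have a4 := (τ q).adj_symm_fst
  rcases hR.exists_of_isNearKite hq h with ⟨x, x1, x2, x3⟩ | ⟨x, x1, x2, x3⟩
  · have a5 := x.adj_symm_fst
    rw [x2, x3] at a5
    have := hC.eq_of_common_neighbors hne.symm a1 a2 a3 a5
    exact (isCrossed_congr h1 this).not.mp hg hq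
  · have a5 := x.adj_symm_fst
    rw [x2, x3] at a5
    have := hC.eq_of_common_neighbors hne.symm a1 a2 a5 a4
    rw [h3] at this
    exact (isCrossed_congr h2 this).not.mp hg' (hR.isCrossed_apply.mpr hq)

theorem not_isNearKite_of_opposite (hR : IsReducedRotation f τ)
    (hC : HasNoCycleOfLength G 4) {q p : G.Dart} (hq : IsCrossed τ q) (hp : IsCrossed τ p)
    (h1 : (τ q).fst = p.fst) (h2 : (τ p).fst = q.fst) (h : IsNearKite f τ q) :
    ¬ IsNearKite f τ p := by
  intro h'
  have hne := hR.apply_fst_ne q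
  have a1 := q.adj_symm_fst
  have a2 := (τ q).adj_symm_fst
  have a3 := p.adj_symm_fst
  have a4 := (τ p).adj_symm_fst
  have hk := hR.isCrossed_apply.mpr hq
  have hl := hR.isCrossed_apply.mpr hp
  rw [h1] at a2 hne
  rw [h2] at a4
  rcases hR.exists_of_isNearKite hq h with ⟨x, x1, x2, x3⟩ | ⟨x, x1, x2, x3⟩ <;>
  rcases hR.exists_of_isNearKite hp h' with ⟨y, y1, y2, y3⟩ | ⟨y, y1, y2, y3⟩ <;>
  have b1 := x.adj_symm_fst <;> have b2 := y.adj_symm_fst <;> rw [x2, x3] at b1 <;>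
  rw [y2, y3] at b2
  · rw [h1] at b1
    rw [h2] at b2
    have := hC.eq_of_common_neighbors hne.symm a1 b1 b2 a3
    exact (isCrossed_congr (x2.trans h1) (x3.trans this)).not.mp x1 hp
  · rw [h1] at b1
    have := hC.eq_of_common_neighbors hne.symm a1 b1 a4 b2
    have hqp : q = τ p := SimpleGraph.Dart.ext_fst h2.symm this
    rw [hqp, hR.apply_apply hp] at h1
    exact p.adj_symm_fst.ne' h1
  · rw [h2] at b2
    have := hC.eq_of_common_neighbors hne.symm b1 a2 b2 a3
    have hqp : p = τ q := SimpleGraph.Dart.ext_fst h1.symm this.symm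
    rw [hqp, hR.apply_apply hq] at h2
    exact q.adj_symm_fst.ne' h2
  · have := hC.eq_of_common_neighbors hne.symm b1 a2 a4 b2
    exact (isCrossed_congr (x2.trans h2.symm) (x3.trans this)).not.mp x1 hl

theorem symm_fst_of_not_isCrossed (hR : IsReducedRotation f τ) {g : G.Dart}
    (hg : ¬ IsCrossed τ g) : g.symm.fst = (f g).fst := by
  rw [hR.fst_apply, apply_of_not_isCrossed hg]

theorem isTriangularFace_of_isPoorSide (hR : IsReducedRotation f τ)
    (hC : HasNoCycleOfLength G 4) {g : G.Dart} (hg : ¬ IsCrossed τ g) (h : IsPoorSide f τ g)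
    (h' : IsPoorSide f τ g.symm) : IsTriangularFace f τ g ∧ IsTriangularFace f τ g.symm := by
  have key : ∀ g : G.Dart, IsTriangularFace f τ g → IsKite f τ (f g.symm) →
      ¬ IsNearKite f τ (f g.symm) := by
    intro g ht hk
    have hgs : ¬ IsCrossed τ g.symm := fun h => ht.1 (hR.isCrossed_symm.mp h)
    have e : f (f g.symm) = g.symm := f.injective hk.2.2
    refine hR.not_isNearKite_of_common_neighbor hC (g := (f (f g)).symm) (g' := f g) hk.1
      (fun h => ht.2.2.1 (hR.isCrossed_symm.mp h)) ht.2.1 ?_ ?_ ?_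
    · rw [hR.symm_fst_of_not_isCrossed ht.2.2.1, ht.2.2.2, ← hR.symm_fst_of_not_isCrossed hgs,
        SimpleGraph.Dart.symm_symm]
    · rw [← hR.fst_apply (f g.symm), e, hR.symm_fst_of_not_isCrossed ht.1]
    · rw [SimpleGraph.Dart.symm_symm, hR.symm_fst_of_not_isCrossed ht.2.1]
  have hgs : ¬ IsCrossed τ g.symm := fun h => hg (hR.isCrossed_symm.mp h)
  rcases h with h | h <;> rcases h' with h' | h'
  · exact ⟨h, h'⟩
  · exact absurd h'.2 (key g h h'.1)
  · have := key g.symm h'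
    rw [SimpleGraph.Dart.symm_symm] at this
    exact absurd h.2 (this h.1)
  · refine absurd h'.2 (hR.not_isNearKite_of_opposite hC h.1.1 h'.1.1 ?_ ?_ h.2)
    · rw [← hR.fst_apply, f.injective h.1.2.2, ← hR.symm_fst_of_not_isCrossed hgs,
        SimpleGraph.Dart.symm_symm]
    · rw [← hR.fst_apply, f.injective h'.1.2.2, hR.symm_fst_of_not_isCrossed hg]

theorem not_isCrossed_of_isPoorSide {g : G.Dart} (h : IsPoorSide f τ g) : ¬ IsCrossed τ g := by
  rcases h with h | h
  · exact h.1
  · have := h.1.2.1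
    rwa [f.injective h.1.2.2] at this

end IsReducedRotation

end

open Classical in
/-- If every class of an equivalence relation has weight at least `c`, then the number of classes
times `c` is at most the total weight. -/
theorem mul_card_quotient_le_sum {α : Type*} [Fintype α] (r : Setoid α) (w : α → ℤ) (c : ℤ)
    (h : ∀ x, c ≤ ∑ y with r x y, w y) : c * Nat.card (Quotient r) ≤ ∑ x, w x := by
  rw [← Finset.sum_fiberwise Finset.univ (fun x => Quotient.mk r x), Nat.card_eq_fintype_card,
    mul_comm, ← nsmul_eq_mul, ← Finset.card_univ]
  refine Finset.card_nsmul_le_sum _ _ _ fun q _ => ?_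
  induction q using Quotient.inductionOn with
  | h x =>
    refine (h x).trans (le_of_eq (Finset.sum_congr ?_ fun _ _ => rfl))
    ext y
    simp only [Finset.mem_filter, Finset.mem_univ, true_and, Quotient.eq]
    exact ⟨fun h => r.symm h, fun h => r.symm h⟩

open Classical in
/-- If every class of an equivalence relation has weight at most `c`, then the total weight is at
most the number of classes times `c`. -/
theorem sum_le_mul_card_quotient {α : Type*} [Fintype α] (r : Setoid α) (w : α → ℤ) (c : ℤ)
    (h : ∀ x, ∑ y with r x y, w y ≤ c) : ∑ x, w x ≤ c * Nat.card (Quotient r) := by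
  have := mul_card_quotient_le_sum r (fun x => -w x) (-c) fun x => by
    rw [Finset.sum_neg_distrib]
    exact neg_le_neg (h x)
  rw [Finset.sum_neg_distrib] at this
  linarith

namespace IsReducedRotation

variable {V : Type*} {G : SimpleGraph V} {f τ : Equiv.Perm G.Dart}

open Classical in
/-- The charge of a dart after redistribution along kites and triangular faces. -/
noncomputable def charge (f τ : Equiv.Perm G.Dart) (g : G.Dart) : ℤ :=
  (if IsCrossed τ g then 11 else 6) + 4 * (if IsKite f τ g then 1 else 0) -
    2 * (if IsKite f τ (τ g) then 1 else 0) - 2 * (if IsKite f τ (τ.symm g) then 1 else 0) +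
    (if IsPoorSide f τ g then 1 else 0) - (if IsPoorSide f τ g.symm then 1 else 0)

open Classical in
/-- The extra charge needed on components consisting of one edge or one triangle. -/
noncomputable def bonus (f τ : Equiv.Perm G.Dart) (g : G.Dart) : ℤ :=
  if ¬ IsCrossed τ g ∧ f g = g.symm ∧ f g.symm = g then 4
  else if IsTriangularFace f τ g ∧ IsTriangularFace f τ g.symm then 1 else 0

theorem bonus_nonneg (f τ : Equiv.Perm G.Dart) (g : G.Dart) : 0 ≤ bonus f τ g := by
  unfold bonus
  split_ifs <;> norm_num

theorem sum_charge [Fintype G.Dart] (f τ : Equiv.Perm G.Dart) :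
    ∑ g, charge f τ g = ∑ g, open Classical in if IsCrossed τ g then 11 else 6 := by
  classical
  unfold charge
  simp only [Finset.sum_add_distrib, Finset.sum_sub_distrib, ← Finset.mul_sum]
  rw [Equiv.sum_comp τ (fun g => if IsKite f τ g then (1 : ℤ) else 0),
    Equiv.sum_comp τ.symm (fun g => if IsKite f τ g then (1 : ℤ) else 0)]
  have hs : ∑ g : G.Dart, (if IsPoorSide f τ g.symm then (1 : ℤ) else 0) =
      ∑ g, if IsPoorSide f τ g then (1 : ℤ) else 0 :=
    Equiv.sum_comp (SimpleGraph.Dart.symm_involutive.toPerm)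
      fun g : G.Dart => if IsPoorSide f τ g then (1 : ℤ) else 0
  rw [hs]
  ring

theorem charge_of_isCrossed (hR : IsReducedRotation f τ) {g : G.Dart} (hg : IsCrossed τ g) :
    open Classical in charge f τ g = 11 + 4 * (if IsKite f τ g then 1 else 0) -
      2 * (if IsKite f τ (τ g) then 1 else 0) - 2 * (if IsKite f τ (τ.symm g) then 1 else 0) := by
  unfold charge
  rw [if_pos hg, if_neg fun h => not_isCrossed_of_isPoorSide h hg,
    if_neg fun h => not_isCrossed_of_isPoorSide h (hR.isCrossed_symm.mpr hg)]
  ring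

theorem charge_of_not_isCrossed (hR : IsReducedRotation f τ) {g : G.Dart}
    (hg : ¬ IsCrossed τ g) :
    open Classical in charge f τ g = 6 + (if IsPoorSide f τ g then 1 else 0) -
      (if IsPoorSide f τ g.symm then 1 else 0) := by
  have hs : ¬ IsCrossed τ g.symm := fun h => hg (hR.isCrossed_symm.mp h)
  unfold charge
  rw [if_neg hg, if_neg fun h => hg h.1, hR.symm_apply_of_not_isCrossed hg,
    apply_of_not_isCrossed hg, if_neg fun h => hs h.1]
  ring

theorem five_le_charge (hR : IsReducedRotation f τ) {g : G.Dart} (hg : ¬ IsCrossed τ g) :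
    5 ≤ charge f τ g := by
  rw [hR.charge_of_not_isCrossed hg]
  split_ifs <;> norm_num

theorem not_isKite_symm_apply (hR : IsReducedRotation f τ) (hC : HasNoCycleOfLength G 4)
    {g : G.Dart} (hg : IsCrossed τ g) (hk : IsKite f τ (τ g)) : ¬ IsKite f τ (τ.symm g) := by
  rw [hR.symm_apply hg]
  exact hR.not_isKite_symm hC hk

theorem nine_le_charge (hR : IsReducedRotation f τ) (hC : HasNoCycleOfLength G 4) {g : G.Dart}
    (hg : IsCrossed τ g) : 9 ≤ charge f τ g := by
  have := hR.not_isKite_symm_apply hC hg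
  rw [hR.charge_of_isCrossed hg]
  split_ifs <;> first | exact absurd ‹_› (this ‹_›) | norm_num

theorem thirteen_le_charge (hR : IsReducedRotation f τ) (hC : HasNoCycleOfLength G 4) {g : G.Dart}
    (hg : IsKite f τ g) : 13 ≤ charge f τ g := by
  have := hR.not_isKite_symm_apply hC hg.1
  rw [hR.charge_of_isCrossed hg.1, if_pos hg]
  split_ifs <;> first | exact absurd ‹_› (this ‹_›) | norm_num

theorem eleven_le_charge (hR : IsReducedRotation f τ) {g : G.Dart} (hg : IsCrossed τ g)
    (hn : ¬ IsNearKite f τ g) : 11 ≤ charge f τ g := by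
  rw [hR.charge_of_isCrossed hg, if_neg fun h => hn (Or.inl h), if_neg fun h => hn (Or.inr h)]
  split_ifs <;> norm_num

theorem fifteen_le_charge (hR : IsReducedRotation f τ) {g : G.Dart} (hg : IsKite f τ g)
    (hn : ¬ IsNearKite f τ g) : 15 ≤ charge f τ g := by
  rw [hR.charge_of_isCrossed hg.1, if_neg fun h => hn (Or.inl h), if_neg fun h => hn (Or.inr h),
    if_pos hg]
  norm_num

theorem seven_le_charge_add_bonus (hR : IsReducedRotation f τ) (hC : HasNoCycleOfLength G 4)
    {g : G.Dart} (hg : IsTriangularFace f τ g) : 7 ≤ charge f τ g + bonus f τ g := by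
  rw [hR.charge_of_not_isCrossed hg.1, if_pos (show IsPoorSide f τ g from Or.inl hg)]
  by_cases h : IsPoorSide f τ g.symm
  · have := hR.isTriangularFace_of_isPoorSide hC hg.1 (Or.inl hg) h
    unfold bonus
    rw [if_pos this, if_pos h]
    split_ifs <;> norm_num
  · rw [if_neg h]
    linarith [bonus_nonneg f τ g]

theorem five_le_charge_add_bonus (hR : IsReducedRotation f τ) (hC : HasNoCycleOfLength G 4)
    (g : G.Dart) : 5 ≤ charge f τ g + bonus f τ g := by
  by_cases hg : IsCrossed τ g
  · linarith [bonus_nonneg f τ g, hR.nine_le_charge hC hg]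
  · linarith [bonus_nonneg f τ g, hR.five_le_charge hg]

theorem twenty_le_of_isKite (hR : IsReducedRotation f τ) (hC : HasNoCycleOfLength G 4)
    {q : G.Dart} (hq : IsKite f τ q) : 20 ≤ charge f τ q + charge f τ (f q) := by
  by_cases hn : IsNearKite f τ q
  · have h1 := hR.thirteen_le_charge hC hq
    have hp : IsPoorSide f τ (f q) := Or.inr (by rw [hq.2.2]; exact ⟨hq, hn⟩)
    have hp' : ¬ IsPoorSide f τ (f q).symm := fun h => by
      have := (hR.isTriangularFace_of_isPoorSide hC hq.2.1 hp h).1.2.1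
      rw [hq.2.2] at this
      exact this hq.1
    rw [hR.charge_of_not_isCrossed hq.2.1, if_pos hp, if_neg hp']
    linarith
  · linarith [hR.fifteen_le_charge hq hn, hR.five_le_charge hq.2.1]

theorem twenty_le_of_apply_apply (hR : IsReducedRotation f τ) (hC : HasNoCycleOfLength G 4)
    {g : G.Dart} (hg : f (f g) = g) :
    20 ≤ (charge f τ g + bonus f τ g) + (charge f τ (f g) + bonus f τ (f g)) := by
  have b1 := bonus_nonneg f τ g
  have b2 := bonus_nonneg f τ (f g)
  by_cases h1 : IsCrossed τ g <;> by_cases h2 : IsCrossed τ (f g)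
  · have e1 : (τ g).fst = (f g).fst := (hR.fst_apply g).symm
    have e2 : (τ (f g)).fst = g.fst := by rw [← hR.fst_apply, hg]
    by_cases hn : IsNearKite f τ g
    · linarith [hR.nine_le_charge hC h1, hR.eleven_le_charge h2
        (hR.not_isNearKite_of_opposite hC h1 h2 e1 e2 hn)]
    · linarith [hR.eleven_le_charge h1 hn, hR.nine_le_charge hC h2]
  · linarith [hR.twenty_le_of_isKite hC ⟨h1, h2, hg⟩]
  · have := hR.twenty_le_of_isKite hC (q := f g) ⟨h2, by rwa [hg], by rw [hg]⟩
    rw [hg] at this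
    linarith
  · have e : f g = g.symm := SimpleGraph.Dart.ext_fst
      (hR.symm_fst_of_not_isCrossed h1).symm (by
        rw [hR.symm_fst_of_not_isCrossed h2, hg, SimpleGraph.Dart.symm_symm])
    have e' : f g.symm = g := by rw [← e, hg]
    have c1 : bonus f τ g = 4 := if_pos ⟨h1, e, e'⟩
    have c2 : bonus f τ (f g) = 4 := if_pos ⟨h2, by rw [hg, e, SimpleGraph.Dart.symm_symm], by
      rw [e, SimpleGraph.Dart.symm_symm, e]⟩
    rw [c1, c2, hR.charge_of_not_isCrossed h1, hR.charge_of_not_isCrossed h2, e,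
      SimpleGraph.Dart.symm_symm]
    linarith

theorem twenty_le_of_one_crossed (hR : IsReducedRotation f τ) (hC : HasNoCycleOfLength G 4)
    {q : G.Dart} (hq : f (f (f q)) = q) (h0 : IsCrossed τ q) (h1 : ¬ IsCrossed τ (f q))
    (h2 : ¬ IsCrossed τ (f (f q))) :
    20 ≤ charge f τ q + charge f τ (f q) + charge f τ (f (f q)) := by
  have hn : ¬ IsNearKite f τ q := by
    refine hR.not_isNearKite_of_common_neighbor hC (g := (f (f q)).symm) (g' := f q) h0
      (fun h => h2 (hR.isCrossed_symm.mp h)) h1 ?_ (hR.fst_apply q) ?_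
    · rw [hR.symm_fst_of_not_isCrossed h2, hq]
    · rw [SimpleGraph.Dart.symm_symm, hR.symm_fst_of_not_isCrossed h1]
  linarith [hR.eleven_le_charge h0 hn, hR.five_le_charge h1, hR.five_le_charge h2]

theorem twenty_le_of_apply_apply_apply (hR : IsReducedRotation f τ) (hC : HasNoCycleOfLength G 4)
    {g : G.Dart} (hg : f (f (f g)) = g) :
    20 ≤ (charge f τ g + bonus f τ g) + ((charge f τ (f g) + bonus f τ (f g)) +
      (charge f τ (f (f g)) + bonus f τ (f (f g)))) := by
  have b0 := bonus_nonneg f τ g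
  have b1 := bonus_nonneg f τ (f g)
  have b2 := bonus_nonneg f τ (f (f g))
  by_cases h0 : IsCrossed τ g <;> by_cases h1 : IsCrossed τ (f g) <;>
    by_cases h2 : IsCrossed τ (f (f g))
  · linarith [hR.nine_le_charge hC h0, hR.nine_le_charge hC h1, hR.nine_le_charge hC h2]
  · linarith [hR.nine_le_charge hC h0, hR.nine_le_charge hC h1, hR.five_le_charge h2]
  · linarith [hR.nine_le_charge hC h0, hR.five_le_charge h1, hR.nine_le_charge hC h2]
  · linarith [hR.twenty_le_of_one_crossed hC hg h0 h1 h2]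
  · linarith [hR.five_le_charge h0, hR.nine_le_charge hC h1, hR.nine_le_charge hC h2]
  · have := hR.twenty_le_of_one_crossed hC (q := f g) (by rw [hg]) h1 h2 (by rwa [hg])
    rw [hg] at this
    linarith
  · have := hR.twenty_le_of_one_crossed hC (q := f (f g)) (by rw [hg]) h2 (by rwa [hg])
      (by rwa [hg])
    rw [hg] at this
    linarith
  · have t0 : IsTriangularFace f τ g := ⟨h0, h1, h2, hg⟩
    have t1 : IsTriangularFace f τ (f g) := ⟨h1, h2, by rwa [hg], by rw [hg]⟩
    have t2 : IsTriangularFace f τ (f (f g)) := ⟨h2, by rwa [hg], by rwa [hg], by rw [hg]⟩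
    linarith [hR.seven_le_charge_add_bonus hC t0, hR.seven_le_charge_add_bonus hC t1,
      hR.seven_le_charge_add_bonus hC t2]

theorem apply_ne (hR : IsReducedRotation f τ) (g : G.Dart) : f g ≠ g := fun h =>
  hR.apply_fst_ne g (by rw [← hR.fst_apply, h])

open Classical in
/-- Every face has charge at least `20`. -/
theorem twenty_le_sum [Fintype G.Dart] (hR : IsReducedRotation f τ)
    (hC : HasNoCycleOfLength G 4) (g : G.Dart) :
    20 ≤ ∑ h with f.SameCycle g h, (charge f τ h + bonus f τ h) := by
  have hmono : ∀ s : Finset G.Dart, (∀ h ∈ s, f.SameCycle g h) →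
      ∑ h ∈ s, (charge f τ h + bonus f τ h) ≤
        ∑ h with f.SameCycle g h, (charge f τ h + bonus f τ h) := fun s hs =>
    Finset.sum_le_sum_of_subset_of_nonneg
      (fun h hh => Finset.mem_filter.mpr ⟨Finset.mem_univ _, hs h hh⟩)
      fun h _ _ => by linarith [hR.five_le_charge_add_bonus hC h]
  have s0 : f.SameCycle g g := Equiv.Perm.SameCycle.refl _ _
  have s1 : f.SameCycle g (f g) := Equiv.Perm.sameCycle_apply_right.mpr s0
  have s2 : f.SameCycle g (f (f g)) := Equiv.Perm.sameCycle_apply_right.mpr s1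
  have s3 : f.SameCycle g (f (f (f g))) := Equiv.Perm.sameCycle_apply_right.mpr s2
  have n0 := hR.apply_ne g
  have n1 := hR.apply_ne (f g)
  have n2 := hR.apply_ne (f (f g))
  by_cases h2 : f (f g) = g
  · have := hmono {g, f g} (by simp [s0, s1])
    rw [Finset.sum_pair n0.symm] at this
    exact (hR.twenty_le_of_apply_apply hC h2).trans this
  have h2' : f (f (f g)) ≠ f g := fun h => h2 (f.injective h)
  by_cases h3 : f (f (f g)) = g
  · have := hmono {g, f g, f (f g)} (by simp [s0, s1, s2])
    rw [Finset.sum_insert (by simp [n0.symm, Ne.symm h2]), Finset.sum_pair n1.symm] at this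
    exact (hR.twenty_le_of_apply_apply_apply hC h3).trans this
  · have := hmono {g, f g, f (f g), f (f (f g))} (by simp [s0, s1, s2, s3])
    rw [Finset.sum_insert (by simp [n0.symm, Ne.symm h2, Ne.symm h3]),
      Finset.sum_insert (by simp [n1.symm, h2'.symm]), Finset.sum_pair n2.symm] at this
    linarith [hR.five_le_charge_add_bonus hC g, hR.five_le_charge_add_bonus hC (f g),
      hR.five_le_charge_add_bonus hC (f (f g)), hR.five_le_charge_add_bonus hC (f (f (f g)))]

end IsReducedRotation

theorem mem_of_jointOrbitSetoid {α : Type*} {f τ : Equiv.Perm α} {S : Finset α}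
    (hf : ∀ x ∈ S, f x ∈ S) (hτ : ∀ x ∈ S, τ x ∈ S) {x y : α} (h : jointOrbitSetoid f τ x y)
    (hx : x ∈ S) : y ∈ S := by
  have key : ∀ π : Equiv.Perm α, (∀ x ∈ S, π x ∈ S) → ∀ z, π z ∈ S ↔ z ∈ S := by
    intro π hπ z
    refine ⟨fun hz => ?_, hπ z⟩
    have : S.map π.toEmbedding = S := Finset.eq_of_subset_of_card_le
      (fun w hw => by
        obtain ⟨v, hv, rfl⟩ := Finset.mem_map.mp hw
        exact hπ v hv) (by rw [Finset.card_map])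
    rw [← this] at hz
    exact (Finset.mem_map' π.toEmbedding).mp hz
  exact (h (· ∈ S) (key f hf) (key τ hτ)).mp hx

namespace IsReducedRotation

variable {V : Type*} {G : SimpleGraph V} {f τ : Equiv.Perm G.Dart}

open Classical in
theorem jointOrbit_subset_pair (hR : IsReducedRotation f τ) {g h : G.Dart}
    (hg : ¬ IsCrossed τ g) (hg1 : f g = g.symm) (hg2 : f g.symm = g)
    (h' : jointOrbitSetoid f τ g h) : h ∈ ({g, g.symm} : Finset G.Dart) := by
  refine mem_of_jointOrbitSetoid ?_ ?_ h' (by simp)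
  · simp [hg1, hg2]
  · simp [apply_of_not_isCrossed hg, hR.apply_symm_of_not_isCrossed hg]

theorem apply_symm_eq (hR : IsReducedRotation f τ) (hC : HasNoCycleOfLength G 4) {g : G.Dart}
    (hg : IsTriangularFace f τ g) (hg' : IsTriangularFace f τ g.symm) :
    f g.symm = (f (f g)).symm ∧ f (f g.symm) = (f g).symm := by
  have e1 := hR.symm_fst_of_not_isCrossed hg.1
  have e2 := hR.symm_fst_of_not_isCrossed hg.2.1
  have e3 := hR.symm_fst_of_not_isCrossed hg.2.2.1
  have e1' := hR.symm_fst_of_not_isCrossed hg'.1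
  have e2' := hR.symm_fst_of_not_isCrossed hg'.2.1
  have e3' := hR.symm_fst_of_not_isCrossed hg'.2.2.1
  rw [hg.2.2.2] at e3
  rw [hg'.2.2.2] at e3'
  rw [SimpleGraph.Dart.symm_symm] at e1'
  have a1 := (f g).adj_symm_fst
  have a2 := (f (f g)).adj_symm_fst
  have a3 := (f g.symm).adj_symm_fst
  have a4 := (f (f g.symm)).adj_symm_fst
  rw [e3] at a2
  rw [e2, ← e1] at a1
  rw [e2', ← e1'] at a3
  rw [e3'] at a4
  have hv := hC.eq_of_common_neighbors g.adj_symm_fst.ne a2.symm a1 a3 a4.symm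
  refine ⟨SimpleGraph.Dart.ext_fst ?_ ?_, SimpleGraph.Dart.ext_fst ?_ ?_⟩
  · rw [e3, e1']
  · rw [SimpleGraph.Dart.symm_symm, e2', hv]
  · rw [e2, hv]
  · rw [SimpleGraph.Dart.symm_symm, e3', e1]

open Classical in
theorem jointOrbit_subset_triangle (hR : IsReducedRotation f τ) (hC : HasNoCycleOfLength G 4)
    {g h : G.Dart} (hg : IsTriangularFace f τ g) (hg' : IsTriangularFace f τ g.symm)
    (h' : jointOrbitSetoid f τ g h) :
    h ∈ ({g, f g, f (f g), g.symm, (f g).symm, (f (f g)).symm} : Finset G.Dart) := by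
  obtain ⟨e1, e2⟩ := hR.apply_symm_eq hC hg hg'
  have e3 := hg'.2.2.2
  rw [e2] at e3
  have e4 := e2
  rw [e1] at e4
  refine mem_of_jointOrbitSetoid ?_ ?_ h' (by simp)
  · simp [hg.2.2.2, e1, e3, e4]
  · simp [apply_of_not_isCrossed hg.1, apply_of_not_isCrossed hg.2.1,
      apply_of_not_isCrossed hg.2.2.1, hR.apply_symm_of_not_isCrossed hg.1,
      hR.apply_symm_of_not_isCrossed hg.2.1, hR.apply_symm_of_not_isCrossed hg.2.2.1]

open Classical in
theorem card_jointOrbit_le [Fintype G.Dart] (hR : IsReducedRotation f τ)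
    (hC : HasNoCycleOfLength G 4) {g : G.Dart} (hg : bonus f τ g ≠ 0) :
    (Finset.univ.filter fun h => jointOrbitSetoid f τ g h).card ≤ 6 := by
  unfold bonus at hg
  split_ifs at hg with h1 h2
  · refine (Finset.card_le_card fun h hh =>
      hR.jointOrbit_subset_pair h1.1 h1.2.1 h1.2.2 (Finset.mem_filter.mp hh).2).trans ?_
    exact Finset.card_le_two.trans (by norm_num)
  · refine (Finset.card_le_card fun h hh =>
      hR.jointOrbit_subset_triangle hC h2.1 h2.2 (Finset.mem_filter.mp hh).2).trans ?_
    exact Finset.card_le_six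
  · exact absurd rfl hg

open Classical in
theorem sum_bonus_le [Fintype G.Dart] (hR : IsReducedRotation f τ)
    (hC : HasNoCycleOfLength G 4) (g : G.Dart) :
    ∑ h with jointOrbitSetoid f τ g h, bonus f τ h ≤ 8 := by
  let r := jointOrbitSetoid f τ
  have hle : ∀ h, bonus f τ h ≤ 4 := fun h => by
    unfold bonus
    split_ifs <;> norm_num
  by_cases hex : ∃ y, r g y ∧ ¬ IsCrossed τ y ∧ f y = y.symm ∧ f y.symm = y
  · obtain ⟨y, hy, h1, h2, h3⟩ := hex
    have hcard : (Finset.univ.filter fun h => r g h).card ≤ 2 :=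
      (Finset.card_le_card fun h hh => hR.jointOrbit_subset_pair h1 h2 h3
        (r.trans (r.symm hy) (Finset.mem_filter.mp hh).2)).trans Finset.card_le_two
    have := Finset.sum_le_card_nsmul (Finset.univ.filter fun h => r g h) (bonus f τ) 4
      fun h _ => hle h
    rw [nsmul_eq_mul] at this
    have hcard' : ((Finset.univ.filter fun h => r g h).card : ℤ) ≤ 2 := by exact_mod_cast hcard
    exact this.trans (by linarith)
  · by_cases hex' : ∃ y, r g y ∧ bonus f τ y ≠ 0
    · obtain ⟨y, hy, h1⟩ := hex'
      have hcard : (Finset.univ.filter fun h => r g h).card ≤ 6 :=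
        (Finset.card_le_card fun h hh => Finset.mem_filter.mpr ⟨Finset.mem_univ _,
          r.trans (r.symm hy) (Finset.mem_filter.mp hh).2⟩).trans (hR.card_jointOrbit_le hC h1)
      have := Finset.sum_le_card_nsmul (Finset.univ.filter fun h => r g h) (bonus f τ) 1
        fun h hh => by
          unfold bonus
          rw [if_neg fun h2 => hex ⟨h, (Finset.mem_filter.mp hh).2, h2⟩]
          split_ifs <;> norm_num
      rw [nsmul_eq_mul] at this
      have hcard' : ((Finset.univ.filter fun h => r g h).card : ℤ) ≤ 6 := by exact_mod_cast hcard
      exact this.trans (by linarith)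
    · refine (Finset.sum_eq_zero fun h hh => ?_).trans_le (by norm_num)
      by_contra h0
      exact hex' ⟨h, (Finset.mem_filter.mp hh).2, h0⟩

open Classical in
theorem four_le_sum [Fintype G.Dart] (hR : IsReducedRotation f τ) (g : G.Dart) :
    4 ≤ ∑ h with τ.SameCycle g h, if IsCrossed τ h then (1 : ℤ) else 2 := by
  have hmono : ∀ s : Finset G.Dart, (∀ h ∈ s, τ.SameCycle g h) →
      ∑ h ∈ s, (if IsCrossed τ h then (1 : ℤ) else 2) ≤
        ∑ h with τ.SameCycle g h, if IsCrossed τ h then (1 : ℤ) else 2 := fun s hs =>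
    Finset.sum_le_sum_of_subset_of_nonneg
      (fun h hh => Finset.mem_filter.mpr ⟨Finset.mem_univ _, hs h hh⟩)
      fun h _ _ => by split_ifs <;> norm_num
  have s0 : τ.SameCycle g g := Equiv.Perm.SameCycle.refl _ _
  have s1 : τ.SameCycle g (τ g) := Equiv.Perm.sameCycle_apply_right.mpr s0
  have s2 : τ.SameCycle g (τ (τ g)) := Equiv.Perm.sameCycle_apply_right.mpr s1
  have s3 : τ.SameCycle g (τ (τ (τ g))) := Equiv.Perm.sameCycle_apply_right.mpr s2
  have hne : ∀ x, τ x ≠ x := fun x h => hR.apply_fst_ne x (by rw [h])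
  by_cases hg : IsCrossed τ g
  · have h1 := hR.isCrossed_apply.mpr hg
    have h2 := hR.isCrossed_apply.mpr h1
    have h3 := hR.isCrossed_apply.mpr h2
    have n2 : g ≠ τ (τ g) := by
      rw [hR.apply_apply hg]
      exact g.symm_ne.symm
    have n3 : g ≠ τ (τ (τ g)) := by
      rw [hR.apply_apply h1]
      intro h
      exact hg (by rw [h, SimpleGraph.Dart.symm_symm, ← h])
    have n3' : τ g ≠ τ (τ (τ g)) := fun h => n2 (τ.injective h)
    have := hmono {g, τ g, τ (τ g), τ (τ (τ g))} (by simp [s0, s1, s2, s3])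
    rw [Finset.sum_insert (by simp [(hne g).symm, n2, n3]),
      Finset.sum_insert (by simp [(hne (τ g)).symm, n3']), Finset.sum_pair (hne _).symm,
      if_pos hg, if_pos h1, if_pos h2, if_pos h3] at this
    linarith
  · have h1 : ¬ IsCrossed τ (τ g) := fun h => hg (hR.isCrossed_apply.mp h)
    have := hmono {g, τ g} (by simp [s0, s1])
    rw [Finset.sum_pair (hne g).symm, if_neg hg, if_neg h1] at this
    linarith

end IsReducedRotation

theorem IsPlanarRotation.card_dart_le {V : Type*} [Fintype V] {G : SimpleGraph V}
    [Fintype G.Dart] {ν τ : Equiv.Perm G.Dart} (hR : IsPlanarRotation ν τ)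
    (hred : ∀ h, (τ h = h.symm ∧ τ h.symm = h) ∨
      (τ h ≠ h.symm ∧ τ (τ h) = h.symm ∧ (τ h).fst ≠ h.fst))
    (hC : HasNoCycleOfLength G 4) (hn : 4 ≤ Fintype.card V) :
    4 * Fintype.card G.Dart + 40 ≤ 20 * Fintype.card V := by
  classical
  have : Nonempty V := Fintype.card_pos_iff.mp (by omega)
  rcases isEmpty_or_nonempty G.Dart with he | ⟨⟨g₀⟩⟩
  · rw [Fintype.card_eq_zero]
    omega
  have hred' : IsReducedRotation (ν * τ) τ := ⟨fun h => hR.fst_apply (τ h), hred⟩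
  have e1 := hR.euler
  have e2 := mul_card_quotient_le_sum (Equiv.Perm.SameCycle.setoid τ)
    (fun h => if IsCrossed τ h then 1 else 2) 4 fun g => by
      convert hred'.four_le_sum g
      exact Iff.rfl
  have e3 := mul_card_quotient_le_sum (Equiv.Perm.SameCycle.setoid (ν * τ))
    (fun h => IsReducedRotation.charge (ν * τ) τ h + IsReducedRotation.bonus (ν * τ) τ h) 20
    fun g => by
      convert hred'.twenty_le_sum hC g
      exact Iff.rfl
  have e4 := sum_le_mul_card_quotient (jointOrbitSetoid (ν * τ) τ) _ 8 (hred'.sum_bonus_le hC)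
  have e5 : 5 * ∑ h, (if IsCrossed τ h then (1 : ℤ) else 2) +
      ∑ h, (if IsCrossed τ h then (11 : ℤ) else 6) = 16 * Fintype.card G.Dart := by
    rw [Finset.mul_sum, ← Finset.sum_add_distrib, Finset.sum_congr rfl
      (g := fun _ => (16 : ℤ)) fun h _ => by split_ifs <;> norm_num]
    simp [mul_comm]
  rw [Finset.sum_add_distrib, IsReducedRotation.sum_charge] at e3
  have e6 : 0 < Nat.card (Quotient (jointOrbitSetoid (ν * τ) τ)) := by
    have : Nonempty (Quotient (jointOrbitSetoid (ν * τ) τ)) := ⟨Quotient.mk _ g₀⟩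
    exact Nat.card_pos
  by_cases h2 : 2 ≤ Nat.card (Quotient (jointOrbitSetoid (ν * τ) τ))
  · omega
  by_cases h0 : ∀ h, IsReducedRotation.bonus (ν * τ) τ h = 0
  · rw [Finset.sum_eq_zero fun h _ => h0 h] at e3
    omega
  · push Not at h0
    obtain ⟨g, hg⟩ := h0
    have hcard := hred'.card_jointOrbit_le hC hg
    have hsub : Subsingleton (Quotient (jointOrbitSetoid (ν * τ) τ)) :=
      Finite.card_le_one_iff_subsingleton.mp (by omega)
    rw [Finset.filter_true_of_mem fun h _ => Quotient.exact (hsub.elim _ _),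
      Finset.card_univ] at hcard
    omega

theorem stmt_5 {V : Type} [Fintype V] (G : SimpleGraph V)
    (hC4 : HasNoCycleOfLength G 4) (hG : KPlanar G 1)
    (hn : 4 ≤ Fintype.card V) :
    (G.edgeSet.ncard : ℝ) ≤ (5 / 2) * ((Fintype.card V : ℝ) - 2) := by
  classical
  obtain ⟨D, hD⟩ := hG
  obtain ⟨ν₀, τ₀, hR₀⟩ := D.exists_isPlanarRotation hD
  obtain ⟨ν, τ, hR, hred⟩ := hR₀.exists_reduced
  have h := hR.card_dart_le hred hC4 hn
  rw [SimpleGraph.dart_card_eq_twice_card_edges, SimpleGraph.edgeFinset,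
    ← Set.ncard_eq_toFinset_card'] at h
  have h' : (4 * (2 * G.edgeSet.ncard) + 40 : ℝ) ≤ 20 * Fintype.card V := by exact_mod_cast h
  linarith
end

section
/- There exist a constant C ≥ 0 and a threshold N such that for every integer n ≥ N there exists a C₄-free 1-planar finite simple graph on n vertices with at least (12/5)·n − C edges. -/
open unitInterval

/-! ### Straight-line drawings -/

/-- The placement `q` of the vertices of `G` yields a straight-line drawing in which every edge
is crossed by at most one other edge. -/
structure IsStraightOnePlane {V E : Type*} [AddCommGroup E] [Module ℝ E] (G : SimpleGraph V)
    (q : V → E) : Prop where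
  inj : Function.Injective q
  vertex_mem : ∀ ⦃u v : V⦄, G.Adj u v → ∀ w, q w ∈ segment ℝ (q u) (q v) → w = u ∨ w = v
  inter_subsingleton : ∀ ⦃u v x y : V⦄, G.Adj u v → G.Adj x y → s(u, v) ≠ s(x, y) →
    (segment ℝ (q u) (q v) ∩ segment ℝ (q x) (q y)).Subsingleton
  crossing_unique : ∀ ⦃u v x y x' y' : V⦄, G.Adj u v → G.Adj x y → G.Adj x' y' →
    s(u, v) ≠ s(x, y) → s(u, v) ≠ s(x', y') →
    (openSegment ℝ (q u) (q v) ∩ openSegment ℝ (q x) (q y)).Nonempty →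
    (openSegment ℝ (q u) (q v) ∩ openSegment ℝ (q x') (q y')).Nonempty →
    s(x, y) = s(x', y')

namespace IsStraightOnePlane

variable {V W E F : Type*} [AddCommGroup E] [Module ℝ E] [AddCommGroup F] [Module ℝ F]
  {G : SimpleGraph V} {q : V → E}

theorem comap (h : IsStraightOnePlane G q) {f : W → V} (hf : Function.Injective f) :
    IsStraightOnePlane (G.comap f) (q ∘ f) := by
  have key : ∀ u v x y : W, s(u, v) ≠ s(x, y) → s(f u, f v) ≠ s(f x, f y) :=
    fun u v x y hne he => hne (Sym2.map.injective hf he)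
  refine ⟨h.inj.comp hf, ?_, ?_, ?_⟩
  · intro u v huv w hw
    exact (h.vertex_mem huv (f w) hw).imp (fun e => hf e) (fun e => hf e)
  · intro u v x y huv hxy hne
    exact h.inter_subsingleton huv hxy (key _ _ _ _ hne)
  · intro u v x y x' y' huv hxy hxy' hne hne' hc hc'
    exact Sym2.map.injective hf
      (h.crossing_unique huv hxy hxy' (key _ _ _ _ hne) (key _ _ _ _ hne') hc hc')

theorem map (h : IsStraightOnePlane G q) (L : E →ₗ[ℝ] F) (hL : Function.Injective L) :
    IsStraightOnePlane G (L ∘ q) := by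
  have hs : ∀ u v, segment ℝ ((L ∘ q) u) ((L ∘ q) v) = L '' segment ℝ (q u) (q v) :=
    fun u v => (image_segment ℝ L.toAffineMap _ _).symm
  have ho : ∀ u v, openSegment ℝ ((L ∘ q) u) ((L ∘ q) v) = L '' openSegment ℝ (q u) (q v) :=
    fun u v => (image_openSegment ℝ L.toAffineMap _ _).symm
  refine ⟨hL.comp h.inj, ?_, ?_, ?_⟩
  · intro u v huv w hw
    rw [hs] at hw
    exact h.vertex_mem huv w ((hL.mem_set_image).1 hw)
  · intro u v x y huv hxy hne
    rw [hs, hs, ← Set.image_inter hL]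
    exact (h.inter_subsingleton huv hxy hne).image L
  · intro u v x y x' y' huv hxy hxy' hne hne' hc hc'
    rw [ho, ho, ← Set.image_inter hL, Set.image_nonempty] at hc hc'
    exact h.crossing_unique huv hxy hxy' hne hne' hc hc'

theorem mem_openSegment_of_ne {a b : ℝ × ℝ} {t : I} (h0 : t ≠ 0) (h1 : t ≠ 1) :
    Path.segment a b t ∈ openSegment ℝ a b := by
  rw [openSegment_eq_image_lineMap]
  exact ⟨t, ⟨unitInterval.pos_iff_ne_zero.2 h0, unitInterval.lt_one_iff_ne_one.2 h1⟩, rfl⟩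

theorem mem_segment (a b : ℝ × ℝ) (t : I) : Path.segment a b t ∈ segment ℝ a b := by
  rw [← Path.range_segment]
  exact Set.mem_range_self t

theorem kPlanar {p : V → ℝ × ℝ} (h : IsStraightOnePlane G p) : KPlanar G 1 := by
  let D : PlaneDrawing G :=
    { pos := p
      pos_inj := h.inj
      arc := fun u v _ => Path.segment (p u) (p v)
      arc_symm := fun u v _ => (Path.segment_symm _ _).symm
      arc_inj := fun u v huv => Path.segment_injective_of_ne (h.inj.ne huv.ne)
      no_vertex_mem := fun u v huv w t ht =>
        h.vertex_mem huv w (ht ▸ mem_segment _ _ t)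
      finite_inter := fun u v x y huv hxy hne => by
        rw [Path.range_segment, Path.range_segment]
        exact (h.inter_subsingleton huv hxy hne).finite
      no_triple_point := fun u₁ v₁ u₂ v₂ u₃ v₃ h₁ h₂ h₃ h12 h13 h23 t₁ t₂ t₃ a1 b1 a2 b2 a3 b3
          e12 e23 => by
        refine h23 (h.crossing_unique h₁ h₂ h₃ h12 h13
          ⟨_, mem_openSegment_of_ne a1 b1, ?_⟩ ⟨_, mem_openSegment_of_ne a1 b1, ?_⟩)
        · rw [e12]; exact mem_openSegment_of_ne a2 b2
        · rw [e12, e23]; exact mem_openSegment_of_ne a3 b3 }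
  have hint : ∀ {u v : V} (huv : G.Adj u v) (z : ℝ × ℝ), D.IsInteriorPoint huv z →
      z ∈ openSegment ℝ (p u) (p v) := by
    rintro u v huv z ⟨t, h0, h1, rfl⟩
    exact mem_openSegment_of_ne h0 h1
  refine ⟨D, fun u v huv => ?_⟩
  have hsub : (D.edgeCrossings huv).Subsingleton := by
    rintro z ⟨hz, x, y, hxy, hne, hz'⟩ w ⟨hw, x', y', hxy', hne', hw'⟩
    have hzo := hint _ _ hz
    have hwo := hint _ _ hw
    have hzo' := hint _ _ hz'
    have hwo' := hint _ _ hw'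
    have he := h.crossing_unique huv hxy hxy' hne hne' ⟨z, hzo, hzo'⟩ ⟨w, hwo, hwo'⟩
    have hseg : segment ℝ (p x') (p y') = segment ℝ (p x) (p y) := by
      rcases Sym2.eq_iff.1 he with ⟨rfl, rfl⟩ | ⟨rfl, rfl⟩
      · rfl
      · exact segment_symm _ _ _
    exact h.inter_subsingleton huv hxy hne
      ⟨openSegment_subset_segment _ _ _ hzo, openSegment_subset_segment _ _ _ hzo'⟩
      ⟨openSegment_subset_segment _ _ _ hwo,
        hseg ▸ openSegment_subset_segment _ _ _ hwo'⟩
  exact (Set.ncard_le_one hsub.finite).2 fun a ha b hb => hsub ha hb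

end IsStraightOnePlane

/-! ### Segments in the complex plane -/

/-- Twice the signed area of the triangle `a b c`. -/
def signedArea (a b c : ℂ) : ℝ :=
  (b.re - a.re) * (c.im - a.im) - (b.im - a.im) * (c.re - a.re)

theorem signedArea_combo (a b r s : ℂ) {x y : ℝ} (h : x + y = 1) :
    signedArea a b (x • r + y • s) = x * signedArea a b r + y * signedArea a b s := by
  obtain rfl : x = 1 - y := by linarith
  simp [signedArea]
  ring

theorem signedArea_eq_zero_of_mem {a b z : ℂ} (hz : z ∈ segment ℝ a b) :
    signedArea a b z = 0 := by
  obtain ⟨x, y, -, -, h, rfl⟩ := hz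
  rw [signedArea_combo _ _ _ _ h]
  simp [signedArea]
  right; ring

theorem disjoint_segment_of_signedArea {a b r s : ℂ}
    (h : 0 < signedArea a b r * signedArea a b s) :
    Disjoint (segment ℝ a b) (segment ℝ r s) := by
  rw [Set.disjoint_left]
  rintro z hz ⟨x, y, hx, hy, hxy, rfl⟩
  have h0 := signedArea_eq_zero_of_mem hz
  rw [signedArea_combo _ _ _ _ hxy] at h0
  have hr : signedArea a b r ≠ 0 := fun h' => by simp [h'] at h
  have h1 : x * signedArea a b r ^ 2 + y * (signedArea a b r * signedArea a b s) = 0 := by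
    linear_combination signedArea a b r * h0
  have h2 : 0 < signedArea a b r ^ 2 := by positivity
  rcases hx.eq_or_lt with rfl | hx
  · obtain rfl : y = 1 := by linarith
    linarith
  · have := mul_pos hx h2
    have := mul_nonneg hy h.le
    linarith

theorem subsingleton_segment_inter {a b r s : ℂ}
    (h : (b.re - a.re) * (s.im - r.im) - (b.im - a.im) * (s.re - r.re) ≠ 0) :
    (segment ℝ a b ∩ segment ℝ r s).Subsingleton := by
  rintro z ⟨hz, hz'⟩ w ⟨hw, hw'⟩
  rw [segment_eq_image'] at hz hz' hw hw'
  obtain ⟨t, -, rfl⟩ := hz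
  obtain ⟨t', -, ht'⟩ := hz'
  obtain ⟨u, -, rfl⟩ := hw
  obtain ⟨u', -, hu'⟩ := hw'
  have e1 := congrArg Complex.re ht'
  have e2 := congrArg Complex.im ht'
  have e3 := congrArg Complex.re hu'
  have e4 := congrArg Complex.im hu'
  simp at e1 e2 e3 e4
  have : (t - u) * ((b.re - a.re) * (s.im - r.im) - (b.im - a.im) * (s.re - r.re)) = 0 := by
    linear_combination (s.im - r.im) * (e3 - e1) - (s.re - r.re) * (e4 - e2)
  rcases mul_eq_zero.1 this with h' | h'
  · rw [sub_eq_zero.1 h']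
  · exact absurd h' h

theorem normSq_le_of_mem_segment {a b z : ℂ} {r : ℝ} (ha : Complex.normSq a ≤ r)
    (hb : Complex.normSq b ≤ r) (hz : z ∈ segment ℝ a b) : Complex.normSq z ≤ r := by
  obtain ⟨x, y, hx, hy, h, rfl⟩ := hz
  obtain rfl : x = 1 - y := by linarith
  simp only [Complex.normSq_apply, Complex.add_re, Complex.add_im, Complex.real_smul,
    Complex.mul_re, Complex.mul_im, Complex.ofReal_re, Complex.ofReal_im] at *
  nlinarith [mul_nonneg (mul_nonneg hx hy) (add_nonneg (sq_nonneg (a.re - b.re))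
    (sq_nonneg (a.im - b.im))), mul_le_mul_of_nonneg_left ha hx, mul_le_mul_of_nonneg_left hb hy]

/-- The real inner product of two complex numbers. -/
def dot (a b : ℂ) : ℝ := a.re * b.re + a.im * b.im

theorem lt_normSq_of_mem_segment {a b n z : ℂ} {r : ℝ} (ha : 0 < dot n a)
    (ha' : r * Complex.normSq n < dot n a ^ 2) (hb : 0 < dot n b)
    (hb' : r * Complex.normSq n < dot n b ^ 2) (hz : z ∈ segment ℝ a b) :
    r < Complex.normSq z := by
  obtain ⟨x, y, hx, hy, h, rfl⟩ := hz
  set z := x • a + y • b with hz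
  have hdot : dot n z = x * dot n a + y * dot n b := by
    simp [dot, hz]; ring
  have hcs : dot n z ^ 2 ≤ Complex.normSq z * Complex.normSq n := by
    simp only [dot, Complex.normSq_apply]
    nlinarith [sq_nonneg (n.re * z.im - n.im * z.re)]
  have hle : r * Complex.normSq n < dot n z ^ 2 := by
    rcases le_total (dot n a) (dot n b) with hab | hab
    · have : dot n a ≤ dot n z := by nlinarith
      nlinarith
    · have : dot n b ≤ dot n z := by nlinarith
      nlinarith
  exact lt_of_mul_lt_mul_right (hle.trans_le hcs) (Complex.normSq_nonneg n)

/-! ### A periodic graph drawn along a spiral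

The vertices are `ℤ × Fin 10`, and the layers are related by the similarity `z ↦ (-1 + I) * z`. -/

namespace Spiral

/-- The positions of the vertices of layer `0`, as Gaussian integers. -/
def base : Fin 10 → ℤ × ℤ :=
  ![(16, -5), (2, -12), (21, -12), (7, -9), (11, -15), (1, -18), (12, -1), (12, 6), (6, -21),
    (21, 2)]

/-- An edge pattern `(a, b, d)` stands for the edges joining `(i, a)` and `(i + d, b)`. -/
abbrev Pattern := Fin 10 × Fin 10 × ℕ

/-- The edge patterns of the periodic graph. -/
def patterns : List Pattern :=
  [(7, 3, 1), (2, 1, 3), (0, 7, 0), (6, 9, 0), (2, 0, 0), (4, 9, 0), (8, 6, 2), (8, 4, 0),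
    (3, 5, 0), (4, 1, 0), (5, 8, 0), (5, 3, 2), (9, 6, 3), (7, 5, 1), (9, 1, 1), (9, 2, 0),
    (3, 1, 0), (9, 0, 0), (8, 7, 2), (0, 3, 0), (4, 6, 0), (2, 3, 3), (5, 6, 2), (4, 7, 2)]

/-- `(e, f, k)` records that the edge with pattern `e` starting in layer `i` crosses the edge
with pattern `f` starting in layer `i + k`. -/
def crossingPatterns : List (Pattern × Pattern × ℕ) :=
  [((2, 1, 3), (7, 3, 1), 2), ((0, 7, 0), (6, 9, 0), 0), ((0, 3, 0), (4, 6, 0), 0),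
    ((2, 0, 0), (4, 9, 0), 0), ((9, 6, 3), (5, 3, 2), 1), ((7, 5, 1), (9, 1, 1), 0),
    ((3, 5, 0), (4, 1, 0), 0)]

/-- The pattern `e` joins `u` to `v`. -/
def Joins (e : Pattern) (u v : ℤ × Fin 10) : Prop :=
  u.2 = e.1 ∧ v.2 = e.2.1 ∧ v.1 = u.1 + e.2.2

/-- The periodic graph with the given edge patterns. -/
def graph : SimpleGraph (ℤ × Fin 10) where
  Adj u v := ∃ e ∈ patterns, Joins e u v ∨ Joins e v u
  symm := ⟨fun _ _ ⟨e, he, h⟩ => ⟨e, he, h.symm⟩⟩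
  loopless := ⟨by
    have key : ∀ e ∈ patterns, e.1 ≠ e.2.1 := by decide
    rintro u ⟨e, he, h | h⟩ <;> exact key e he (h.1.symm.trans h.2.1)⟩

/-! #### Absence of 4-cycles -/

/-- The oriented edge patterns. -/
def darts : List (Fin 10 × Fin 10 × ℤ) :=
  patterns.map (fun e => (e.1, e.2.1, (e.2.2 : ℤ))) ++
    patterns.map (fun e => (e.2.1, e.1, -(e.2.2 : ℤ)))

theorem mem_darts {u v : ℤ × Fin 10} (h : graph.Adj u v) : (u.2, v.2, v.1 - u.1) ∈ darts := by
  obtain ⟨e, he, h | h⟩ := h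
  · refine List.mem_append_left _ (List.mem_map.2 ⟨e, he, ?_⟩)
    obtain ⟨h1, h2, h3⟩ := h
    rw [h1, h2, h3, add_sub_cancel_left]
  · refine List.mem_append_right _ (List.mem_map.2 ⟨e, he, ?_⟩)
    obtain ⟨h1, h2, h3⟩ := h
    rw [h1, h2, h3, sub_add_cancel_left]

theorem darts_unique : ∀ d₁ ∈ darts, ∀ d₂ ∈ darts, d₁.2.1 = d₂.1 → ∀ d₃ ∈ darts, d₁.1 = d₃.1 →
    ∀ d₄ ∈ darts, d₃.2.1 = d₄.1 → d₂.2.1 = d₄.2.1 → d₁.2.2 + d₂.2.2 = d₃.2.2 + d₄.2.2 →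
    (d₁.1 = d₂.2.1 ∧ d₁.2.2 + d₂.2.2 = 0) ∨ d₁ = d₃ := by
  decide +kernel

theorem common_neighbor_unique {u v w w' : ℤ × Fin 10} (huv : u ≠ v) (h₁ : graph.Adj u w)
    (h₂ : graph.Adj w v) (h₃ : graph.Adj u w') (h₄ : graph.Adj w' v) : w = w' := by
  rcases darts_unique _ (mem_darts h₁) _ (mem_darts h₂) rfl _ (mem_darts h₃) rfl _ (mem_darts h₄)
    rfl rfl (by simp) with ⟨h, h'⟩ | h
  · refine absurd (Prod.ext ?_ h) huv
    simp only at h'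
    omega
  · simp only [Prod.mk.injEq, true_and] at h
    exact Prod.ext (by omega) h.1

/-! #### Coordinates -/

/-- The Gaussian integer `p` as a complex number. -/
def toComplex (p : ℤ × ℤ) : ℂ := ⟨p.1, p.2⟩

/-- The ratio of the similarity relating consecutive layers. -/
def ratio : ℂ := ⟨-1, 1⟩

/-- Multiplication of a Gaussian integer by `-1 + I`. -/
def rotate (p : ℤ × ℤ) : ℤ × ℤ := (-p.1 - p.2, p.1 - p.2)

/-- The position of the vertex `(k, a)` as a Gaussian integer. -/
def point (k : ℕ) (a : Fin 10) : ℤ × ℤ := rotate^[k] (base a)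

/-- The position of a vertex. -/
noncomputable def pos (v : ℤ × Fin 10) : ℂ := ratio ^ v.1 * toComplex (base v.2)

theorem ratio_ne_zero : ratio ≠ 0 := fun h => by
  have := congrArg Complex.im h
  simp [ratio] at this

theorem toComplex_rotate (p : ℤ × ℤ) : toComplex (rotate p) = ratio * toComplex p := by
  apply Complex.ext
  · simp [toComplex, rotate, ratio]
  · simp [toComplex, rotate, ratio]
    ring

theorem toComplex_point (k : ℕ) (a : Fin 10) :
    toComplex (point k a) = ratio ^ k * toComplex (base a) := by
  induction k with
  | zero => simp [point]
  | succ k ih =>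
    rw [point, Function.iterate_succ_apply', ← point, toComplex_rotate, ih, pow_succ']
    ring

theorem pos_add (i : ℤ) (k : ℕ) (a : Fin 10) :
    pos (i + k, a) = ratio ^ i * toComplex (point k a) := by
  rw [toComplex_point, pos, zpow_add₀ ratio_ne_zero, zpow_natCast, mul_assoc]

theorem normSq_ratio_zpow (i : ℤ) : Complex.normSq (ratio ^ i) = 2 ^ i := by
  rw [map_zpow₀]
  congr 1
  norm_num [ratio, Complex.normSq_apply]

/-! #### Edges -/

/-- An edge is given by the layer of its source and its pattern. -/
abbrev Edge := ℤ × Pattern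

/-- The source of an edge. -/
def Edge.src (x : Edge) : ℤ × Fin 10 := (x.1, x.2.1)

/-- The target of an edge. -/
def Edge.tgt (x : Edge) : ℤ × Fin 10 := (x.1 + x.2.2.2, x.2.2.1)

/-- The segment representing an edge. -/
def Edge.seg (x : Edge) : Set ℂ := segment ℝ (pos x.src) (pos x.tgt)

/-- The segment of the edge of pattern `e` starting in layer `k`. -/
def patternSeg (k : ℕ) (e : Pattern) : Set ℂ :=
  segment ℝ (toComplex (point k e.1)) (toComplex (point (k + e.2.2) e.2.1))

theorem seg_add (i : ℤ) (k : ℕ) (e : Pattern) :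
    Edge.seg (i + k, e) = (fun z => ratio ^ i * z) '' patternSeg k e := by
  have := image_segment ℝ (LinearMap.mulLeft ℝ (ratio ^ i)).toAffineMap
    (toComplex (point k e.1)) (toComplex (point (k + e.2.2) e.2.1))
  rw [Edge.seg, Edge.src, Edge.tgt]
  simp only
  rw [add_assoc, ← Nat.cast_add, pos_add, pos_add]
  exact this.symm

theorem seg_eq (i : ℤ) (e : Pattern) :
    Edge.seg (i, e) = (fun z => ratio ^ i * z) '' patternSeg 0 e := by
  simpa using seg_add i 0 e

theorem mul_ratio_injective (i : ℤ) : Function.Injective fun z : ℂ => ratio ^ i * z :=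
  mul_right_injective₀ (zpow_ne_zero i ratio_ne_zero)

/-- Integer version of `signedArea`. -/
def orient (a b c : ℤ × ℤ) : ℤ :=
  (b.1 - a.1) * (c.2 - a.2) - (b.2 - a.2) * (c.1 - a.1)

theorem signedArea_toComplex (a b c : ℤ × ℤ) :
    signedArea (toComplex a) (toComplex b) (toComplex c) = orient a b c := by
  simp [signedArea, toComplex, orient]

/-- The lines through `a`, `b` and `c`, `d` are certificates that the segments are disjoint. -/
def Separated (a b c d : ℤ × ℤ) : Prop :=
  0 < orient a b c * orient a b d ∨ 0 < orient c d a * orient c d b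

instance (a b c d : ℤ × ℤ) : Decidable (Separated a b c d) :=
  inferInstanceAs (Decidable (_ ∨ _))

theorem Separated.disjoint {a b c d : ℤ × ℤ} (h : Separated a b c d) :
    Disjoint (segment ℝ (toComplex a) (toComplex b))
      (segment ℝ (toComplex c) (toComplex d)) := by
  rcases h with h | h
  · apply disjoint_segment_of_signedArea
    rw [signedArea_toComplex, signedArea_toComplex]
    exact_mod_cast h
  · apply Disjoint.symm
    apply disjoint_segment_of_signedArea
    rw [signedArea_toComplex, signedArea_toComplex]
    exact_mod_cast h

/-- The edge of pattern `e` from layer `0` and that of pattern `f` from layer `k` share an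
endpoint. -/
def ShareEndpoint (e f : Pattern) (k : ℕ) : Prop :=
  (0 = k ∧ e.1 = f.1) ∨ (0 = k + f.2.2 ∧ e.1 = f.2.1) ∨ (e.2.2 = k ∧ e.2.1 = f.1) ∨
    (e.2.2 = k + f.2.2 ∧ e.2.1 = f.2.1)

instance (e f : Pattern) (k : ℕ) : Decidable (ShareEndpoint e f k) :=
  inferInstanceAs (Decidable (_ ∨ _))

/-- Non-vanishing of the determinant of `b - a` and `d - c`. -/
def Nonparallel (a b c d : ℤ × ℤ) : Prop :=
  (b.1 - a.1) * (d.2 - c.2) - (b.2 - a.2) * (d.1 - c.1) ≠ 0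

instance (a b c d : ℤ × ℤ) : Decidable (Nonparallel a b c d) :=
  inferInstanceAs (Decidable (_ ≠ _))

theorem Nonparallel.subsingleton {a b c d : ℤ × ℤ} (h : Nonparallel a b c d) :
    (segment ℝ (toComplex a) (toComplex b) ∩
      segment ℝ (toComplex c) (toComplex d)).Subsingleton := by
  apply subsingleton_segment_inter
  simp only [toComplex]
  exact_mod_cast h

/-- The edge of pattern `e` from layer `0` and that of pattern `f` from layer `k` cross. -/
def CrossPattern (e f : Pattern) (k : ℕ) : Prop :=
  (e, f, k) ∈ crossingPatterns ∨ (k = 0 ∧ (f, e, 0) ∈ crossingPatterns)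

instance (e f : Pattern) (k : ℕ) : Decidable (CrossPattern e f k) :=
  inferInstanceAs (Decidable (_ ∨ _))

theorem near_edges : ∀ k ∈ List.range 4, ∀ e ∈ patterns, ∀ f ∈ patterns, (0 = k ∧ e = f) ∨
    Separated (point 0 e.1) (point e.2.2 e.2.1) (point k f.1) (point (k + f.2.2) f.2.1) ∨
    (Nonparallel (point 0 e.1) (point e.2.2 e.2.1) (point k f.1) (point (k + f.2.2) f.2.1) ∧
      (ShareEndpoint e f k ∨ CrossPattern e f k)) := by
  decide +kernel

theorem crossingPatterns_unique : ∀ c ∈ crossingPatterns, ∀ c' ∈ crossingPatterns,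
    (c.1 = c'.1 → c = c') ∧ c.1 ≠ c'.2.1 ∧ (c.2.1 = c'.2.1 → c = c') := by
  decide +kernel

theorem endpoints_ne : ∀ e ∈ patterns, point 0 e.1 ≠ point e.2.2 e.2.1 := by
  decide +kernel

theorem exists_pattern : ∀ a : Fin 10, ∃ e ∈ patterns, e.1 = a ∨ e.2.1 = a := by
  decide +kernel

theorem near_vertices_above : ∀ k ∈ List.range 4, ∀ e ∈ patterns, ∀ a : Fin 10,
    (0 = k ∧ e.1 = a) ∨ (e.2.2 = k ∧ e.2.1 = a) ∨
    Separated (point 0 e.1) (point e.2.2 e.2.1) (point k a) (point k a) := by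
  decide +kernel

theorem near_vertices_below : ∀ k ∈ List.range 4, ∀ e ∈ patterns, ∀ a : Fin 10,
    (k = 0 ∧ e.1 = a) ∨ (k + e.2.2 = 0 ∧ e.2.1 = a) ∨
    Separated (point 0 a) (point 0 a) (point k e.1) (point (k + e.2.2) e.2.1) := by
  decide +kernel

theorem norm_base : ∀ a : Fin 10, (base a).1 ^ 2 + (base a).2 ^ 2 ≤ 1184 ∧
    74 < (base a).1 ^ 2 + (base a).2 ^ 2 := by
  decide +kernel

theorem norm_point : ∀ e ∈ patterns,
    (point e.2.2 e.2.1).1 ^ 2 + (point e.2.2 e.2.1).2 ^ 2 ≤ 1184 := by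
  decide +kernel

/-- Integer version of `dot`. -/
def intDot (a b : ℤ × ℤ) : ℤ := a.1 * b.1 + a.2 * b.2

theorem far_edges : ∀ e ∈ patterns,
    0 < intDot (point 0 e.1 + point e.2.2 e.2.1) (point 0 e.1) ∧
    74 * intDot (point 0 e.1 + point e.2.2 e.2.1) (point 0 e.1 + point e.2.2 e.2.1) <
      intDot (point 0 e.1 + point e.2.2 e.2.1) (point 0 e.1) ^ 2 ∧
    0 < intDot (point 0 e.1 + point e.2.2 e.2.1) (point e.2.2 e.2.1) ∧
    74 * intDot (point 0 e.1 + point e.2.2 e.2.1) (point 0 e.1 + point e.2.2 e.2.1) <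
      intDot (point 0 e.1 + point e.2.2 e.2.1) (point e.2.2 e.2.1) ^ 2 := by
  decide +kernel


theorem normSq_toComplex (p : ℤ × ℤ) :
    Complex.normSq (toComplex p) = ((p.1 ^ 2 + p.2 ^ 2 : ℤ) : ℝ) := by
  simp [toComplex, Complex.normSq_apply, sq]

theorem dot_toComplex (p q : ℤ × ℤ) : dot (toComplex p) (toComplex q) = intDot p q := by
  simp [toComplex, dot, intDot]

theorem normSq_le_of_mem_patternSeg {e : Pattern} (he : e ∈ patterns) {z : ℂ}
    (hz : z ∈ patternSeg 0 e) : Complex.normSq z ≤ 1184 := by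
  refine normSq_le_of_mem_segment ?_ ?_ hz <;> rw [normSq_toComplex]
  · exact_mod_cast (norm_base e.1).1
  · rw [zero_add]
    exact_mod_cast norm_point e he

theorem lt_normSq_of_mem_patternSeg {e : Pattern} (he : e ∈ patterns) {z : ℂ}
    (hz : z ∈ patternSeg 0 e) : 74 < Complex.normSq z := by
  rw [patternSeg, zero_add] at hz
  obtain ⟨h1, h2, h3, h4⟩ := far_edges e he
  have hn : Complex.normSq (toComplex (point 0 e.1 + point e.2.2 e.2.1)) =
      intDot (point 0 e.1 + point e.2.2 e.2.1) (point 0 e.1 + point e.2.2 e.2.1) := by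
    rw [normSq_toComplex, intDot, sq, sq]
  refine lt_normSq_of_mem_segment (n := toComplex (point 0 e.1 + point e.2.2 e.2.1))
    ?_ ?_ ?_ ?_ hz <;> rw [dot_toComplex]
  · exact_mod_cast h1
  · rw [hn]; exact_mod_cast h2
  · exact_mod_cast h3
  · rw [hn]; exact_mod_cast h4

/-- An edge lies in an annulus whose radii are determined by its layer. -/
theorem normSq_bounds_of_mem_seg {x : Edge} (hx : x.2 ∈ patterns) {z : ℂ} (hz : z ∈ x.seg) :
    74 * 2 ^ x.1 < Complex.normSq z ∧ Complex.normSq z ≤ 1184 * 2 ^ x.1 := by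
  obtain ⟨i, e⟩ := x
  rw [seg_eq] at hz
  obtain ⟨w, hw, rfl⟩ := hz
  have h2 : (0 : ℝ) < 2 ^ i := by positivity
  simp only [map_mul, normSq_ratio_zpow]
  constructor
  · nlinarith [lt_normSq_of_mem_patternSeg hx hw]
  · nlinarith [normSq_le_of_mem_patternSeg hx hw]

theorem normSq_bounds_pos (v : ℤ × Fin 10) :
    74 * 2 ^ v.1 < Complex.normSq (pos v) ∧ Complex.normSq (pos v) ≤ 1184 * 2 ^ v.1 := by
  have h2 : (0 : ℝ) < 2 ^ v.1 := by positivity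
  obtain ⟨h, h'⟩ := norm_base v.2
  have h : Complex.normSq (toComplex (base v.2)) ≤ 1184 := by
    rw [normSq_toComplex]; exact_mod_cast h
  have h' : 74 < Complex.normSq (toComplex (base v.2)) := by
    rw [normSq_toComplex]; exact_mod_cast h'
  rw [pos, map_mul, normSq_ratio_zpow]
  constructor <;> nlinarith

theorem inner_le_outer {i j : ℤ} (h : i + 4 ≤ j) : (1184 : ℝ) * 2 ^ i ≤ 74 * 2 ^ j := by
  have : (2 : ℝ) ^ (i + 4) ≤ 2 ^ j := zpow_le_zpow_right₀ (by norm_num) h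
  rw [zpow_add₀ (by norm_num)] at this
  norm_num at this
  linarith

/-! #### Edges and vertices -/

theorem eq_or_eq_of_pos_mem_seg {x : Edge} (hx : x.2 ∈ patterns) {v : ℤ × Fin 10}
    (hv : pos v ∈ x.seg) : v = x.src ∨ v = x.tgt := by
  obtain ⟨i, e⟩ := x
  obtain ⟨j, a⟩ := v
  obtain ⟨hl, hu⟩ := normSq_bounds_of_mem_seg hx hv
  obtain ⟨hl', hu'⟩ := normSq_bounds_pos (j, a)
  simp only [Edge.src, Edge.tgt, Prod.mk.injEq] at *
  have h1 : ¬ i + 4 ≤ j := fun h => by linarith [inner_le_outer h]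
  have h2 : ¬ j + 4 ≤ i := fun h => by linarith [inner_le_outer h]
  rcases le_total i j with h | h
  · obtain ⟨k, rfl⟩ := Int.le.dest h
    rw [pos_add, seg_eq, (mul_ratio_injective i).mem_set_image, patternSeg, zero_add] at hv
    rcases near_vertices_above k (List.mem_range.2 (by omega)) e hx a with h | h | h
    · left; omega
    · right; omega
    · exact absurd (left_mem_segment ℝ _ _) (Set.disjoint_left.1 h.disjoint hv)
  · obtain ⟨k, rfl⟩ := Int.le.dest h
    have hp : pos (j, a) = ratio ^ j * toComplex (point 0 a) := by simpa using pos_add j 0 a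
    rw [hp, seg_add, (mul_ratio_injective j).mem_set_image, patternSeg] at hv
    rcases near_vertices_below k (List.mem_range.2 (by omega)) e hx a with h | h | h
    · left; omega
    · right; omega
    · exact absurd hv (Set.disjoint_left.1 h.disjoint (left_mem_segment ℝ _ _))

theorem pos_src_ne_pos_tgt {x : Edge} (hx : x.2 ∈ patterns) : pos x.src ≠ pos x.tgt := by
  obtain ⟨i, e⟩ := x
  intro h
  have hs : pos (i, e.1) = ratio ^ i * toComplex (point 0 e.1) := by simpa using pos_add i 0 e.1
  rw [Edge.src, Edge.tgt, pos_add, hs] at h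
  have h' : toComplex (point 0 e.1) = toComplex (point e.2.2 e.2.1) := mul_ratio_injective i h
  refine endpoints_ne e hx (Prod.ext ?_ ?_)
  · exact Int.cast_injective (congrArg Complex.re h')
  · exact Int.cast_injective (congrArg Complex.im h')

theorem pos_injective : Function.Injective pos := by
  intro v w h
  obtain ⟨e, he, ha⟩ := exists_pattern v.2
  obtain ⟨x, hx, hv⟩ : ∃ x : Edge, x.2 ∈ patterns ∧ (v = x.src ∨ v = x.tgt) := by
    rcases ha with ha | ha
    · exact ⟨(v.1, e), he, Or.inl (Prod.ext rfl ha.symm)⟩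
    · exact ⟨(v.1 - e.2.2, e), he, Or.inr (Prod.ext (by simp [Edge.tgt]) ha.symm)⟩
  have hmem : pos w ∈ x.seg := by
    rw [← h]
    rcases hv with rfl | rfl
    · exact left_mem_segment ℝ _ _
    · exact right_mem_segment ℝ _ _
  have hne := pos_src_ne_pos_tgt hx
  rcases hv with rfl | rfl <;> rcases eq_or_eq_of_pos_mem_seg hx hmem with rfl | rfl
  · rfl
  · exact absurd h hne
  · exact absurd h.symm hne
  · rfl

/-! #### Pairs of edges -/

/-- The vertex `v` is an endpoint of the edge `x`. -/
def Edge.IsEnd (x : Edge) (v : ℤ × Fin 10) : Prop := v = x.src ∨ v = x.tgt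

/-- The edges `x` and `y` are listed as crossing, with `x` starting first. -/
def CrossesAbove (x y : Edge) : Prop := ∃ k : ℕ, y.1 = x.1 + k ∧ (x.2, y.2, k) ∈ crossingPatterns

theorem crossing_partner_unique {x y z : Edge} (hy : CrossesAbove x y ∨ CrossesAbove y x)
    (hz : CrossesAbove x z ∨ CrossesAbove z x) : y = z := by
  rcases hy with ⟨k, hk, hy⟩ | ⟨k, hk, hy⟩ <;> rcases hz with ⟨l, hl, hz⟩ | ⟨l, hl, hz⟩
  · have h := (crossingPatterns_unique _ hy _ hz).1 rfl
    simp only [Prod.mk.injEq, true_and] at h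
    exact Prod.ext (by omega) h.1
  · exact absurd rfl (crossingPatterns_unique _ hy _ hz).2.1
  · exact absurd rfl (crossingPatterns_unique _ hz _ hy).2.1
  · have h := (crossingPatterns_unique _ hy _ hz).2.2 rfl
    simp only [Prod.mk.injEq, true_and] at h
    exact Prod.ext (by omega) h.1

/-- The possible relative positions of two edges. -/
def Compatible (x y : Edge) : Prop :=
  Disjoint x.seg y.seg ∨ ((x.seg ∩ y.seg).Subsingleton ∧
    ((∃ v, x.IsEnd v ∧ y.IsEnd v) ∨ CrossesAbove x y ∨ CrossesAbove y x))

theorem Compatible.symm {x y : Edge} (h : Compatible x y) : Compatible y x := by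
  rcases h with h | ⟨h, h'⟩
  · exact Or.inl h.symm
  · refine Or.inr ⟨Set.inter_comm _ _ ▸ h, ?_⟩
    rcases h' with ⟨v, hv, hv'⟩ | h' | h'
    · exact Or.inl ⟨v, hv', hv⟩
    · exact Or.inr (Or.inr h')
    · exact Or.inr (Or.inl h')

theorem ShareEndpoint.exists_isEnd {e f : Pattern} {k : ℕ} (h : ShareEndpoint e f k) (i : ℤ) :
    ∃ v, Edge.IsEnd (i, e) v ∧ Edge.IsEnd (i + k, f) v := by
  rcases h with ⟨h, h'⟩ | ⟨h, h'⟩ | ⟨h, h'⟩ | ⟨h, h'⟩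
  · exact ⟨_, Or.inl rfl, Or.inl (Prod.ext (by simp [Edge.src, ← h]) h')⟩
  · exact ⟨_, Or.inl rfl, Or.inr (Prod.ext (by simp only [Edge.src, Edge.tgt]; omega) h')⟩
  · exact ⟨_, Or.inr rfl, Or.inl (Prod.ext (by simp only [Edge.src, Edge.tgt]; omega) h')⟩
  · exact ⟨_, Or.inr rfl, Or.inr (Prod.ext (by simp only [Edge.tgt]; omega) h')⟩

theorem compatible_of_le {x y : Edge} (hx : x.2 ∈ patterns) (hy : y.2 ∈ patterns) (hne : x ≠ y)
    (hle : x.1 ≤ y.1) : Compatible x y := by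
  obtain ⟨i, e⟩ := x
  obtain ⟨j, f⟩ := y
  obtain ⟨k, rfl⟩ := Int.le.dest hle
  by_cases hk : k < 4
  · rw [Compatible, seg_add, seg_eq, Set.disjoint_image_iff (mul_ratio_injective i),
      ← Set.image_inter (mul_ratio_injective i), patternSeg, zero_add, patternSeg]
    rcases near_edges k (List.mem_range.2 hk) e hx f hy with ⟨rfl, rfl⟩ | h | ⟨h, h'⟩
    · simp at hne
    · exact Or.inl h.disjoint
    · refine Or.inr ⟨h.subsingleton.image _, ?_⟩
      rcases h' with h' | h' | ⟨rfl, h'⟩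
      · exact Or.inl (h'.exists_isEnd i)
      · exact Or.inr (Or.inl ⟨k, rfl, h'⟩)
      · exact Or.inr (Or.inr ⟨0, by simp, h'⟩)
  · refine Or.inl (Set.disjoint_left.2 fun z hz hz' => ?_)
    have h := (normSq_bounds_of_mem_seg hx hz).2
    have h' := (normSq_bounds_of_mem_seg hy hz').1
    have := inner_le_outer (i := i) (j := i + k) (by omega)
    simp only at h h'
    linarith

theorem compatible {x y : Edge} (hx : x.2 ∈ patterns) (hy : y.2 ∈ patterns) (hne : x ≠ y) :
    Compatible x y := by
  rcases le_total x.1 y.1 with h | h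
  · exact compatible_of_le hx hy hne h
  · exact (compatible_of_le hy hx hne.symm h).symm

/-! #### The drawing -/

/-- The interior of the segment representing an edge. -/
def Edge.openSeg (x : Edge) : Set ℂ := openSegment ℝ (pos x.src) (pos x.tgt)

theorem pos_notMem_openSeg {x : Edge} (hx : x.2 ∈ patterns) {v : ℤ × Fin 10} (hv : x.IsEnd v) :
    pos v ∉ x.openSeg := by
  have hne := pos_src_ne_pos_tgt hx
  intro h
  rcases hv with rfl | rfl
  · exact hne (left_mem_openSegment_iff.1 h)
  · exact hne (right_mem_openSegment_iff.1 h)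

theorem Edge.IsEnd.pos_mem_seg {x : Edge} {v : ℤ × Fin 10} (hv : x.IsEnd v) : pos v ∈ x.seg := by
  rcases hv with rfl | rfl
  · exact left_mem_segment ℝ _ _
  · exact right_mem_segment ℝ _ _

theorem crosses_of_openSeg_inter {x y : Edge} (hx : x.2 ∈ patterns) (hy : y.2 ∈ patterns)
    (hne : x ≠ y) (h : (x.openSeg ∩ y.openSeg).Nonempty) :
    CrossesAbove x y ∨ CrossesAbove y x := by
  obtain ⟨z, hzx, hzy⟩ := h
  have hzx' : z ∈ x.seg := openSegment_subset_segment _ _ _ hzx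
  have hzy' : z ∈ y.seg := openSegment_subset_segment _ _ _ hzy
  rcases compatible hx hy hne with h | ⟨h, ⟨v, hv, hv'⟩ | h'⟩
  · exact absurd hzy' (Set.disjoint_left.1 h hzx')
  · obtain rfl : z = pos v := h ⟨hzx', hzy'⟩ ⟨hv.pos_mem_seg, hv'.pos_mem_seg⟩
    exact absurd hzx (pos_notMem_openSeg hx hv)
  · exact h'

theorem exists_edge {u v : ℤ × Fin 10} (h : graph.Adj u v) :
    ∃ x : Edge, x.2 ∈ patterns ∧ s(x.src, x.tgt) = s(u, v) ∧
      segment ℝ (pos u) (pos v) = x.seg ∧ openSegment ℝ (pos u) (pos v) = x.openSeg := by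
  obtain ⟨e, he, ⟨h1, h2, h3⟩ | ⟨h1, h2, h3⟩⟩ := h
  · have hu : u = Edge.src (u.1, e) := Prod.ext rfl h1
    have hv : v = Edge.tgt (u.1, e) := Prod.ext h3 h2
    refine ⟨(u.1, e), he, ?_, ?_, ?_⟩
    · rw [← hu, ← hv]
    · rw [Edge.seg, ← hu, ← hv]
    · rw [Edge.openSeg, ← hu, ← hv]
  · have hv : v = Edge.src (v.1, e) := Prod.ext rfl h1
    have hu : u = Edge.tgt (v.1, e) := Prod.ext h3 h2
    refine ⟨(v.1, e), he, ?_, ?_, ?_⟩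
    · rw [← hu, ← hv, Sym2.eq_swap]
    · rw [segment_symm, Edge.seg, ← hu, ← hv]
    · rw [openSegment_symm, Edge.openSeg, ← hu, ← hv]

theorem isStraightOnePlane : IsStraightOnePlane graph pos := by
  refine ⟨pos_injective, ?_, ?_, ?_⟩
  · intro u v huv w hw
    obtain ⟨x, hx, he, hs, -⟩ := exists_edge huv
    rw [← Sym2.mem_iff, ← he, Sym2.mem_iff]
    exact eq_or_eq_of_pos_mem_seg hx (hs ▸ hw)
  · intro u v u' v' huv huv' hne
    obtain ⟨x, hx, he, hs, -⟩ := exists_edge huv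
    obtain ⟨y, hy, he', hs', -⟩ := exists_edge huv'
    rw [hs, hs']
    have hxy : x ≠ y := by
      rintro rfl
      exact hne (he.symm.trans he')
    rcases compatible hx hy hxy with h | h
    · rw [h.inter_eq]
      exact Set.subsingleton_empty
    · exact h.1
  · intro u v u₁ v₁ u₂ v₂ huv huv₁ huv₂ hne₁ hne₂ h₁ h₂
    obtain ⟨x, hx, he, -, hs⟩ := exists_edge huv
    obtain ⟨y, hy, he₁, -, hs₁⟩ := exists_edge huv₁
    obtain ⟨z, hz, he₂, -, hs₂⟩ := exists_edge huv₂
    rw [hs, hs₁] at h₁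
    rw [hs, hs₂] at h₂
    have hxy : x ≠ y := by
      rintro rfl
      exact hne₁ (he.symm.trans he₁)
    have hxz : x ≠ z := by
      rintro rfl
      exact hne₂ (he.symm.trans he₂)
    rw [← he₁, ← he₂, crossing_partner_unique (crosses_of_openSeg_inter hx hy hxy h₁)
      (crosses_of_openSeg_inter hx hz hxz h₂)]

/-! #### Finite induced subgraphs -/

/-- The vertices of the finite subgraphs, listed layer by layer. -/
def vertex {n : ℕ} (v : Fin n) : ℤ × Fin 10 :=
  ((v / 10 : ℕ), ⟨v % 10, Nat.mod_lt _ (by norm_num)⟩)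

theorem vertex_injective (n : ℕ) : Function.Injective (vertex (n := n)) := by
  intro v w h
  simp only [vertex, Prod.mk.injEq, Fin.mk.injEq, Nat.cast_inj] at h
  exact Fin.ext (by omega)

/-- The subgraph of the periodic graph induced on the first `n` vertices. -/
def finiteGraph (n : ℕ) : SimpleGraph (Fin n) := graph.comap vertex

theorem kPlanar_finiteGraph (n : ℕ) : KPlanar (finiteGraph n) 1 :=
  ((isStraightOnePlane.comap (vertex_injective n)).map
    (Complex.equivRealProdCLM.toLinearEquiv : ℂ →ₗ[ℝ] ℝ × ℝ)
    Complex.equivRealProdCLM.injective).kPlanar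

theorem hasNoCycleOfLength_four (n : ℕ) : HasNoCycleOfLength (finiteGraph n) 4 := by
  intro a c hc hlen
  have hnodup := hc.support_nodup
  cases c with
  | nil => simp at hlen
  | @cons _ b _ h₁ p =>
    cases p with
    | nil => simp at hlen
    | @cons _ d _ h₂ p =>
      cases p with
      | nil => simp at hlen
      | @cons _ f _ h₃ p =>
        cases p with
        | nil => simp at hlen
        | @cons _ g _ h₄ p =>
          cases p with
          | cons _ _ => simp at hlen
          | nil =>
            simp only [SimpleGraph.Walk.support_cons, SimpleGraph.Walk.support_nil,
              List.tail_cons, List.nodup_cons, List.mem_cons, List.not_mem_nil, or_false,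
              not_or] at hnodup
            obtain ⟨⟨-, hbf, -⟩, ⟨-, hda⟩, -⟩ := hnodup
            have had : vertex a ≠ vertex d := (vertex_injective n).ne (Ne.symm hda)
            exact hbf (vertex_injective n (common_neighbor_unique had h₁ h₂ h₄.symm h₃.symm))

theorem pattern_le_three : ∀ e ∈ patterns, e.2.2 ≤ 3 := by
  decide +kernel

theorem patterns_antisymm : ∀ e ∈ patterns, ∀ f ∈ patterns, e.1 = f.2.1 → e.2.1 = f.1 →
    e.2.2 + f.2.2 ≠ 0 := by
  decide +kernel

theorem card_patterns : patterns.toFinset.card = 24 := by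
  decide +kernel

theorem edge_eq_of_ends_eq {x y : Edge} (hx : x.2 ∈ patterns) (hy : y.2 ∈ patterns)
    (h : s(x.src, x.tgt) = s(y.src, y.tgt)) : x = y := by
  obtain ⟨i, a, b, d⟩ := x
  obtain ⟨j, a', b', d'⟩ := y
  simp only [Edge.src, Edge.tgt, Sym2.eq_iff, Prod.mk.injEq] at h
  rcases h with ⟨⟨rfl, rfl⟩, h, rfl⟩ | ⟨⟨h₁, h₂⟩, h₃, h₄⟩
  · obtain rfl : d = d' := by omega
    rfl
  · have := patterns_antisymm _ hx _ hy h₂ h₄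
    simp only at this
    omega

theorem exists_vertex {n i : ℕ} (h : i < n / 10) (a : Fin 10) :
    ∃ v : Fin n, vertex v = ((i : ℤ), a) := by
  refine ⟨⟨10 * i + a, by omega⟩, Prod.ext ?_ (Fin.ext ?_)⟩
  · simp only [vertex, Nat.cast_inj]
    omega
  · simp only [vertex]
    omega

theorem le_ncard_edgeSet (n : ℕ) : 24 * (n / 10 - 3) ≤ (finiteGraph n).edgeSet.ncard := by
  set S : Finset (ℕ × Pattern) := Finset.range (n / 10 - 3) ×ˢ patterns.toFinset
  have hS : ∀ x ∈ S, x.1 + 3 < n / 10 ∧ x.2 ∈ patterns := fun x hx => by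
    simp only [S, Finset.mem_product, Finset.mem_range, List.mem_toFinset] at hx
    exact ⟨by omega, hx.2⟩
  let ends : ℕ × Pattern → Sym2 (ℤ × Fin 10) := fun x =>
    s(Edge.src (x.1, x.2), Edge.tgt (x.1, x.2))
  have hinj : Set.InjOn ends S := fun x hx y hy hxy => by
    have h := edge_eq_of_ends_eq (hS x hx).2 (hS y hy).2 hxy
    simp only [Prod.mk.injEq, Nat.cast_inj] at h
    exact Prod.ext h.1 h.2
  have hsub : ends '' S ⊆ Sym2.map vertex '' (finiteGraph n).edgeSet := by
    rintro _ ⟨x, hx, rfl⟩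
    obtain ⟨hi, he⟩ := hS x hx
    have := pattern_le_three _ he
    obtain ⟨u, hu⟩ := exists_vertex (n := n) (i := x.1) (by omega) x.2.1
    obtain ⟨v, hv⟩ := exists_vertex (n := n) (i := x.1 + x.2.2.2) (by omega) x.2.2.1
    refine ⟨s(u, v), ⟨x.2, he, Or.inl ?_⟩, ?_⟩
    · rw [hu, hv]
      exact ⟨rfl, rfl, by simp⟩
    · rw [Sym2.map_mk, hu, hv]
      simp [ends, Edge.src, Edge.tgt]
  calc 24 * (n / 10 - 3) = S.card := by
        rw [Finset.card_product, card_patterns, Finset.card_range, mul_comm]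
    _ = (ends '' S).ncard := by rw [hinj.ncard_image, Set.ncard_coe_finset]
    _ ≤ (Sym2.map vertex '' (finiteGraph n).edgeSet).ncard :=
        Set.ncard_le_ncard hsub (Set.toFinite _)
    _ ≤ _ := Set.ncard_image_le (Set.toFinite _)

end Spiral

theorem stmt_6 :
    ∃ (C : ℝ) (N : ℕ), 0 ≤ C ∧ ∀ n : ℕ, N ≤ n →
      ∃ G : SimpleGraph (Fin n), HasNoCycleOfLength G 4 ∧ KPlanar G 1 ∧
        (12 / 5 : ℝ) * n - C ≤ G.edgeSet.ncard := by
  refine ⟨100, 0, by norm_num, fun n _ => ⟨Spiral.finiteGraph n, Spiral.hasNoCycleOfLength_four n,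
    Spiral.kPlanar_finiteGraph n, ?_⟩⟩
  have h : 24 * n ≤ 10 * (Spiral.finiteGraph n).edgeSet.ncard + 1000 := by
    have := Spiral.le_ncard_edgeSet n
    omega
  have h' : (24 : ℝ) * n ≤ 10 * (Spiral.finiteGraph n).edgeSet.ncard + 1000 := by
    exact_mod_cast h
  linarith
end
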